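/- Let δ₃ = 0.074267, δ₄ = 0.103974, δ_ℓ = 0.124821 for ℓ ≥ 5, and θ_ℓ = ℓ − δ_ℓ. For every integer ℓ ≥ 3, setting α = 2θ_ℓ/(3θ_ℓ − 2), the quadruple (3, ℓ; α, α) is admissible: for every ε > 0 there exists M such that for every integer m ≥ M and every integer a with gcd(a,m) = 1, there exist primes p₁, p₂, p₃ ≤ m^{α+ε} and a positive integer s ≤ m^{α+ε} which is a product of at most ℓ primes (counted with multiplicity), such that p₁·p₂·p₃·s ≡ a (mod m). -/

import Mathlib

/-- The Greaves sieve constants δ_ℓ. -/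
noncomputable def greavesDelta (l : ℕ) : ℝ :=
  if l ≤ 2 then 0.044560
  else if l = 3 then 0.074267
  else if l = 4 then 0.103974
  else 0.124821

/-- θ_ℓ = ℓ - δ_ℓ. -/
noncomputable def greavesTheta (l : ℕ) : ℝ := l - greavesDelta l


open Finset in
/-- sum of log p / p over primes p < n -/
noncomputable def mertA (n : ℕ) : ℝ := ∑ p ∈ (Finset.range n).filter Nat.Prime, Real.log p / p

/-- primes in [a,b) -/
noncomputable def pr (a b : ℝ) : Finset ℕ :=
  (Finset.range ⌈b⌉₊).filter (fun p => p.Prime ∧ a ≤ (p : ℝ))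

lemma mem_pr {a b : ℝ} {p : ℕ} : p ∈ pr a b ↔ p.Prime ∧ a ≤ (p : ℝ) ∧ (p : ℝ) < b := by
  simp only [pr, Finset.mem_filter, Finset.mem_range, Nat.lt_ceil]
  tauto

lemma log_fact_eq (n : ℕ) : Real.log (n.factorial : ℝ) =
    ∑ p ∈ (Finset.range (n+1)).filter Nat.Prime, (n.factorial.factorization p : ℝ) * Real.log p := by
  rw [Real.log_nat_eq_sum_factorization, Finsupp.sum]
  apply Finset.sum_subset
  · intro p hp
    have h1 := Nat.prime_of_mem_primeFactors (by simpa using hp)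
    have h2 := Nat.dvd_of_mem_primeFactors (n := n.factorial) (p := p) (by simpa using hp)
    simp only [Finset.mem_filter, Finset.mem_range]
    exact ⟨Nat.lt_succ_of_le ((h1.dvd_factorial).1 h2), h1⟩
  · intro p _ hp
    have : n.factorial.factorization p = 0 := Finsupp.notMem_support_iff.1 hp
    simp [this]

lemma mertA_upper (n : ℕ) (hn : 1 ≤ n) : mertA (n+1) ≤ Real.log n + Real.log 4 := by
  have hn0 : (0:ℝ) < n := by exact_mod_cast hn
  have h1 : Real.log (n.factorial : ℝ) ≤ n * Real.log n := by
    rw [← Real.log_pow]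
    apply Real.log_le_log (by exact_mod_cast n.factorial_pos)
    exact_mod_cast n.factorial_le_pow
  have h2 : ∑ p ∈ (Finset.range (n+1)).filter Nat.Prime, ((n:ℝ) / p - 1) * Real.log p
      ≤ Real.log (n.factorial : ℝ) := by
    rw [log_fact_eq]
    apply Finset.sum_le_sum
    intro p hp
    simp only [Finset.mem_filter, Finset.mem_range] at hp
    have hp2 := hp.2.two_le
    apply mul_le_mul_of_nonneg_right _ (Real.log_nonneg (by exact_mod_cast (by lia : 1 ≤ p)))
    have h3 : n / p ≤ n.factorial.factorization p := by
      rw [Nat.factorization_factorial hp.2 (Nat.lt_succ_self (Nat.log p n))]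
      have : n / p = n / p ^ 1 := by simp
      rw [this]
      apply Finset.single_le_sum (f := fun i => n / p ^ i) (fun _ _ => Nat.zero_le _)
      simp only [Finset.mem_Ico, le_refl, true_and]
      have := Nat.log_pos hp.2.one_lt (by lia : p ≤ n)
      lia
    have h4 : (n:ℝ) / p - 1 ≤ ((n / p : ℕ) : ℝ) := by
      have := Nat.lt_floor_add_one ((n:ℝ) / p)
      rw [Nat.floor_div_eq_div] at this
      linarith
    exact h4.trans (by exact_mod_cast h3)
  have h3 : ∑ p ∈ (Finset.range (n+1)).filter Nat.Prime, ((n:ℝ) / p - 1) * Real.log p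
     = n * mertA (n+1) - Chebyshev.theta n := by
    rw [Chebyshev.theta_eq_sum_Icc, mertA, Finset.mul_sum]
    have : (Finset.Icc 0 ⌊(n:ℝ)⌋₊).filter Nat.Prime = (Finset.range (n+1)).filter Nat.Prime := by
      ext p; simp
    rw [this, ← Finset.sum_sub_distrib]
    apply Finset.sum_congr rfl
    intros; ring
  have h4 := Chebyshev.theta_le_log4_mul_x hn0.le
  have : n * mertA (n+1) ≤ n * (Real.log n + Real.log 4) := by nlinarith
  exact le_of_mul_le_mul_left this hn0

lemma mertA_lower : ∃ C : ℝ, 0 < C ∧ ∀ n : ℕ, 1 ≤ n → Real.log n - C ≤ mertA (n+1) := by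
  have hsum : Summable (fun n : ℕ => 4 * ((n:ℝ) ^ (3/2:ℝ))⁻¹) :=
    (Real.summable_nat_rpow_inv.2 (by norm_num)).mul_left 4
  refine ⟨1 + ∑' n : ℕ, 4 * ((n:ℝ) ^ (3/2:ℝ))⁻¹, ?_, ?_⟩
  · have : 0 ≤ ∑' n : ℕ, 4 * ((n:ℝ) ^ (3/2:ℝ))⁻¹ := tsum_nonneg (fun n => by positivity)
    linarith
  intro n hn
  have hn0 : (0:ℝ) < n := by exact_mod_cast hn
  have h1 : n * Real.log n - n ≤ Real.log (n.factorial : ℝ) := by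
    have := Stirling.le_log_factorial_stirling (n := n) (by lia)
    have h2 : 0 ≤ Real.log n := Real.log_nonneg (by exact_mod_cast hn)
    have h3 : 0 ≤ Real.log (2 * Real.pi) := Real.log_nonneg (by nlinarith [Real.pi_gt_three])
    linarith
  have h2 : Real.log (n.factorial : ℝ) ≤ ∑ p ∈ (Finset.range (n+1)).filter Nat.Prime,
      n * (Real.log p / p + 4 * ((p:ℝ) ^ (3/2:ℝ))⁻¹) := by
    rw [log_fact_eq]
    apply Finset.sum_le_sum
    intro p hp
    simp only [Finset.mem_filter, Finset.mem_range] at hp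
    have hp2 : (2:ℝ) ≤ p := by exact_mod_cast hp.2.two_le
    have hl : 0 ≤ Real.log p := Real.log_nonneg (by linarith)
    have h3 : (n.factorial.factorization p : ℝ) ≤ n / ((p:ℝ) - 1) := by
      have := Nat.factorization_factorial_le_div_pred hp.2 n
      have h4 : ((n / (p - 1) : ℕ) : ℝ) ≤ (n:ℝ) / ((p - 1 : ℕ) : ℝ) := Nat.cast_div_le
      rw [Nat.cast_sub hp.2.one_le] at h4
      refine le_trans (Nat.cast_le.2 this) (by simpa using h4)
    have h5 : Real.log p ≤ 2 * (p:ℝ) ^ (1/2:ℝ) := by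
      have := Real.log_le_rpow_div (x := (p:ℝ)) (by linarith) (by norm_num : (0:ℝ) < 1/2)
      linarith
    have h6 : (p:ℝ) ^ (1/2:ℝ) / (p:ℝ)^2 = ((p:ℝ) ^ (3/2:ℝ))⁻¹ := by
      rw [← Real.rpow_natCast, ← Real.rpow_sub (by linarith), ← Real.rpow_neg (by linarith)]
      norm_num
    have h7 : Real.log p / (p - 1) ≤ Real.log p / p + 4 * ((p:ℝ) ^ (3/2:ℝ))⁻¹ := by
      have : Real.log p / (p - 1) = Real.log p / p + Real.log p / (p * (p - 1)) := by
        field_simp [(by linarith : (p:ℝ) - 1 ≠ 0)]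
        ring
      rw [this, ← h6]
      have h8 : Real.log p / (p * (p - 1)) ≤ (2 * (p:ℝ) ^ (1/2:ℝ)) / (p^2/2) := by
        apply div_le_div₀ (by positivity) h5 (by positivity)
        nlinarith
      have h9 : (2 * (p:ℝ) ^ (1/2:ℝ)) / ((p:ℝ)^2/2) = 4 * ((p:ℝ) ^ (1/2:ℝ) / (p:ℝ)^2) := by
        field_simp; ring
      linarith
    calc (n.factorial.factorization p : ℝ) * Real.log p ≤ n / ((p:ℝ) - 1) * Real.log p := by gcongr
      _ = n * (Real.log p / (p - 1)) := by ring
      _ ≤ _ := by gcongr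
  rw [← Finset.mul_sum, Finset.sum_add_distrib] at h2
  have h3 : ∑ p ∈ (Finset.range (n+1)).filter Nat.Prime, 4 * ((p:ℝ) ^ (3/2:ℝ))⁻¹ ≤
      ∑' n : ℕ, 4 * ((n:ℝ) ^ (3/2:ℝ))⁻¹ := hsum.sum_le_tsum _ (fun n _ => by positivity)
  rw [← mertA] at h2
  have : n * (Real.log n - 1) ≤ n * (mertA (n+1) + ∑' n : ℕ, 4 * ((n:ℝ) ^ (3/2:ℝ))⁻¹) := by
    nlinarith
  have := le_of_mul_le_mul_left this hn0
  linarith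

lemma mertens_interval : ∃ C : ℝ, 0 < C ∧ ∀ a b : ℝ, 1 ≤ a → a ≤ b →
    ∑ p ∈ pr a b, Real.log p / p ≤ Real.log b - Real.log a + C := by
  obtain ⟨C, hC, hlow⟩ := mertA_lower
  refine ⟨C + Real.log 2 + Real.log 4, by positivity, ?_⟩
  intro a b ha hab
  have hl2 : 0 < Real.log 2 := Real.log_pos (by norm_num)
  have hl4 : 0 < Real.log 4 := Real.log_pos (by norm_num)
  have h1 : ∑ p ∈ pr a b, Real.log p / p = mertA ⌈b⌉₊ - mertA ⌈a⌉₊ := by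
    rw [mertA, mertA, eq_sub_iff_add_eq, ← Finset.sum_union]
    · apply Finset.sum_congr _ (fun _ _ => rfl)
      ext p
      simp only [Finset.mem_union, mem_pr, Finset.mem_filter, Finset.mem_range, Nat.lt_ceil]
      constructor
      · rintro (⟨h1, h2, h3⟩ | ⟨h1, h2⟩)
        · exact ⟨h3, h1⟩
        · exact ⟨h1.trans_le hab, h2⟩
      · rintro ⟨h1, h2⟩
        rcases le_or_gt a p with h | h
        · exact Or.inl ⟨h2, h, h1⟩
        · exact Or.inr ⟨h, h2⟩
    · rw [Finset.disjoint_left]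
      intro p hp hp'
      simp only [mem_pr, Finset.mem_filter, Finset.mem_range, Nat.lt_ceil] at hp hp'
      linarith [hp.2.1, hp'.1]
  have hb : mertA ⌈b⌉₊ ≤ Real.log b + Real.log 4 := by
    obtain ⟨n, hn⟩ : ∃ n, ⌈b⌉₊ = n + 1 := ⟨⌈b⌉₊ - 1, by
      have := Nat.ceil_pos.2 (by linarith : 0 < b); lia⟩
    rw [hn]
    have hnb : (n:ℝ) < b := Nat.lt_ceil.1 (by lia)
    rcases Nat.eq_zero_or_pos n with h0 | h0
    · subst h0
      have : mertA (0+1) = 0 := by simp [mertA, Finset.sum_filter]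
      rw [this]
      have := Real.log_nonneg (ha.trans hab)
      linarith
    · have := mertA_upper n h0
      have h3 := Real.log_le_log (by exact_mod_cast h0) hnb.le
      linarith
  have haa : Real.log a - Real.log 2 - C ≤ mertA ⌈a⌉₊ := by
    obtain ⟨n, hn⟩ : ∃ n, ⌈a⌉₊ = n + 1 := ⟨⌈a⌉₊ - 1, by
      have := Nat.ceil_pos.2 (by linarith : 0 < a); lia⟩
    have hna : a ≤ (n:ℝ) + 1 := by
      have := Nat.le_ceil a; rw [hn] at this; exact_mod_cast this
    rw [hn]
    rcases Nat.eq_zero_or_pos n with h0 | h0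
    · subst h0
      have : mertA (0+1) = 0 := by simp [mertA, Finset.sum_filter]
      rw [this]
      have h1 : a = 1 := by norm_num at hna; linarith
      subst h1; simp; linarith
    · have h2 := hlow n h0
      have h3 : Real.log a ≤ Real.log 2 + Real.log n := by
        rw [← Real.log_mul (by norm_num) (by positivity)]
        apply Real.log_le_log (by linarith)
        have : (1:ℝ) ≤ n := by exact_mod_cast h0
        linarith
      linarith
  linarith

/-- reciprocal sums over primes in `[exp (j u), exp ((j+1) u))`. -/
lemma mertens_recip : ∃ C : ℝ, 0 < C ∧ ∀ v w : ℝ, 0 < v → v ≤ w →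
    ∑ p ∈ pr (Real.exp v) (Real.exp w), (1:ℝ) / p ≤ (w - v + C) / v := by
  obtain ⟨C, hC, h⟩ := mertens_interval
  refine ⟨C, hC, ?_⟩
  intro v w hv hvw
  have := h (Real.exp v) (Real.exp w) (Real.one_le_exp hv.le) (Real.exp_le_exp.2 hvw)
  rw [Real.log_exp, Real.log_exp] at this
  rw [le_div_iff₀ hv, Finset.sum_mul]
  refine le_trans (Finset.sum_le_sum ?_) this
  intro p hp
  rw [mem_pr] at hp
  have h1 : v ≤ Real.log p := by
    rw [Real.le_log_iff_exp_le (by exact_mod_cast hp.1.pos)]; exact hp.2.1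
  have h2 : (0:ℝ) < p := by exact_mod_cast hp.1.pos
  rw [div_mul_eq_mul_div, one_mul]
  gcongr

lemma mertens_loglog : ∃ C : ℝ, 0 < C ∧ ∀ s : ℕ,
    ∑ p ∈ pr 1 (Real.exp (2^s)), (1:ℝ) / p ≤ C * (s + 1) := by
  obtain ⟨C, hC, h⟩ := mertens_recip
  refine ⟨3 + C, by positivity, ?_⟩
  intro s
  induction s with
  | zero =>
    have : pr 1 (Real.exp (2^0)) ⊆ {1, 2} := by
      intro p hp
      rw [mem_pr] at hp
      have h3 : (p:ℝ) < 3 := by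
        have := Real.exp_one_lt_d9
        have h4 := hp.2.2
        norm_num at h4 
        linarith
      have : p < 3 := by exact_mod_cast h3
      have := hp.1.two_le
      simp; lia
    refine (Finset.sum_le_sum_of_subset_of_nonneg this (fun _ _ _ => by positivity)).trans ?_
    norm_num
    linarith
  | succ s ih =>
    have hsub : pr 1 (Real.exp (2^(s+1))) ⊆ pr 1 (Real.exp (2^s)) ∪
        pr (Real.exp (2^s)) (Real.exp (2^(s+1))) := by
      intro p hp
      rw [Finset.mem_union, mem_pr, mem_pr]
      rw [mem_pr] at hp
      rcases lt_or_ge (p:ℝ) (Real.exp (2^s)) with h1 | h1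
      · exact Or.inl ⟨hp.1, hp.2.1, h1⟩
      · exact Or.inr ⟨hp.1, h1, hp.2.2⟩
    have h1 := h (2^s) (2^(s+1)) (by positivity) (by
      apply pow_le_pow_right₀ (by norm_num) (by lia))
    have h2 : ((2:ℝ)^(s+1) - 2^s + C) / 2^s ≤ 1 + C := by
      rw [div_le_iff₀ (by positivity)]
      have : (1:ℝ) ≤ 2^s := one_le_pow₀ (by norm_num)
      rw [pow_succ]; nlinarith
    refine (Finset.sum_le_sum_of_subset_of_nonneg hsub (fun _ _ _ => by positivity)).trans ?_
    have h3 := Finset.sum_union_inter (s₁ := pr 1 (Real.exp (2^s)))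
      (s₂ := pr (Real.exp (2^s)) (Real.exp (2^(s+1)))) (f := fun p : ℕ => (1:ℝ)/p)
    have h4 : 0 ≤ ∑ p ∈ pr 1 (Real.exp (2^s)) ∩ pr (Real.exp (2^s)) (Real.exp (2^(s+1))), (1:ℝ)/p :=
      Finset.sum_nonneg (fun _ _ => by positivity)
    push_cast
    linarith


/-- squarefree k < t coprime to m -/
noncomputable def SF (m : ℕ) (t : ℝ) : Finset ℕ :=
  (Finset.range ⌈t⌉₊).filter (fun k => Squarefree k ∧ k.Coprime m)

lemma mem_SF {m : ℕ} {t : ℝ} {k : ℕ} : k ∈ SF m t ↔ (k:ℝ) < t ∧ Squarefree k ∧ k.Coprime m := by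
  simp only [SF, Finset.mem_filter, Finset.mem_range, Nat.lt_ceil]

noncomputable def GG (m : ℕ) (t : ℝ) : ℝ := ∑ k ∈ SF m t, (1:ℝ) / (k.totient : ℝ)

noncomputable def hh (K : ℕ) : ℝ := ∏ p ∈ K.primeFactors, (1 - ((p:ℝ) ^ (1/2:ℝ))⁻¹)⁻¹

noncomputable def radm (m n : ℕ) : ℕ := ∏ p ∈ n.primeFactors.filter (fun p => ¬ p ∣ m), p

lemma radm_dvd (m n : ℕ) : radm m n ∣ n :=
  (Finset.prod_dvd_prod_of_subset _ _ _ (Finset.filter_subset _ _)).trans (Nat.prod_primeFactors_dvd n)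

lemma radm_primeFactors (m n : ℕ) :
    (radm m n).primeFactors = n.primeFactors.filter (fun p => ¬ p ∣ m) := by
  apply Nat.primeFactors_prod
  intro p hp
  exact Nat.prime_of_mem_primeFactors (Finset.mem_filter.1 hp).1

lemma radm_squarefree (m n : ℕ) : Squarefree (radm m n) := by
  apply Finset.squarefree_prod_of_pairwise_isCoprime
  · intro p hp q hq hpq
    simp only [Function.onFun]
    rw [← Nat.coprime_iff_isRelPrime]
    exact (Nat.coprime_primes (Nat.prime_of_mem_primeFactors (Finset.mem_filter.1 hp).1)
     (Nat.prime_of_mem_primeFactors (Finset.mem_filter.1 hq).1)).2 hpq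
  · intro p hp
    exact (Nat.prime_of_mem_primeFactors (Finset.mem_filter.1 hp).1).squarefree

lemma radm_coprime (m n : ℕ) : (radm m n).Coprime m := by
  apply Nat.Coprime.prod_left
  intro p hp
  have h := Finset.mem_filter.1 hp
  exact (Nat.Prime.coprime_iff_not_dvd (Nat.prime_of_mem_primeFactors h.1)).2 h.2

lemma hasSum_fact_one (K : ℕ) (hK : K ≠ 0) :
    HasSum ((Nat.factoredNumbers K.primeFactors).indicator (fun j : ℕ => ((j:ℝ))⁻¹))
      ((K:ℝ) / K.totient) := by
  rw [← hasSum_subtype_iff_indicator]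
  let f : ℕ →* ℝ := { toFun := fun n => (n:ℝ)⁻¹, map_one' := by simp, map_mul' := (by
    intro a b; push_cast; rw [mul_inv]) }
  have h := (EulerProduct.summable_and_hasSum_factoredNumbers_prod_filter_prime_geometric (f := f)
    (by
      intro p hp
      simp only [f, MonoidHom.coe_mk, OneHom.coe_mk, norm_inv, Real.norm_natCast]
      exact inv_lt_one_of_one_lt₀ (by exact_mod_cast hp.one_lt)) K.primeFactors).2
  suffices heq : (K:ℝ) / K.totient = ∏ p ∈ K.primeFactors with Nat.Prime p, (1 - f p)⁻¹ by
    rw [heq]; exact h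
  have h1 : K.primeFactors.filter Nat.Prime = K.primeFactors :=
    Finset.filter_true_of_mem (fun p hp => Nat.prime_of_mem_primeFactors hp)
  rw [h1]
  have h2 : ((K.totient : ℚ) : ℝ) = ((K * ∏ p ∈ K.primeFactors, (1 - (p:ℚ)⁻¹) : ℚ) : ℝ) := by
    rw [Nat.totient_eq_mul_prod_factors]
  push_cast at h2
  rw [h2]
  simp only [f, MonoidHom.coe_mk, OneHom.coe_mk]
  rw [Finset.prod_inv_distrib]
  have : (K:ℝ) ≠ 0 := by exact_mod_cast hK
  rw [div_mul_eq_div_div, div_self this, one_div]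

lemma hasSum_fact_half (K : ℕ) :
    HasSum ((Nat.factoredNumbers K.primeFactors).indicator (fun j : ℕ => ((j:ℝ) ^ (1/2:ℝ))⁻¹))
      (hh K) := by
  rw [← hasSum_subtype_iff_indicator]
  let f : ℕ →* ℝ := { toFun := fun n => ((n:ℝ) ^ (1/2:ℝ))⁻¹, map_one' := by simp, map_mul' := (by
    intro a b; push_cast; rw [Real.mul_rpow (by positivity) (by positivity), mul_inv]) }
  have h := (EulerProduct.summable_and_hasSum_factoredNumbers_prod_filter_prime_geometric (f := f)
    (by
      intro p hp
      simp only [f, MonoidHom.coe_mk, OneHom.coe_mk, norm_inv]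
      apply inv_lt_one_of_one_lt₀
      rw [Real.norm_of_nonneg (by positivity)]
      exact Real.one_lt_rpow (by exact_mod_cast hp.one_lt) (by norm_num)) K.primeFactors).2
  suffices heq : hh K = ∏ p ∈ K.primeFactors with Nat.Prime p, (1 - f p)⁻¹ by
    rw [heq]; exact h
  have h1 : K.primeFactors.filter Nat.Prime = K.primeFactors :=
    Finset.filter_true_of_mem (fun p hp => Nat.prime_of_mem_primeFactors hp)
  rw [h1]
  rfl

lemma two_pow_card_primeFactors (n : ℕ) (hn : n ≠ 0) : 2 ^ n.primeFactors.card ≤ n := by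
  calc 2 ^ n.primeFactors.card = ∏ p ∈ n.primeFactors, 2 := by simp
    _ ≤ ∏ p ∈ n.primeFactors, p := Finset.prod_le_prod' (fun p hp =>
        (Nat.prime_of_mem_primeFactors hp).two_le)
    _ ≤ n := Nat.le_of_dvd (Nat.pos_of_ne_zero hn) (Nat.prod_primeFactors_dvd n)

lemma card_primeFactors_le (n : ℕ) (hn : n ≠ 0) : (n.primeFactors.card : ℝ) ≤ 2 * Real.log n := by
  have h := two_pow_card_primeFactors n hn
  have h1 : Real.log ((2:ℝ) ^ n.primeFactors.card) ≤ Real.log n :=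
    Real.log_le_log (by positivity) (by exact_mod_cast h)
  rw [Real.log_pow] at h1
  have := Real.log_two_gt_d9
  nlinarith [(Nat.cast_nonneg n.primeFactors.card : (0:ℝ) ≤ _)]

lemma hh_factor {p : ℕ} (hp : p.Prime) : 0 < (1 - ((p:ℝ) ^ (1/2:ℝ))⁻¹) ∧
    (1 - ((p:ℝ) ^ (1/2:ℝ))⁻¹)⁻¹ ≤ Real.exp (4 * ((p:ℝ) ^ (1/2:ℝ))⁻¹) := by
  have hp2 : (2:ℝ) ≤ p := by exact_mod_cast hp.two_le
  rw [← Real.sqrt_eq_rpow]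
  have h1 : (4/3:ℝ) ≤ √p := by
    apply Real.le_sqrt_of_sq_le; norm_num; linarith
  have h2 : (√p)⁻¹ ≤ 3/4 := by
    rw [inv_le_comm₀ (by positivity) (by norm_num)]; norm_num; linarith
  have h3 : 0 < (√p)⁻¹ := by positivity
  set w := (√p)⁻¹
  refine ⟨by linarith, ?_⟩
  have h4 := Real.add_one_le_exp (4 * w)
  refine le_trans ?_ h4
  rw [inv_le_iff_one_le_mul₀ (by linarith)]
  nlinarith

noncomputable def EE (m : ℕ) : ℝ := 100 * (Real.log m) ^ (3/4:ℝ)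

lemma hh_pos (K : ℕ) : 0 < hh K :=
  Finset.prod_pos fun _ hp => inv_pos.2 (hh_factor (Nat.prime_of_mem_primeFactors hp)).1

lemma hh_le (m K : ℕ) (hm : 3 ≤ m) (hK : K ≠ 0) (hKm : Real.log K ≤ 2 * Real.log m) :
    hh K ≤ Real.exp (EE m / 5) := by
  have hlm : 1 ≤ Real.log m := by
    rw [Real.le_log_iff_exp_le (by positivity)]
    have := Real.exp_one_lt_d9
    have : (3:ℝ) ≤ m := by exact_mod_cast hm
    linarith
  set v := Real.log m
  have h1 : hh K ≤ Real.exp (∑ p ∈ K.primeFactors, 4 * ((p:ℝ) ^ (1/2:ℝ))⁻¹) := by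
    rw [Real.exp_sum]
    apply Finset.prod_le_prod
    · intro p hp; exact (inv_pos.2 (hh_factor (Nat.prime_of_mem_primeFactors hp)).1).le
    · intro p hp; exact (hh_factor (Nat.prime_of_mem_primeFactors hp)).2
  refine h1.trans (Real.exp_le_exp.2 ?_)
  set A := v ^ (1/2:ℝ)
  set B := v ^ (1/4:ℝ)
  have hB1 : 1 ≤ B := Real.one_le_rpow hlm (by norm_num)
  have hAB : A = B^2 := by
    rw [← Real.rpow_natCast, ← Real.rpow_mul (by linarith)]; norm_num [A]
  have hv : v = B^4 := by
    rw [← Real.rpow_natCast, ← Real.rpow_mul (by linarith)]; norm_num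
  have hE : EE m = 100 * B^3 := by
    rw [EE, ← Real.rpow_natCast, ← Real.rpow_mul (by linarith)]; norm_num [v]
  have h2 : ∑ p ∈ K.primeFactors, ((p:ℝ) ^ (1/2:ℝ))⁻¹ ≤
      ∑ p ∈ K.primeFactors, ((if p ∈ Finset.Icc 1 ⌊A⌋₊ then (1:ℝ) else 0) + B⁻¹) := by
    apply Finset.sum_le_sum
    intro p hp
    have hp' := Nat.prime_of_mem_primeFactors hp
    have hp1 : (1:ℝ) ≤ p := by exact_mod_cast hp'.one_le
    split_ifs with hif
    · have : ((p:ℝ) ^ (1/2:ℝ))⁻¹ ≤ 1 := inv_le_one_of_one_le₀ (Real.one_le_rpow hp1 (by norm_num))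
      have : 0 ≤ B⁻¹ := by positivity
      linarith
    · have : A < p := by
        by_contra hcon
        push Not at hcon
        apply hif
        rw [Finset.mem_Icc]
        exact ⟨hp'.one_le, Nat.le_floor hcon⟩
      rw [zero_add]
      apply inv_anti₀ (by positivity)
      rw [← Real.sqrt_eq_rpow]
      apply Real.le_sqrt_of_sq_le
      rw [← hAB]; exact this.le
  have h3 : ∑ p ∈ K.primeFactors, (if p ∈ Finset.Icc 1 ⌊A⌋₊ then (1:ℝ) else 0) ≤ A := by
    rw [← Finset.sum_filter, Finset.sum_const, nsmul_eq_mul, mul_one]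
    have : (K.primeFactors.filter (fun p => p ∈ Finset.Icc 1 ⌊A⌋₊)).card ≤ ⌊A⌋₊ := by
      calc _ ≤ (Finset.Icc 1 ⌊A⌋₊).card := Finset.card_le_card (by
            intro p hp; exact (Finset.mem_filter.1 hp).2)
        _ = _ := by simp
    calc _ ≤ ((⌊A⌋₊ : ℕ) : ℝ) := by exact_mod_cast this
      _ ≤ A := Nat.floor_le (by positivity)
  have h4 : (K.primeFactors.card : ℝ) * B⁻¹ ≤ 4 * B^3 := by
    have := card_primeFactors_le K hK
    rw [← div_eq_mul_inv, div_le_iff₀ (by positivity)]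
    nlinarith
  rw [Finset.sum_add_distrib, Finset.sum_const, nsmul_eq_mul] at h2
  rw [← Finset.mul_sum, hE]
  have h5 : A ≤ B^3 := by rw [hAB]; apply pow_le_pow_right₀ hB1; norm_num
  linarith

lemma div_totient_le_hh (K : ℕ) (hK : K ≠ 0) : (K:ℝ) / K.totient ≤ hh K := by
  refine hasSum_le ?_ (hasSum_fact_one K hK) (hasSum_fact_half K)
  intro j
  apply Set.indicator_le_indicator
  rcases Nat.eq_zero_or_pos j with h | h
  · subst h; simp
  · have h1 : (1:ℝ) ≤ j := by exact_mod_cast h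
    apply inv_anti₀ (by positivity)
    calc (j:ℝ)^(1/2:ℝ) ≤ (j:ℝ)^(1:ℝ) := Real.rpow_le_rpow_of_exponent_le h1 (by norm_num)
      _ = j := by simp

lemma ratio_split {k m : ℕ} (hk : k ≠ 0) (h : k.Coprime m) :
    (k:ℝ)⁻¹ * (((k * m : ℕ) : ℝ) / (k*m).totient) = ((m:ℝ) / m.totient) * (1 / k.totient) := by
  rw [Nat.totient_mul h]
  push_cast
  have : (k:ℝ) ≠ 0 := by exact_mod_cast hk
  field_simp

lemma GG_lower (m : ℕ) (hm : m ≠ 0) (t : ℝ) (ht : 1 ≤ t) :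
    Real.log t ≤ ((m:ℝ) / m.totient) * GG m t := by
  obtain ⟨N, hN⟩ : ∃ N, ⌈t⌉₊ = N + 1 := ⟨⌈t⌉₊ - 1, by
      have := Nat.ceil_pos.2 (by linarith : 0 < t); lia⟩
  have hNt : t ≤ (N:ℝ) + 1 := by
    have := Nat.le_ceil t; rw [hN] at this; exact_mod_cast this
  have h1 : Real.log t ≤ ∑ n ∈ Finset.Icc 1 N, (n:ℝ)⁻¹ := by
    have h := log_add_one_le_harmonic N
    rw [harmonic_eq_sum_Icc] at h
    push_cast at h
    exact (Real.log_le_log (by linarith) hNt).trans h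
  have hmaps : ∀ n ∈ Finset.Icc 1 N, radm m n ∈ SF m t := by
    intro n hn
    rw [Finset.mem_Icc] at hn
    rw [mem_SF]
    refine ⟨?_, radm_squarefree m n, radm_coprime m n⟩
    have h2 := Nat.le_of_dvd (by lia) (radm_dvd m n)
    exact Nat.lt_ceil.1 (by lia)
  rw [← Finset.sum_fiberwise_of_maps_to hmaps] at h1
  refine h1.trans ?_
  rw [GG, Finset.mul_sum]
  apply Finset.sum_le_sum
  intro k hk
  rw [mem_SF] at hk
  have hk0 : k ≠ 0 := hk.2.1.ne_zero
  rw [← ratio_split hk0 hk.2.2]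
  set S := (Finset.Icc 1 N).filter (fun n => radm m n = k)
  have hdvd : ∀ n ∈ S, k ∣ n := by
    intro n hn
    rw [← (Finset.mem_filter.1 hn).2]; exact radm_dvd m n
  have h2 : ∑ n ∈ S, (n:ℝ)⁻¹ = (k:ℝ)⁻¹ * ∑ j ∈ S.image (fun n => n / k),
      (Nat.factoredNumbers (k*m).primeFactors).indicator (fun j : ℕ => ((j:ℝ))⁻¹) j := by
    rw [Finset.sum_image, Finset.mul_sum]
    · apply Finset.sum_congr rfl
      intro n hn
      obtain ⟨j, rfl⟩ := hdvd n hn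
      have hn' := Finset.mem_filter.1 hn
      rw [Nat.mul_div_cancel_left j (Nat.pos_of_ne_zero hk0)]
      rw [Set.indicator_of_mem]
      · push_cast; rw [mul_inv]
      · rw [Nat.mem_factoredNumbers']
        intro p hp hpj
        rw [Nat.mem_primeFactors]
        refine ⟨hp, ?_, by simp [hk0, hm]⟩
        by_cases hpm : p ∣ m
        · exact hpm.mul_left k
        · apply Dvd.dvd.mul_right
          have hh := hn'.2
          have : p ∈ (radm m (k*j)).primeFactors := by
            rw [radm_primeFactors, Finset.mem_filter, Nat.mem_primeFactors]
            refine ⟨⟨hp, hpj.mul_left k, ?_⟩, hpm⟩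
            have := (Finset.mem_Icc.1 hn'.1).1
            lia
          rw [hh] at this
          exact Nat.dvd_of_mem_primeFactors this
    · intro n hn n' hn' he
      simp only at he
      have h1 := Nat.div_mul_cancel (hdvd n hn)
      have h2 := Nat.div_mul_cancel (hdvd n' hn')
      rw [← h1, ← h2, he]
  rw [h2]
  apply mul_le_mul_of_nonneg_left _ (by positivity)
  apply sum_le_hasSum _ _ (hasSum_fact_one (k*m) (by simp [hk0, hm]))
  intro j _
  apply Set.indicator_nonneg
  intros; positivity

lemma log_ge_one {m : ℕ} (hm : 3 ≤ m) : 1 ≤ Real.log m := by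
  rw [Real.le_log_iff_exp_le (by positivity)]
  have := Real.exp_one_lt_d9
  have : (3:ℝ) ≤ m := by exact_mod_cast hm
  linarith

lemma EE_ge {m : ℕ} (hm : 3 ≤ m) : 100 ≤ EE m := by
  have := Real.one_le_rpow (log_ge_one hm) (by norm_num : (0:ℝ) ≤ 3/4)
  rw [EE]; linarith

lemma log_le_exp_EE {m : ℕ} (hm : 3 ≤ m) : 1 + Real.log m ≤ Real.exp (EE m / 5) := by
  have hv := log_ge_one hm
  set v := Real.log m
  set B := v ^ (1/4:ℝ)
  have hB1 : 1 ≤ B := Real.one_le_rpow hv (by norm_num)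
  have hvB : v = B^4 := by
    rw [← Real.rpow_natCast, ← Real.rpow_mul (by linarith)]; norm_num
  have hE : EE m = 100 * B^3 := by
    rw [EE, ← Real.rpow_natCast, ← Real.rpow_mul (by linarith)]; norm_num [v]
  have h1 := Real.add_one_le_exp (EE m / 10)
  have h2 : Real.exp (EE m / 5) = Real.exp (EE m / 10) ^ 2 := by
    rw [← Real.exp_nat_mul]; congr 1; push_cast; ring
  rw [h2, hvB]
  rw [hE] at h1 ⊢
  have h3 : 1 ≤ B^3 := one_le_pow₀ hB1
  have h4 : B^4 ≤ B^6 := pow_le_pow_right₀ hB1 (by norm_num)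
  have h5 : (100 * B^3/10)^2 ≤ Real.exp (100 * B^3 / 10)^2 := by
    apply pow_le_pow_left₀ (by positivity); linarith
  nlinarith

lemma GG_upper (m : ℕ) (hm : 3 ≤ m) (t : ℝ) (ht : 1 ≤ t) (htm : t ≤ m) :
    ((m:ℝ) / m.totient) * GG m t ≤ Real.log t + EE m := by
  have hm0 : m ≠ 0 := by lia
  set E := EE m / 5 with hEdef
  have hE20 : 20 ≤ E := by have := EE_ge hm; rw [hEdef]; linarith
  set L : ℕ := ⌈Real.exp (4 * E)⌉₊
  have hL : Real.exp (4 * E) ≤ L := Nat.le_ceil _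
  have hL1 : (1:ℝ) ≤ L := le_trans (Real.one_le_exp (by linarith)) hL
  have hLlog : Real.log L ≤ 1 + 4 * E := by
    have h1 : (L:ℝ) ≤ Real.exp (4*E) + 1 := (Nat.ceil_lt_add_one (by positivity)).le
    have h2 : (L:ℝ) ≤ Real.exp (1 + 4 * E) := by
      rw [Real.exp_add]
      have := Real.add_one_le_exp (1:ℝ)
      have := Real.one_le_exp (by linarith : 0 ≤ 4 * E)
      nlinarith
    rw [Real.log_le_iff_le_exp (by linarith)]; exact h2
  have hLhalf : ((L:ℝ) ^ (1/2:ℝ))⁻¹ ≤ Real.exp (-(2 * E)) := by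
    rw [Real.exp_neg]
    apply inv_anti₀ (by positivity)
    calc Real.exp (2 * E) = (Real.exp (4 * E)) ^ (1/2:ℝ) := by
          rw [← Real.exp_mul]; congr 1; ring
      _ ≤ _ := Real.rpow_le_rpow (by positivity) hL (by norm_num)
  -- for each k
  have hkey : ∀ k ∈ SF m t, ((m:ℝ) / m.totient) * (1 / k.totient) ≤
      ∑ j ∈ (Finset.Icc 1 L).filter (fun j => j ∈ Nat.factoredNumbers (k*m).primeFactors),
        ((k * j : ℕ) : ℝ)⁻¹ + (k:ℝ)⁻¹ * Real.exp (-E) := by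
    intro k hk
    rw [mem_SF] at hk
    have hk0 : k ≠ 0 := hk.2.1.ne_zero
    have hkr : (0:ℝ) < k := by exact_mod_cast Nat.pos_of_ne_zero hk0
    rw [← ratio_split hk0 hk.2.2]
    have hKlog : Real.log ((k * m : ℕ):ℝ) ≤ 2 * Real.log m := by
      push_cast
      rw [Real.log_mul hkr.ne' (by exact_mod_cast hm0)]
      have := Real.log_le_log hkr (hk.1.le.trans htm)
      linarith
    have hhle := hh_le m (k*m) hm (by simp [hk0, hm0]) hKlog
    have hfin : HasSum (fun j => if j ∈ (Finset.Icc 1 L).filter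
        (fun j => j ∈ Nat.factoredNumbers (k*m).primeFactors) then (j:ℝ)⁻¹ else 0)
        (∑ j ∈ (Finset.Icc 1 L).filter
        (fun j => j ∈ Nat.factoredNumbers (k*m).primeFactors), (j:ℝ)⁻¹) := by
      rw [← Finset.sum_congr rfl (fun j hj => if_pos hj)]
      apply hasSum_sum_of_ne_finset_zero
      intro j hj
      rw [if_neg hj]
    have h1 : ((k * m : ℕ) : ℝ) / (k*m).totient ≤ ∑ j ∈ (Finset.Icc 1 L).filter
        (fun j => j ∈ Nat.factoredNumbers (k*m).primeFactors), (j:ℝ)⁻¹ +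
        ((L:ℝ) ^ (1/2:ℝ))⁻¹ * hh (k*m) := by
      refine hasSum_le ?_ (hasSum_fact_one (k*m) (by simp [hk0, hm0]))
        (hfin.add ((hasSum_fact_half (k*m)).mul_left (((L:ℝ) ^ (1/2:ℝ))⁻¹)))
      intro j
      by_cases hj : j ∈ Nat.factoredNumbers (k*m).primeFactors
      · rw [Set.indicator_of_mem hj, Set.indicator_of_mem hj]
        have hj0 : j ≠ 0 := Nat.ne_zero_of_mem_factoredNumbers hj
        have hjr : (0:ℝ) < j := by exact_mod_cast Nat.pos_of_ne_zero hj0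
        split_ifs with hif
        · have : 0 ≤ ((L:ℝ) ^ (1/2:ℝ))⁻¹ * ((j:ℝ) ^ (1/2:ℝ))⁻¹ := by positivity
          linarith
        · have hjL : (L:ℝ) ≤ j := by
            by_contra hcon
            push Not at hcon
            apply hif
            rw [Finset.mem_filter, Finset.mem_Icc]
            exact ⟨⟨Nat.pos_of_ne_zero hj0, by exact_mod_cast hcon.le⟩, hj⟩
          rw [zero_add, ← mul_inv]
          apply inv_anti₀ (by positivity)
          calc (L:ℝ)^(1/2:ℝ) * (j:ℝ)^(1/2:ℝ) ≤ (j:ℝ)^(1/2:ℝ) * (j:ℝ)^(1/2:ℝ) := by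
                gcongr
            _ = j := by rw [← Real.rpow_add hjr]; norm_num
      · rw [Set.indicator_of_notMem hj, Set.indicator_of_notMem hj]
        split_ifs
        · simp
        · simp
    have h2 : ((L:ℝ) ^ (1/2:ℝ))⁻¹ * hh (k*m) ≤ Real.exp (-E) := by
      calc _ ≤ Real.exp (-(2 * E)) * Real.exp E := by
            apply mul_le_mul hLhalf hhle (hh_pos _).le (by positivity)
        _ = _ := by rw [← Real.exp_add]; congr 1; ring
    have h3 := mul_le_mul_of_nonneg_left (h1.trans (add_le_add_right h2 _))
      (by positivity : 0 ≤ (k:ℝ)⁻¹)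
    refine h3.trans (le_of_eq ?_)
    rw [mul_add, Finset.mul_sum]
    congr 1
    apply Finset.sum_congr rfl
    intros; push_cast; rw [mul_inv]
  rw [GG, Finset.mul_sum]
  refine (Finset.sum_le_sum hkey).trans ?_
  rw [Finset.sum_add_distrib, ← Finset.sum_mul]
  have htail : (∑ k ∈ SF m t, (k:ℝ)⁻¹) * Real.exp (-E) ≤ 1 := by
    have h1 : ∑ k ∈ SF m t, (k:ℝ)⁻¹ ≤ 1 + Real.log t := by
      have h := harmonic_floor_le_one_add_log t ht
      rw [harmonic_eq_sum_Icc] at h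
      push_cast at h
      refine le_trans (Finset.sum_le_sum_of_subset_of_nonneg ?_ (fun _ _ _ => by positivity)) h
      intro k hk
      rw [mem_SF] at hk
      rw [Finset.mem_Icc]
      exact ⟨Nat.pos_of_ne_zero hk.2.1.ne_zero, Nat.le_floor hk.1.le⟩
    have h2 : Real.log t ≤ Real.log m := Real.log_le_log (by linarith) htm
    have h3 := log_le_exp_EE hm
    rw [Real.exp_neg, ← div_eq_mul_inv, div_le_one (by positivity)]
    linarith
  have hmain : ∑ k ∈ SF m t, ∑ j ∈ (Finset.Icc 1 L).filter
      (fun j => j ∈ Nat.factoredNumbers (k*m).primeFactors), ((k * j : ℕ) : ℝ)⁻¹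
      ≤ 1 + Real.log (t * L) := by
    have h := harmonic_floor_le_one_add_log (t * L) (by nlinarith)
    rw [harmonic_eq_sum_Icc] at h
    push_cast at h
    refine le_trans ?_ h
    rw [Finset.sum_sigma']
    rw [← Finset.sum_image (g := fun x : (_ : ℕ) × ℕ => x.1 * x.2) (f := fun n : ℕ => (n:ℝ)⁻¹)]
    · apply Finset.sum_le_sum_of_subset_of_nonneg _ (fun _ _ _ => by positivity)
      intro n hn
      rw [Finset.mem_image] at hn
      obtain ⟨⟨k, j⟩, hkj, rfl⟩ := hn
      rw [Finset.mem_sigma, Finset.mem_filter, mem_SF, Finset.mem_Icc] at hkj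
      obtain ⟨⟨h1, h2, h3⟩, ⟨h4, h5⟩, h6⟩ := hkj
      rw [Finset.mem_Icc]
      refine ⟨Nat.mul_pos (Nat.pos_of_ne_zero h2.ne_zero) h4, Nat.le_floor ?_⟩
      push_cast
      have : (j:ℝ) ≤ L := by exact_mod_cast h5
      gcongr
    · rintro ⟨k, j⟩ hkj ⟨k', j'⟩ hkj' he
      simp only at he
      rw [Finset.mem_coe, Finset.mem_sigma, Finset.mem_filter, mem_SF, Finset.mem_Icc] at hkj hkj'
      have hrad : ∀ k j : ℕ, Squarefree k → k.Coprime m → 1 ≤ j →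
          j ∈ Nat.factoredNumbers (k*m).primeFactors → radm m (k*j) = k := by
        intro k j h1 h2 h3 h4
        refine Eq.trans ?_ (Nat.prod_primeFactors_of_squarefree h1)
        rw [radm]
        apply Finset.prod_congr _ (fun _ _ => rfl)
        ext p
        rw [Finset.mem_filter, Nat.mem_primeFactors, Nat.mem_primeFactors]
        rw [Nat.mem_factoredNumbers'] at h4
        constructor
        · rintro ⟨⟨hp, hpd, hne⟩, hpm⟩
          refine ⟨hp, ?_, h1.ne_zero⟩
          rcases (Nat.Prime.dvd_mul hp).1 hpd with h | h
          · exact h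
          · have := Nat.dvd_of_mem_primeFactors (h4 p hp h)
            exact ((Nat.Prime.dvd_mul hp).1 this).resolve_right hpm
        · rintro ⟨hp, hpk, hne⟩
          refine ⟨⟨hp, hpk.mul_right j, Nat.mul_ne_zero hne (by lia)⟩, ?_⟩
          intro hpm
          exact Nat.not_coprime_of_dvd_of_dvd hp.one_lt hpk hpm h2
      have e1 := hrad k j hkj.1.2.1 hkj.1.2.2 hkj.2.1.1 hkj.2.2
      have e2 := hrad k' j' hkj'.1.2.1 hkj'.1.2.2 hkj'.2.1.1 hkj'.2.2
      have hkk : k = k' := by rw [← e1, ← e2, he]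
      subst hkk
      have : j = j' := Nat.eq_of_mul_eq_mul_left (Nat.pos_of_ne_zero hkj.1.2.1.ne_zero) he
      subst this
      rfl
  rw [Real.log_mul (by linarith) (by linarith)] at hmain
  have : EE m = 5 * E := by rw [hEdef]; ring
  rw [this]
  linarith


open ArithmeticFunction in
/-- Selberg weights from the diagonal variables `y`. -/
noncomputable def lam (P : ℕ) (y : ℕ → ℝ) (d : ℕ) : ℝ :=
  (ArithmeticFunction.moebius d : ℝ) * d *
    ∑ k ∈ P.divisors, if d ∣ k then y k / (k.totient : ℝ) else 0

lemma moebius_interval {j k : ℕ} (hj : Squarefree j) (hkj : k ∣ j) :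
    ∑ d ∈ j.divisors, (if k ∣ d then (ArithmeticFunction.moebius d : ℝ) else 0) =
      if j = k then (ArithmeticFunction.moebius k : ℝ) else 0 := by
  obtain ⟨e, rfl⟩ := hkj
  have hk0 : k ≠ 0 := by rintro rfl; simp at hj
  have he0 : e ≠ 0 := by rintro rfl; simp at hj
  have hcop : k.Coprime e := Nat.coprime_of_squarefree_mul hj
  rw [← Finset.sum_filter]
  have : (k*e).divisors.filter (fun d => k ∣ d) = e.divisors.image (fun x => k * x) := by
    ext d
    simp only [Finset.mem_filter, Nat.mem_divisors, Finset.mem_image]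
    constructor
    · rintro ⟨⟨h1, h2⟩, x, rfl⟩
      exact ⟨x, ⟨Nat.dvd_of_mul_dvd_mul_left (Nat.pos_of_ne_zero hk0) h1, he0⟩, rfl⟩
    · rintro ⟨x, ⟨h1, h2⟩, rfl⟩
      exact ⟨⟨Nat.mul_dvd_mul_left k h1, Nat.mul_ne_zero hk0 he0⟩, Dvd.intro x rfl⟩
  rw [this, Finset.sum_image (by
    intro a _ b _ h; exact Nat.eq_of_mul_eq_mul_left (Nat.pos_of_ne_zero hk0) h)]
  have h2 : ∀ x ∈ e.divisors, (ArithmeticFunction.moebius (k * x) : ℝ) =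
      (ArithmeticFunction.moebius k : ℝ) * (ArithmeticFunction.moebius x : ℝ) := by
    intro x hx
    rw [ArithmeticFunction.isMultiplicative_moebius.map_mul_of_coprime
      (hcop.coprime_dvd_right (Nat.dvd_of_mem_divisors hx))]
    push_cast; rfl
  rw [Finset.sum_congr rfl h2, ← Finset.mul_sum]
  have h3 : ∑ x ∈ e.divisors, (ArithmeticFunction.moebius x : ℝ) = if e = 1 then 1 else 0 := by
    have h5 : ∑ x ∈ e.divisors, ArithmeticFunction.moebius x = if e = 1 then 1 else 0 := by
      rw [← ArithmeticFunction.coe_mul_zeta_apply, ArithmeticFunction.moebius_mul_coe_zeta,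
        ArithmeticFunction.one_apply]
    have h6 := congrArg (fun z : ℤ => (z : ℝ)) h5
    simp only [Int.cast_sum] at h6
    rw [h6]
    split_ifs <;> simp
  rw [h3]
  by_cases h : e = 1
  · subst h; simp
  · rw [if_neg h, if_neg, mul_zero]
    intro h4
    apply h
    have : k * e = k * 1 := by rw [h4, mul_one]
    exact Nat.eq_of_mul_eq_mul_left (Nat.pos_of_ne_zero hk0) this

lemma lam_inv {P : ℕ} (hP : Squarefree P) (y : ℕ → ℝ) {k : ℕ} (hk : k ∈ P.divisors) :
    ∑ d ∈ P.divisors, (if k ∣ d then lam P y d / d else 0) =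
      (ArithmeticFunction.moebius k : ℝ) * (y k / k.totient) := by
  have hP0 : P ≠ 0 := hP.ne_zero
  have h1 : ∀ d ∈ P.divisors, (if k ∣ d then lam P y d / d else 0) =
      ∑ j ∈ P.divisors, (y j / j.totient) * (if d ∣ j then (if k ∣ d then
        (ArithmeticFunction.moebius d : ℝ) else 0) else 0) := by
    intro d hd
    have hd0 : (d:ℝ) ≠ 0 := by
      exact_mod_cast (Nat.pos_of_mem_divisors hd).ne'
    split_ifs with h
    · rw [lam, mul_right_comm, mul_div_assoc, div_self hd0, mul_one, Finset.mul_sum]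
      apply Finset.sum_congr rfl
      intro j _
      split_ifs <;> ring
    · simp
  rw [Finset.sum_congr rfl h1, Finset.sum_comm]
  have h2 : ∀ j ∈ P.divisors, ∑ d ∈ P.divisors, (y j / j.totient) * (if d ∣ j then (if k ∣ d then
        (ArithmeticFunction.moebius d : ℝ) else 0) else 0) =
      if j = k then (ArithmeticFunction.moebius k : ℝ) * (y k / k.totient) else 0 := by
    intro j hj
    have hjP := Nat.dvd_of_mem_divisors hj
    rw [← Finset.mul_sum, ← Finset.sum_filter]
    have : P.divisors.filter (fun d => d ∣ j) = j.divisors := by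
      ext d
      simp only [Finset.mem_filter, Nat.mem_divisors]
      constructor
      · rintro ⟨_, h⟩; exact ⟨h, (Nat.pos_of_mem_divisors hj).ne'⟩
      · rintro ⟨h, _⟩; exact ⟨⟨h.trans hjP, hP0⟩, h⟩
    rw [this]
    by_cases hkj : k ∣ j
    · rw [moebius_interval (hP.squarefree_of_dvd hjP) hkj]
      split_ifs with h
      · subst h; ring
      · ring
    · rw [Finset.sum_eq_zero, if_neg, mul_zero]
      · rintro rfl; exact hkj dvd_rfl
      · intro d hd
        rw [if_neg]
        intro h; exact hkj (h.trans (Nat.dvd_of_mem_divisors hd))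
  rw [Finset.sum_congr rfl h2, Finset.sum_ite_eq' , if_pos hk]

lemma quad_lam {P : ℕ} (hP : Squarefree P) (y : ℕ → ℝ) :
    ∑ d₁ ∈ P.divisors, ∑ d₂ ∈ P.divisors, lam P y d₁ * lam P y d₂ / (Nat.lcm d₁ d₂ : ℝ) =
      ∑ k ∈ P.divisors, y k ^ 2 / (k.totient : ℝ) := by
  have hP0 : P ≠ 0 := hP.ne_zero
  have h1 : ∀ d₁ ∈ P.divisors, ∀ d₂ ∈ P.divisors,
      lam P y d₁ * lam P y d₂ / (Nat.lcm d₁ d₂ : ℝ) = ∑ k ∈ P.divisors, (k.totient : ℝ) *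
        ((if k ∣ d₁ then lam P y d₁ / d₁ else 0) * (if k ∣ d₂ then lam P y d₂ / d₂ else 0)) := by
    intro d₁ hd₁ d₂ hd₂
    have p1 := Nat.pos_of_mem_divisors hd₁
    have p2 := Nat.pos_of_mem_divisors hd₂
    have hd1 : (d₁:ℝ) ≠ 0 := by exact_mod_cast p1.ne'
    have hd2 : (d₂:ℝ) ≠ 0 := by exact_mod_cast p2.ne'
    have hl : (Nat.lcm d₁ d₂ : ℝ) ≠ 0 := by exact_mod_cast (Nat.lcm_pos p1 p2).ne'
    have hg : (Nat.gcd d₁ d₂ : ℝ) * (Nat.lcm d₁ d₂ : ℝ) = d₁ * d₂ := by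
      exact_mod_cast Nat.gcd_mul_lcm d₁ d₂
    have hs : (Nat.gcd d₁ d₂ : ℝ) = ∑ k ∈ P.divisors,
        if k ∣ d₁ ∧ k ∣ d₂ then (k.totient : ℝ) else 0 := by
      rw [← Finset.sum_filter]
      have : P.divisors.filter (fun k => k ∣ d₁ ∧ k ∣ d₂) = (Nat.gcd d₁ d₂).divisors := by
        ext k
        simp only [Finset.mem_filter, Nat.mem_divisors, ← Nat.dvd_gcd_iff]
        constructor
        · rintro ⟨_, h⟩; exact ⟨h, (Nat.gcd_pos_of_pos_left _ p1).ne'⟩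
        · rintro ⟨h, _⟩
          exact ⟨⟨(h.trans (Nat.gcd_dvd_left _ _)).trans (Nat.dvd_of_mem_divisors hd₁), hP0⟩, h⟩
      rw [this]
      conv_lhs => rw [← Nat.sum_totient (Nat.gcd d₁ d₂)]
      push_cast; rfl
    have : lam P y d₁ * lam P y d₂ / (Nat.lcm d₁ d₂ : ℝ) =
        (Nat.gcd d₁ d₂ : ℝ) * ((lam P y d₁ / d₁) * (lam P y d₂ / d₂)) := by
      rw [div_mul_div_comm, ← hg]
      have hgg : (Nat.gcd d₁ d₂ : ℝ) ≠ 0 := by exact_mod_cast (Nat.gcd_pos_of_pos_left _ p1).ne'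
      field_simp
    rw [this, hs, Finset.sum_mul]
    apply Finset.sum_congr rfl
    intro k _
    by_cases a : k ∣ d₁ <;> by_cases b : k ∣ d₂ <;> simp [a, b]
  rw [Finset.sum_congr rfl (fun d₁ hd₁ => Finset.sum_congr rfl (h1 d₁ hd₁))]
  have h2 : ∑ d₁ ∈ P.divisors, ∑ d₂ ∈ P.divisors, ∑ k ∈ P.divisors, (k.totient : ℝ) *
        ((if k ∣ d₁ then lam P y d₁ / d₁ else 0) * (if k ∣ d₂ then lam P y d₂ / d₂ else 0)) =
      ∑ k ∈ P.divisors, (k.totient : ℝ) *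
        ((∑ d₁ ∈ P.divisors, if k ∣ d₁ then lam P y d₁ / d₁ else 0) *
         (∑ d₂ ∈ P.divisors, if k ∣ d₂ then lam P y d₂ / d₂ else 0)) := by
    simp_rw [Finset.sum_mul_sum, Finset.mul_sum]
    rw [Finset.sum_congr rfl (fun d _ => Finset.sum_comm)]
    rw [Finset.sum_comm]
  rw [h2]
  apply Finset.sum_congr rfl
  intro k hk
  rw [lam_inv hP y hk]
  have hk' := hP.squarefree_of_dvd (Nat.dvd_of_mem_divisors hk)
  have hm : (ArithmeticFunction.moebius k : ℝ)^2 = 1 := by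
    exact_mod_cast ArithmeticFunction.moebius_sq_eq_one_of_squarefree hk'
  have hphi : (k.totient : ℝ) ≠ 0 := by
    exact_mod_cast (Nat.totient_pos.2 (Nat.pos_of_mem_divisors hk)).ne'
  field_simp
  linear_combination (y k)^2 * hm

lemma sum_div_split {p Q : ℕ} (hp : p.Prime) (hpQ : ¬ p ∣ Q) (hQ : Q ≠ 0) (f : ℕ → ℝ) :
    ∑ d ∈ (p * Q).divisors, f d = ∑ e ∈ Q.divisors, (f e + f (p * e)) := by
  rw [Finset.sum_add_distrib]
  have h1 : (p*Q).divisors = Q.divisors ∪ Q.divisors.image (fun e => p * e) := by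
    ext d
    simp only [Finset.mem_union, Nat.mem_divisors, Finset.mem_image]
    constructor
    · rintro ⟨h1, h2⟩
      by_cases h : p ∣ d
      · obtain ⟨e, rfl⟩ := h
        exact Or.inr ⟨e, ⟨Nat.dvd_of_mul_dvd_mul_left hp.pos h1, hQ⟩, rfl⟩
      · left
        exact ⟨Nat.Coprime.dvd_of_dvd_mul_left ((hp.coprime_iff_not_dvd.2 h).symm) h1, hQ⟩
    · rintro (⟨h1, h2⟩ | ⟨e, ⟨h1, h2⟩, rfl⟩)
      · exact ⟨h1.mul_left p, Nat.mul_ne_zero hp.ne_zero hQ⟩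
      · exact ⟨Nat.mul_dvd_mul_left p h1, Nat.mul_ne_zero hp.ne_zero hQ⟩
  rw [h1, Finset.sum_union, Finset.sum_image]
  · intro a _ b _ h; exact Nat.eq_of_mul_eq_mul_left hp.pos h
  · rw [Finset.disjoint_left]
    intro d hd hd'
    obtain ⟨e, he, rfl⟩ := Finset.mem_image.1 hd'
    exact hpQ ((Dvd.intro e rfl).trans (Nat.dvd_of_mem_divisors hd))

lemma lam_split {p Q : ℕ} (hp : p.Prime) (hpQ : ¬ p ∣ Q) (hQ : Q ≠ 0) (y : ℕ → ℝ) {e : ℕ}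
    (he : e ∈ Q.divisors) :
    lam (p * Q) y e + lam (p * Q) y (p * e) = lam Q (fun k => y k - y (p * k)) e := by
  have heQ := Nat.dvd_of_mem_divisors he
  have hpe : ¬ p ∣ e := fun h => hpQ (h.trans heQ)
  have hcop : p.Coprime e := hp.coprime_iff_not_dvd.2 hpe
  have hmu : (ArithmeticFunction.moebius (p * e) : ℝ) = - (ArithmeticFunction.moebius e : ℝ) := by
    rw [ArithmeticFunction.isMultiplicative_moebius.map_mul_of_coprime hcop,
      ArithmeticFunction.moebius_apply_prime hp]
    push_cast; ring
  rw [lam, lam, lam, sum_div_split hp hpQ hQ, sum_div_split hp hpQ hQ, hmu]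
  push_cast
  have : ∀ A B C : ℝ, A - p * B = C → (ArithmeticFunction.moebius e : ℝ) * e * A +
      -(ArithmeticFunction.moebius e : ℝ) * (p * e) * B =
      (ArithmeticFunction.moebius e : ℝ) * e * C := by
    intro A B C h; rw [← h]; ring
  apply this
  rw [Finset.mul_sum, ← Finset.sum_sub_distrib]
  apply Finset.sum_congr rfl
  intro k hk
  have hkQ := Nat.dvd_of_mem_divisors hk
  have hpk : ¬ p ∣ k := fun h => hpQ (h.trans hkQ)
  have h1 : ¬ (p * e ∣ k) := fun h => hpk ((Dvd.intro e rfl).trans h)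
  have h2 : e ∣ p * k ↔ e ∣ k := ⟨fun h => hcop.symm.dvd_of_dvd_mul_left h, fun h => h.mul_left p⟩
  have h3 : p * e ∣ p * k ↔ e ∣ k := Nat.mul_dvd_mul_iff_left hp.pos
  simp only [h1, h2, h3, if_false, zero_add]
  split_ifs with h
  · rw [Nat.totient_mul (hp.coprime_iff_not_dvd.2 hpk), Nat.totient_prime hp]
    push_cast [hp.one_le]
    have hp1 : (p:ℝ) - 1 ≠ 0 := by
      have : (2:ℝ) ≤ p := by exact_mod_cast hp.two_le
      linarith
    have hphi : (k.totient : ℝ) ≠ 0 := by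
      exact_mod_cast (Nat.totient_pos.2 (Nat.pos_of_mem_divisors hk)).ne'
    field_simp
    ring
  · ring

lemma quad_lam_prime {p Q : ℕ} (hp : p.Prime) (hpQ : ¬ p ∣ Q) (hQ : Squarefree Q) (y : ℕ → ℝ) :
    ∑ d₁ ∈ (p*Q).divisors, ∑ d₂ ∈ (p*Q).divisors,
      lam (p*Q) y d₁ * lam (p*Q) y d₂ / (Nat.lcm p (Nat.lcm d₁ d₂) : ℝ) =
      (1 / p) * ∑ k ∈ Q.divisors, (y k - y (p * k)) ^ 2 / (k.totient : ℝ) := by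
  rw [← quad_lam hQ (fun k => y k - y (p * k)), sum_div_split hp hpQ hQ.ne_zero, Finset.mul_sum]
  apply Finset.sum_congr rfl
  intro e₁ he₁
  rw [sum_div_split hp hpQ hQ.ne_zero, sum_div_split hp hpQ hQ.ne_zero, ← Finset.sum_add_distrib,
    Finset.mul_sum]
  apply Finset.sum_congr rfl
  intro e₂ he₂
  have c1 : p.Coprime e₁ := hp.coprime_iff_not_dvd.2 fun h =>
    hpQ (h.trans (Nat.dvd_of_mem_divisors he₁))
  have c2 : p.Coprime e₂ := hp.coprime_iff_not_dvd.2 fun h =>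
    hpQ (h.trans (Nat.dvd_of_mem_divisors he₂))
  have c3 : p.Coprime (Nat.lcm e₁ e₂) :=
    Nat.Coprime.coprime_dvd_right (Nat.lcm_dvd_mul e₁ e₂) (c1.mul_right c2)
  have l0 : Nat.lcm p (Nat.lcm e₁ e₂) = p * Nat.lcm e₁ e₂ := c3.lcm_eq_mul
  have q1 : e₁ ∣ Nat.lcm e₁ e₂ := Nat.dvd_lcm_left _ _
  have q2 : e₂ ∣ Nat.lcm e₁ e₂ := Nat.dvd_lcm_right _ _
  have key : ∀ f₁ f₂ : ℕ, e₁ ∣ f₁ → e₂ ∣ f₂ → f₁ ∣ p * e₁ → f₂ ∣ p * e₂ →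
      Nat.lcm p (Nat.lcm f₁ f₂) = p * Nat.lcm e₁ e₂ := by
    intro f₁ f₂ h1 h2 h3 h4
    apply Nat.dvd_antisymm
    · exact Nat.lcm_dvd (Dvd.intro _ rfl) (Nat.lcm_dvd (h3.trans (Nat.mul_dvd_mul_left p q1))
        (h4.trans (Nat.mul_dvd_mul_left p q2)))
    · rw [← l0]
      exact Nat.lcm_dvd (Nat.dvd_lcm_left _ _) (Nat.lcm_dvd
        (h1.trans ((Nat.dvd_lcm_left _ _).trans (Nat.dvd_lcm_right _ _)))
        (h2.trans ((Nat.dvd_lcm_right _ _).trans (Nat.dvd_lcm_right _ _))))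
  have l1 := key e₁ (p * e₂) dvd_rfl (Dvd.intro_left p rfl) (Dvd.intro_left p rfl) dvd_rfl
  have l2 := key (p * e₁) e₂ (Dvd.intro_left p rfl) dvd_rfl dvd_rfl (Dvd.intro_left p rfl)
  have l3 := key (p * e₁) (p * e₂) (Dvd.intro_left p rfl) (Dvd.intro_left p rfl) dvd_rfl dvd_rfl
  rw [l0, l1, l2, l3, ← lam_split hp hpQ hQ.ne_zero y he₁, ← lam_split hp hpQ hQ.ne_zero y he₂]
  push_cast
  have : (p:ℝ) ≠ 0 := by exact_mod_cast hp.ne_zero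
  have : (Nat.lcm e₁ e₂ : ℝ) ≠ 0 := by
    exact_mod_cast (Nat.lcm_pos (Nat.pos_of_mem_divisors he₁) (Nat.pos_of_mem_divisors he₂)).ne'
  field_simp


/-- distance to zero in `ZMod m` -/
def nn {m : ℕ} (w : ZMod m) : ℕ := w.valMinAbs.natAbs

lemma geo_bound {m : ℕ} [NeZero m] (T : ℕ) (w : ZMod m) (hw : w ≠ 0) :
    ‖∑ t ∈ Finset.Icc 1 T, ZMod.stdAddChar (w * (t : ZMod m))‖ * nn w ≤ m := by
  have hm : (0:ℝ) < m := by exact_mod_cast Nat.pos_of_ne_zero (NeZero.ne m)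
  set z : ℂ := ZMod.stdAddChar w with hz
  have hpow : ∀ t : ℕ, ZMod.stdAddChar (w * (t : ZMod m)) = z ^ t := by
    intro t
    rw [hz, ← AddChar.map_nsmul_eq_pow, nsmul_eq_mul, mul_comm]
  have hz1 : ‖z‖ = 1 := by rw [hz]; exact AddChar.norm_apply _ _
  set j := w.valMinAbs with hj
  have hj0 : j ≠ 0 := by rw [hj, Ne, ZMod.valMinAbs_eq_zero]; exact hw
  have hzj : z = Complex.exp (Complex.I * ((2 * Real.pi * j / m : ℝ) : ℂ)) := by
    rw [hz, ← ZMod.coe_valMinAbs w, ZMod.stdAddChar_coe]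
    congr 1; push_cast; ring
  have hnorm : ‖z - 1‖ = ‖2 * Real.sin (Real.pi * j / m)‖ := by
    rw [hzj, Complex.norm_exp_I_mul_ofReal_sub_one]
    congr 3; ring
  have hnn : (nn w : ℝ) = |(j:ℝ)| := by
    rw [nn, ← hj, Nat.cast_natAbs]; simp
  have hjm : |(j:ℝ)| ≤ m / 2 := by
    have := ZMod.natAbs_valMinAbs_le w
    rw [← hnn, nn]
    have h2 : (w.valMinAbs.natAbs : ℝ) ≤ ((m/2 : ℕ) : ℝ) := by exact_mod_cast this
    exact h2.trans Nat.cast_div_le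
  have hsin : 2 * |(j:ℝ)| / m ≤ |Real.sin (Real.pi * j / m)| := by
    have h1 : |Real.sin (Real.pi * j / m)| = Real.sin (Real.pi * |(j:ℝ)| / m) := by
      have h0 : 0 ≤ Real.sin (Real.pi * |(j:ℝ)| / m) := by
        apply Real.sin_nonneg_of_nonneg_of_le_pi
        · positivity
        · rw [div_le_iff₀ hm]; nlinarith [Real.pi_pos]
      rcases abs_cases (j:ℝ) with ⟨h, _⟩ | ⟨h, _⟩
      · rw [h] at h0 ⊢; exact abs_of_nonneg h0
      · have : Real.sin (Real.pi * |(j:ℝ)| / m) = - Real.sin (Real.pi * j / m) := by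
          rw [h, ← Real.sin_neg]; congr 1; ring
        rw [this] at h0 ⊢
        exact abs_of_nonpos (by linarith)
    rw [h1]
    have := Real.mul_le_sin (x := Real.pi * |(j:ℝ)| / m) (by positivity) (by
      rw [div_le_iff₀ hm]; nlinarith [Real.pi_pos])
    refine le_trans (le_of_eq ?_) this
    field_simp
  have hge : 4 * |(j:ℝ)| / m ≤ ‖z - 1‖ := by
    rw [hnorm, Real.norm_eq_abs, abs_mul, abs_two]
    have : 4 * |(j:ℝ)| / m = 2 * (2 * |(j:ℝ)| / m) := by ring
    rw [this]; gcongr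
  have hsum : (z - 1) * ∑ t ∈ Finset.Icc 1 T, z ^ t = z * (z ^ T - 1) := by
    have h1 : ∑ t ∈ Finset.Icc 1 T, z ^ t = z * ∑ t ∈ Finset.range T, z ^ t := by
      clear * -
      induction T with
      | zero => simp
      | succ n ih => rw [Finset.sum_Icc_succ_top (by omega), ih, Finset.sum_range_succ]; ring
    rw [h1, mul_left_comm, mul_geom_sum]
  have hle : ‖z - 1‖ * ‖∑ t ∈ Finset.Icc 1 T, z ^ t‖ ≤ 2 := by
    rw [← norm_mul, hsum, norm_mul, hz1, one_mul]
    calc ‖z ^ T - 1‖ ≤ ‖z ^ T‖ + ‖(1:ℂ)‖ := norm_sub_le _ _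
      _ = 2 := by rw [norm_pow, hz1]; norm_num
  simp_rw [hpow]
  rw [hnn]
  set A := ‖∑ t ∈ Finset.Icc 1 T, z ^ t‖
  have hA : 0 ≤ A := norm_nonneg _
  have : 4 * |(j:ℝ)| / m * A ≤ 2 := le_trans (by gcongr) hle
  rw [div_mul_eq_mul_div, div_le_iff₀ hm] at this
  nlinarith

lemma parseval {m : ℕ} [NeZero m] (G : ZMod m → ℂ) :
    ∑ h : ZMod m, ‖∑ v, G v * ZMod.stdAddChar (h * v)‖ ^ 2 = m * ∑ v, ‖G v‖ ^ 2 := by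
  have key : ∑ h : ZMod m, (∑ v, G v * ZMod.stdAddChar (h * v)) *
      (starRingEnd ℂ) (∑ v, G v * ZMod.stdAddChar (h * v)) =
      (m:ℂ) * ∑ v, G v * (starRingEnd ℂ) (G v) := by
    simp_rw [map_sum, map_mul, Finset.sum_mul_sum]
    have h1 : ∀ v v' : ZMod m, ∑ h : ZMod m, G v * ZMod.stdAddChar (h * v) *
        ((starRingEnd ℂ) (G v') * (starRingEnd ℂ) (ZMod.stdAddChar (h * v'))) =
        if v = v' then (m:ℂ) * (G v * (starRingEnd ℂ) (G v')) else 0 := by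
      intro v v'
      have h2 : ∀ h : ZMod m, G v * ZMod.stdAddChar (h * v) *
        ((starRingEnd ℂ) (G v') * (starRingEnd ℂ) (ZMod.stdAddChar (h * v'))) =
        G v * (starRingEnd ℂ) (G v') * ZMod.stdAddChar (h * (v - v')) := by
        intro h
        have h3 : (starRingEnd ℂ) (ZMod.stdAddChar (h * v')) = ZMod.stdAddChar (-(h * v')) :=
          (AddChar.map_neg_eq_conj _ _).symm
        rw [h3, mul_sub, sub_eq_add_neg, AddChar.map_add_eq_mul]; ring
      simp_rw [h2]
      rw [← Finset.mul_sum, AddChar.sum_mulShift _ (ZMod.isPrimitive_stdAddChar m)]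
      simp only [sub_eq_zero, ZMod.card]
      push_cast; split_ifs <;> ring
    rw [Finset.sum_comm, Finset.sum_congr rfl (fun v _ => Finset.sum_comm), Finset.mul_sum]
    simp_rw [h1]
    simp
  have h2 : ∀ z : ℂ, z * (starRingEnd ℂ) z = ((‖z‖^2 : ℝ) : ℂ) := by
    intro z; rw [Complex.mul_conj, Complex.normSq_eq_norm_sq]
  simp_rw [h2] at key
  exact_mod_cast key


lemma omega_le {m : ℕ} (hm : 3 ≤ m) {n : ℕ} (hn0 : n ≠ 0) (hn : n ≤ m * m) :
    n.primeFactors.card ≤ ⌊4 * Real.log m⌋₊ := by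
  apply Nat.le_floor
  have h1 := card_primeFactors_le n hn0
  have hm0 : (0:ℝ) < m := by exact_mod_cast (by omega : 0 < m)
  have h2 : Real.log n ≤ 2 * Real.log m := by
    have : Real.log n ≤ Real.log ((m:ℝ) * m) := by
      apply Real.log_le_log
      · exact_mod_cast Nat.pos_of_ne_zero hn0
      · exact_mod_cast hn
    rw [Real.log_mul hm0.ne' hm0.ne'] at this
    linarith
  linarith

lemma count_pairs {m : ℕ} [NeZero m] (hm : 3 ≤ m) {X : ℕ} (hX : X ≤ m) (PP : Finset ℕ)
    (hPP : ∀ p ∈ PP, p.Prime ∧ p ≤ X ∧ ¬ p ∣ m) (H : ℕ) :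
    ((Finset.univ ×ˢ PP ×ˢ PP : Finset (ZMod m × ℕ × ℕ)).filter (fun x => x.1 ≠ 0 ∧
      nn (x.1 * (x.2.1 : ZMod m)) ≤ H ∧ nn (x.1 * (x.2.2 : ZMod m)) ≤ H)).card ≤
      ⌊4 * Real.log m⌋₊ * ((2 * H + 1) * (PP.card * (2 * (2 * H * X / m) + 1))) := by
  classical
  set Kk := 2 * H * X / m with hKk
  have hmpos : 0 < m := by omega
  have hunit : ∀ p ∈ PP, IsUnit (p : ZMod m) := by
    intro p hp
    obtain ⟨h1, _, h3⟩ := hPP p hp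
    exact (ZMod.isUnit_iff_coprime p m).2 (h1.coprime_iff_not_dvd.2 h3)
  set t : Finset (ℤ × ℕ × ℤ) := Finset.Icc (-(H:ℤ)) H ×ˢ PP ×ˢ Finset.Icc (-(Kk:ℤ)) Kk with ht
  have htc : t.card = (2 * H + 1) * (PP.card * (2 * Kk + 1)) := by
    rw [ht, Finset.card_product, Finset.card_product, Int.card_Icc, Int.card_Icc]
    congr 1
    · omega
    · congr 1; omega
  rw [← htc]
  set f : ZMod m × ℕ × ℕ → ℤ × ℕ × ℤ := fun x =>
    ((x.1 * (x.2.1 : ZMod m)).valMinAbs, x.2.2,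
      ((x.1 * (x.2.1 : ZMod m)).valMinAbs * x.2.2 - (x.1 * (x.2.2 : ZMod m)).valMinAbs * x.2.1) / m)
    with hf
  have hdvd : ∀ x : ZMod m × ℕ × ℕ, (m:ℤ) ∣
      (x.1 * (x.2.1 : ZMod m)).valMinAbs * x.2.2 - (x.1 * (x.2.2 : ZMod m)).valMinAbs * x.2.1 := by
    intro x
    rw [← ZMod.intCast_zmod_eq_zero_iff_dvd]
    push_cast
    ring
  apply Finset.card_le_mul_card_image_of_maps_to (f := f)
  · rintro ⟨h, p, p'⟩ hx
    simp only [Finset.mem_filter, Finset.mem_product, Finset.mem_univ, true_and] at hx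
    obtain ⟨⟨hp, hp'⟩, h0, h1, h2⟩ := hx
    simp only [ht, hf, Finset.mem_product, Finset.mem_Icc]
    have hw : |(h * (p : ZMod m)).valMinAbs| ≤ H := by
      rw [Int.abs_eq_natAbs]; exact_mod_cast h1
    have hw' : |(h * (p' : ZMod m)).valMinAbs| ≤ H := by
      rw [Int.abs_eq_natAbs]; exact_mod_cast h2
    refine ⟨abs_le.1 hw, hp', abs_le.1 ?_⟩
    obtain ⟨k, hk⟩ := hdvd (h, p, p')
    simp only at hk
    rw [hk, Int.mul_ediv_cancel_left _ (by exact_mod_cast hmpos.ne')]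
    have hbound : |(m:ℤ) * k| ≤ 2 * H * X := by
      rw [← hk]
      have hpX : (p:ℤ) ≤ X := by exact_mod_cast (hPP p hp).2.1
      have hpX' : (p':ℤ) ≤ X := by exact_mod_cast (hPP p' hp').2.1
      calc _ ≤ |(h * (p : ZMod m)).valMinAbs * (p':ℤ)| + |(h * (p' : ZMod m)).valMinAbs * (p:ℤ)| :=
            abs_sub _ _
        _ ≤ H * X + H * X := by
            rw [abs_mul, abs_mul, Nat.abs_cast, Nat.abs_cast]
            gcongr
        _ = 2 * H * X := by ring
    rw [abs_mul, Nat.abs_cast] at hbound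
    rw [hKk, Int.natCast_div, Int.le_ediv_iff_mul_le (by exact_mod_cast hmpos)]
    push_cast
    linarith
  · rintro ⟨w, p', k⟩ _
    set V : ℤ := w * p' - m * k with hV
    by_cases hVgood : V.natAbs ≠ 0 ∧ V.natAbs ≤ m * m
    · refine le_trans ?_ (omega_le hm hVgood.1 hVgood.2)
      apply Finset.card_le_card_of_injOn (fun x => x.2.1)
      · rintro ⟨h, p, q⟩ hx
        simp only [Finset.coe_filter, Finset.mem_filter, Finset.mem_product, Finset.mem_univ,
          true_and, Set.mem_ofPred_eq, hf, Prod.mk.injEq] at hx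
        obtain ⟨⟨⟨hp, hq⟩, h0, h1, h2⟩, e1, e2, e3⟩ := hx
        simp only [Finset.mem_coe, Nat.mem_primeFactors]
        refine ⟨(hPP p hp).1, ?_, hVgood.1⟩
        rw [← Int.natCast_dvd]
        have := Int.ediv_mul_cancel (hdvd (h, p, q))
        simp only at this
        rw [e3, e1, e2] at this
        refine ⟨(h * (p' : ZMod m)).valMinAbs, ?_⟩
        rw [hV]; linarith
      · rintro ⟨h, p, q⟩ hx ⟨h', p2, q2⟩ hx2 hpp
        simp only [Finset.coe_filter, Finset.mem_filter, Finset.mem_product, Finset.mem_univ,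
          true_and, Set.mem_ofPred_eq, hf, Prod.mk.injEq] at hx hx2 hpp
        obtain ⟨⟨⟨hp, hq⟩, h0, h1, h2⟩, e1, e2, e3⟩ := hx
        obtain ⟨⟨⟨hp', hq'⟩, h0', h1', h2'⟩, e1', e2', e3'⟩ := hx2
        subst hpp
        rw [e2, e2']
        have h5 : h * (p : ZMod m) = h' * p := by
          apply ZMod.injective_valMinAbs; rw [e1, e1']
        rw [(hunit p hp).mul_right_cancel h5]
    · rw [Finset.card_eq_zero.2]
      · exact Nat.zero_le _
      rw [Finset.filter_eq_empty_iff]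
      rintro ⟨h, p, q⟩ hx hfx
      simp only [Finset.mem_filter, Finset.mem_product, Finset.mem_univ,
          true_and, hf, Prod.mk.injEq] at hx hfx
      obtain ⟨⟨hp, hq⟩, h0, h1, h2⟩ := hx
      obtain ⟨e1, e2, e3⟩ := hfx
      apply hVgood
      have := Int.ediv_mul_cancel (hdvd (h, p, q))
      simp only at this
      rw [e3, e1, e2] at this
      have hVeq : V = (h * (p' : ZMod m)).valMinAbs * p := by rw [hV]; linarith
      rw [hVeq, Int.natAbs_mul, Int.natAbs_natCast]
      constructor
      · apply Nat.mul_ne_zero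
        · rw [Int.natAbs_ne_zero, Ne, ZMod.valMinAbs_eq_zero]
          rw [← e2]
          intro h6
          exact h0 ((hunit q hq).mul_left_eq_zero.1 h6)
        · exact (hPP p hp).1.ne_zero
      · apply Nat.mul_le_mul
        · exact (ZMod.natAbs_valMinAbs_le _).trans (Nat.div_le_self _ _)
        · exact (hPP p hp).2.1.trans hX

lemma count_quads {m : ℕ} [NeZero m] (hm : 3 ≤ m) {X : ℕ} (hX : X ≤ m) (PP : Finset ℕ)
    (hPP : ∀ p ∈ PP, p.Prime ∧ p ≤ X ∧ ¬ p ∣ m) :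
    (((PP ×ˢ PP) ×ˢ (PP ×ˢ PP)).filter (fun x : (ℕ × ℕ) × (ℕ × ℕ) =>
      ((x.1.1 * x.1.2 : ℕ) : ZMod m) = ((x.2.1 * x.2.2 : ℕ) : ZMod m))).card ≤
      ⌊4 * Real.log m⌋₊ * ((PP.card * PP.card) * (X * X / m + 1)) := by
  classical
  have hmpos : 0 < m := by omega
  set t : Finset ((ℕ × ℕ) × ℕ) := (PP ×ˢ PP) ×ˢ Finset.range (X * X / m + 1) with ht
  have htc : t.card = (PP.card * PP.card) * (X * X / m + 1) := by
    rw [ht, Finset.card_product, Finset.card_product, Finset.card_range]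
  rw [← htc]
  apply Finset.card_le_mul_card_image_of_maps_to (f := fun x => (x.1, x.2.1 * x.2.2 / m))
  · rintro ⟨⟨p1, p2⟩, ⟨p3, p4⟩⟩ hx
    simp only [Finset.mem_filter, Finset.mem_product] at hx
    simp only [ht, Finset.mem_product, Finset.mem_range]
    refine ⟨hx.1.1, Nat.lt_succ_of_le (Nat.div_le_div_right ?_)⟩
    exact Nat.mul_le_mul (hPP _ hx.1.2.1).2.1 (hPP _ hx.1.2.2).2.1
  · rintro ⟨⟨p1, p2⟩, k⟩ _
    set V : ℕ := m * k + (p1 * p2) % m with hV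
    have hval : ∀ x : (ℕ × ℕ) × (ℕ × ℕ), ((x.1.1 * x.1.2 : ℕ) : ZMod m) = ((x.2.1 * x.2.2 : ℕ) : ZMod m) →
        x.1 = (p1, p2) → x.2.1 * x.2.2 / m = k → x.2.1 * x.2.2 = V := by
      rintro ⟨⟨q1, q2⟩, ⟨q3, q4⟩⟩ h1 h2 h3
      simp only [Prod.mk.injEq] at h1 h2 h3 ⊢
      obtain ⟨rfl, rfl⟩ := h2
      rw [ZMod.natCast_eq_natCast_iff'] at h1
      rw [hV, h1, ← h3, Nat.div_add_mod]
    by_cases hVgood : V ≠ 0 ∧ V ≤ m * m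
    · refine le_trans ?_ (omega_le hm hVgood.1 hVgood.2)
      apply Finset.card_le_card_of_injOn (fun x => x.2.1)
      · intro x hx
        simp only [Finset.coe_filter, Finset.mem_filter, Finset.mem_product,
          Set.mem_ofPred_eq, Prod.mk.injEq] at hx
        simp only [Finset.mem_coe, Nat.mem_primeFactors]
        refine ⟨(hPP _ hx.1.1.2.1).1, ⟨x.2.2, ?_⟩, hVgood.1⟩
        exact (hval x hx.1.2 hx.2.1 hx.2.2).symm
      · intro x hx x' hx' h
        simp only [Finset.coe_filter, Finset.mem_filter, Finset.mem_product,
          Set.mem_ofPred_eq, Prod.mk.injEq] at hx hx' h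
        have e1 := hval x hx.1.2 hx.2.1 hx.2.2
        have e2 := hval x' hx'.1.2 hx'.2.1 hx'.2.2
        have h0 : 0 < x'.2.1 := (hPP _ hx'.1.1.2.1).1.pos
        rw [← e2, h] at e1
        have := Nat.eq_of_mul_eq_mul_left h0 e1
        exact Prod.ext (hx.2.1.trans hx'.2.1.symm) (Prod.ext h this)
    · rw [Finset.card_eq_zero.2]
      · exact Nat.zero_le _
      rw [Finset.filter_eq_empty_iff]
      intro x hx hfx
      simp only [Finset.mem_filter, Finset.mem_product, Prod.mk.injEq] at hx hfx
      have e1 := hval x hx.2 hfx.1 hfx.2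
      apply hVgood
      rw [← e1]
      exact ⟨Nat.mul_ne_zero (hPP _ hx.1.2.1).1.ne_zero (hPP _ hx.1.2.2).1.ne_zero,
        Nat.mul_le_mul ((hPP _ hx.1.2.1).2.1.trans hX) ((hPP _ hx.1.2.2).2.1.trans hX)⟩


lemma dyadic_bound {m : ℕ} [NeZero m] {T I : ℕ} (hT : 1 ≤ T) (hTI : T ≤ 2 ^ I)
    (w : ZMod m) (hw : w ≠ 0) :
    ‖∑ t ∈ Finset.Icc 1 T, ZMod.stdAddChar (w * (t : ZMod m))‖ ≤
      ∑ i ∈ Finset.range (I + 1), 2 * (T : ℝ) / 2 ^ i * (if nn w ≤ 2 ^ i * m / T then 1 else 0) := by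
  classical
  have hm : 0 < m := Nat.pos_of_ne_zero (NeZero.ne m)
  have hTr : (0:ℝ) < T := by exact_mod_cast hT
  have hex : ∃ i, nn w ≤ 2 ^ i * m / T := by
    refine ⟨I, ?_⟩
    rw [Nat.le_div_iff_mul_le hT]
    have : nn w ≤ m := (ZMod.natAbs_valMinAbs_le w).trans (Nat.div_le_self _ _)
    calc nn w * T ≤ m * 2 ^ I := Nat.mul_le_mul this hTI
      _ = 2 ^ I * m := mul_comm _ _
  set i := Nat.find hex with hi
  have hspec : nn w ≤ 2 ^ i * m / T := Nat.find_spec hex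
  have hiI : i ≤ I := by
    apply Nat.find_min' hex
    rw [Nat.le_div_iff_mul_le hT]
    have : nn w ≤ m := (ZMod.natAbs_valMinAbs_le w).trans (Nat.div_le_self _ _)
    calc nn w * T ≤ m * 2 ^ I := Nat.mul_le_mul this hTI
      _ = 2 ^ I * m := mul_comm _ _
  have hterm : 2 * (T : ℝ) / 2 ^ i ≤
      ∑ i ∈ Finset.range (I + 1), 2 * (T : ℝ) / 2 ^ i * (if nn w ≤ 2 ^ i * m / T then 1 else 0) := by
    refine le_trans (le_of_eq ?_) (Finset.single_le_sum (f := fun i => 2 * (T : ℝ) / 2 ^ i *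
      (if nn w ≤ 2 ^ i * m / T then 1 else 0)) ?_ (Finset.mem_range.2 (Nat.lt_succ_of_le hiI)))
    · rw [if_pos hspec, mul_one]
    · intro j _; positivity
  refine le_trans ?_ hterm
  have hgeo := geo_bound T w hw
  have htriv : ‖∑ t ∈ Finset.Icc 1 T, ZMod.stdAddChar (w * (t : ZMod m))‖ ≤ T := by
    refine (norm_sum_le _ _).trans ?_
    simp [AddChar.norm_apply]
  set A := ‖∑ t ∈ Finset.Icc 1 T, ZMod.stdAddChar (w * (t : ZMod m))‖
  rcases Nat.eq_zero_or_pos i with h0 | h0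
  · rw [h0, pow_zero, div_one]; linarith
  · obtain ⟨j, hj⟩ : ∃ j, i = j + 1 := ⟨i - 1, by omega⟩
    have hnot : ¬ (nn w ≤ 2 ^ j * m / T) := Nat.find_min hex (by omega)
    rw [Nat.le_div_iff_mul_le hT, not_le] at hnot
    have hnot' : (2:ℝ)^j * m < nn w * T := by exact_mod_cast hnot
    rw [hj, pow_succ, mul_comm ((2:ℝ)^j), mul_div_mul_left _ _ two_ne_zero, le_div_iff₀ (by positivity)]
    have hmr : (0:ℝ) < m := by exact_mod_cast hm
    have hA : 0 ≤ A := norm_nonneg _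
    by_contra hcon
    push Not at hcon
    nlinarith

noncomputable def gG (m : ℕ) (PP : Finset ℕ) (T : ℕ) (v : ZMod m) : ℝ :=
  ∑ p ∈ PP, ∑ t ∈ Finset.Icc 1 T, if (p : ZMod m) * (t : ZMod m) = v then 1 else 0

lemma gG_fourier {m : ℕ} [NeZero m] (PP : Finset ℕ) (T : ℕ) (h : ZMod m) :
    ∑ v : ZMod m, (((gG m PP T v - PP.card * T / m : ℝ)) : ℂ) * ZMod.stdAddChar (h * v) =
      if h = 0 then 0 else
        ∑ p ∈ PP, ∑ t ∈ Finset.Icc 1 T, ZMod.stdAddChar (h * (p : ZMod m) * (t : ZMod m)) := by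
  have hm : (m:ℂ) ≠ 0 := by exact_mod_cast (NeZero.ne m)
  have h1 : ∑ v : ZMod m, ((gG m PP T v : ℝ) : ℂ) * ZMod.stdAddChar (h * v) =
      ∑ p ∈ PP, ∑ t ∈ Finset.Icc 1 T, ZMod.stdAddChar (h * (p : ZMod m) * (t : ZMod m)) := by
    simp only [gG, Complex.ofReal_sum, Finset.sum_mul]
    rw [Finset.sum_comm]
    apply Finset.sum_congr rfl
    intro p _
    rw [Finset.sum_comm]
    apply Finset.sum_congr rfl
    intro t _
    rw [Finset.sum_eq_single ((p : ZMod m) * t)]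
    · simp [mul_assoc]
    · intro b _ hb
      rw [if_neg (Ne.symm hb)]; simp
    · simp
  have h2 : ∑ v : ZMod m, (ZMod.stdAddChar (h * v) : ℂ) = if h = 0 then (m : ℂ) else 0 := by
    have := AddChar.sum_mulShift (R := ZMod m) (R' := ℂ) h (ZMod.isPrimitive_stdAddChar m)
    simp only [ZMod.card] at this
    push_cast at this
    rw [← this]
    apply Finset.sum_congr rfl
    intro v _; rw [mul_comm]
  simp only [Complex.ofReal_sub, sub_mul, Finset.sum_sub_distrib]
  rw [h1, ← Finset.mul_sum, h2]
  split_ifs with h0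
  · subst h0
    simp
  · simp

lemma energy_e {m : ℕ} [NeZero m] (hm : 3 ≤ m) {X : ℕ} (hX : X ≤ m) (PP : Finset ℕ)
    (hPP : ∀ p ∈ PP, p.Prime ∧ p ≤ X ∧ ¬ p ∣ m) {T : ℕ} (hTX : T ≤ X) :
    ∑ v : ZMod m, (gG m PP T v - PP.card * T / m) ^ 2 ≤
      3840 * (Real.log m) ^ 3 * (X * PP.card) := by
  classical
  have hmr : (0:ℝ) < m := by exact_mod_cast (by omega : 0 < m)
  have hlog : 1 ≤ Real.log m := log_ge_one hm
  rcases Nat.eq_zero_or_pos T with hT0 | hT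
  · subst hT0
    simp [gG]; positivity
  set I := Nat.clog 2 m with hI
  have hTI : T ≤ 2 ^ I := (hTX.trans hX).trans (Nat.le_pow_clog (by norm_num) m)
  have hIle : ((I + 1 : ℕ) : ℝ) ≤ 4 * Real.log m := by
    have h1 : 2 ^ (I - 1) < m := Nat.pow_pred_clog_lt_self (by norm_num) (by omega)
    have h2 : ((I - 1 : ℕ) : ℝ) * Real.log 2 ≤ Real.log m := by
      rw [← Real.log_pow]
      apply Real.log_le_log (by positivity)
      exact_mod_cast h1.le
    have h3 : (I : ℝ) - 1 ≤ ((I - 1 : ℕ) : ℝ) := by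
      have : I ≤ (I - 1) + 1 := by omega
      have : (I:ℝ) ≤ ((I - 1 : ℕ) : ℝ) + 1 := by exact_mod_cast this
      linarith
    have h4 := Real.log_two_gt_d9
    push_cast
    nlinarith
  have hTr : (0:ℝ) < T := by exact_mod_cast hT
  have hTXr : (T:ℝ) ≤ X := by exact_mod_cast hTX
  have hP := parseval (m := m) (fun v => (((gG m PP T v - PP.card * T / m : ℝ)) : ℂ))
  have hP2 : (m:ℝ) * ∑ v : ZMod m, (gG m PP T v - PP.card * T / m) ^ 2 =
      ∑ h : ZMod m, (if h = 0 then 0 else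
        ‖∑ p ∈ PP, ∑ t ∈ Finset.Icc 1 T, ZMod.stdAddChar (h * (p : ZMod m) * (t : ZMod m))‖ ^ 2) := by
    rw [← sub_eq_zero]
    have : ∀ r : ℝ, ‖(r:ℂ)‖^2 = r^2 := by intro r; rw [Complex.norm_real, Real.norm_eq_abs, sq_abs]
    simp_rw [this] at hP
    rw [← hP, sub_eq_zero]
    apply Finset.sum_congr rfl
    intro h _
    rw [gG_fourier]
    split_ifs <;> simp
  have hunit : ∀ p ∈ PP, IsUnit (p : ZMod m) := by
    intro p hp
    obtain ⟨h1, _, h3⟩ := hPP p hp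
    exact (ZMod.isUnit_iff_coprime p m).2 (h1.coprime_iff_not_dvd.2 h3)
  -- pointwise bound
  set Z : ℕ → ZMod m → ℝ := fun i h => ∑ p ∈ PP, if nn (h * (p : ZMod m)) ≤ 2 ^ i * m / T then (1:ℝ) else 0
    with hZ
  have hpt : ∀ h : ZMod m, (if h = 0 then 0 else
        ‖∑ p ∈ PP, ∑ t ∈ Finset.Icc 1 T, ZMod.stdAddChar (h * (p : ZMod m) * (t : ZMod m))‖ ^ 2) ≤
      (I + 1 : ℕ) * ∑ i ∈ Finset.range (I + 1), (2 * (T : ℝ) / 2 ^ i) ^ 2 *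
        (if h = 0 then 0 else Z i h ^ 2) := by
    intro h
    split_ifs with h0
    · simp
    have h1 : ‖∑ p ∈ PP, ∑ t ∈ Finset.Icc 1 T, ZMod.stdAddChar (h * (p : ZMod m) * (t : ZMod m))‖ ≤
        ∑ i ∈ Finset.range (I + 1), (2 * (T : ℝ) / 2 ^ i) * Z i h := by
      refine (norm_sum_le _ _).trans ?_
      calc _ ≤ ∑ p ∈ PP, ∑ i ∈ Finset.range (I + 1), 2 * (T : ℝ) / 2 ^ i *
            (if nn (h * (p : ZMod m)) ≤ 2 ^ i * m / T then 1 else 0) := by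
            apply Finset.sum_le_sum
            intro p hp
            apply dyadic_bound hT hTI
            intro h6
            exact h0 ((hunit p hp).mul_left_eq_zero.1 h6)
        _ = _ := by
            rw [Finset.sum_comm]
            apply Finset.sum_congr rfl
            intro i _
            rw [hZ, Finset.mul_sum]
    calc _ ≤ (∑ i ∈ Finset.range (I + 1), (2 * (T : ℝ) / 2 ^ i) * Z i h) ^ 2 := by gcongr
      _ ≤ _ := by
        refine (sq_sum_le_card_mul_sum_sq).trans (le_of_eq ?_)
        rw [Finset.card_range]
        simp_rw [mul_pow]
  -- counting
  have hcount : ∀ i, ∑ h : ZMod m, (if h = 0 then 0 else Z i h ^ 2) ≤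
      4 * Real.log m * (3 * (2 ^ i * m / T) * (PP.card * (5 * (2 ^ i * X / T)))) := by
    intro i
    set H := 2 ^ i * m / T with hH
    have hc := count_pairs hm hX PP hPP H
    have e1 : ∑ h : ZMod m, (if h = 0 then 0 else Z i h ^ 2) =
        (((Finset.univ ×ˢ PP ×ˢ PP : Finset (ZMod m × ℕ × ℕ)).filter (fun x => x.1 ≠ 0 ∧
      nn (x.1 * (x.2.1 : ZMod m)) ≤ H ∧ nn (x.1 * (x.2.2 : ZMod m)) ≤ H)).card : ℝ) := by
      rw [Finset.card_filter]
      push_cast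
      rw [Finset.sum_product]
      apply Finset.sum_congr rfl
      intro h _
      rw [Finset.sum_product]
      by_cases h0 : h = 0
      · simp [h0]
      · rw [if_neg h0, hZ]
        simp only
        rw [sq, Finset.sum_mul_sum]
        apply Finset.sum_congr rfl
        intro p _
        apply Finset.sum_congr rfl
        intro q _
        by_cases a : nn (h * (p : ZMod m)) ≤ H <;> by_cases b : nn (h * (q : ZMod m)) ≤ H <;>
          simp [← hH, a, b, h0]
    rw [e1]
    have hc' := (Nat.cast_le (α := ℝ)).2 hc
    refine hc'.trans ?_
    push_cast
    have hHr : (H:ℝ) ≤ 2 ^ i * m / T := by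
      rw [hH]; refine Nat.cast_div_le.trans ?_; push_cast; exact le_rfl
    have hone : (1:ℝ) ≤ 2 ^ i * m / T := by
      rw [le_div_iff₀ hTr, one_mul]
      have : (1:ℝ) ≤ 2 ^ i := one_le_pow₀ (by norm_num)
      have h2 : (T:ℝ) ≤ m := by exact_mod_cast hTX.trans hX
      nlinarith
    have hone' : (1:ℝ) ≤ 2 ^ i * X / T := by
      rw [le_div_iff₀ hTr, one_mul]
      have : (1:ℝ) ≤ 2 ^ i := one_le_pow₀ (by norm_num)
      nlinarith
    have hKr : ((2 * H * X / m : ℕ) : ℝ) ≤ 2 * (2 ^ i * X / T) := by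
      refine Nat.cast_div_le.trans ?_
      push_cast
      rw [div_le_iff₀ hmr]
      calc (2:ℝ) * H * X ≤ 2 * (2 ^ i * m / T) * X := by gcongr
        _ = _ := by ring
    have hfl : ((⌊4 * Real.log m⌋₊ : ℕ) : ℝ) ≤ 4 * Real.log m := Nat.floor_le (by linarith)
    gcongr
    · linarith
    · linarith
  have hfin : (m:ℝ) * ∑ v : ZMod m, (gG m PP T v - PP.card * T / m) ^ 2 ≤
      m * (3840 * (Real.log m) ^ 3 * (X * PP.card)) := by
    rw [hP2]
    calc _ ≤ ∑ h : ZMod m, ((I + 1 : ℕ) : ℝ) * ∑ i ∈ Finset.range (I + 1), (2 * (T : ℝ) / 2 ^ i) ^ 2 *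
        (if h = 0 then 0 else Z i h ^ 2) := Finset.sum_le_sum (fun h _ => hpt h)
      _ = ((I + 1 : ℕ) : ℝ) * ∑ i ∈ Finset.range (I + 1), (2 * (T : ℝ) / 2 ^ i) ^ 2 *
          ∑ h : ZMod m, (if h = 0 then 0 else Z i h ^ 2) := by
          rw [← Finset.mul_sum, Finset.sum_comm]
          simp_rw [Finset.mul_sum]
      _ ≤ ((I + 1 : ℕ) : ℝ) * ∑ i ∈ Finset.range (I + 1), (2 * (T : ℝ) / 2 ^ i) ^ 2 *
          (4 * Real.log m * (3 * (2 ^ i * m / T) * (PP.card * (5 * (2 ^ i * X / T))))) := by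
          gcongr with i _
          exact hcount i
      _ = ((I + 1 : ℕ) : ℝ) * ∑ i ∈ Finset.range (I + 1), (240 * Real.log m * m * (X * PP.card)) := by
          congr 1
          apply Finset.sum_congr rfl
          intro i _
          field_simp
          ring
      _ = ((I + 1 : ℕ) : ℝ) * (((I + 1 : ℕ) : ℝ) * (240 * Real.log m * m * (X * PP.card))) := by
          rw [Finset.sum_const, Finset.card_range, nsmul_eq_mul]
      _ ≤ (4 * Real.log m) * ((4 * Real.log m) * (240 * Real.log m * m * (X * PP.card))) := by
          gcongr
      _ = _ := by ring
  exact le_of_mul_le_mul_left hfin hmr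

/-- Equidistribution of products of three primes and a variable in an interval. -/
lemma equidist {m : ℕ} [NeZero m] (hm : 3 ≤ m) {X : ℕ} (hX : X ≤ m) (hX2 : m ≤ X * X) (PP : Finset ℕ)
    (hPP : ∀ p ∈ PP, p.Prime ∧ p ≤ X ∧ ¬ p ∣ m) {T : ℕ} (hTX : T ≤ X) (b : (ZMod m)ˣ) :
    |(∑ p₁ ∈ PP, ∑ p₂ ∈ PP, ∑ p₃ ∈ PP, ∑ t ∈ Finset.Icc 1 T,
      (if (p₁ : ZMod m) * p₂ * p₃ * t = b then (1:ℝ) else 0)) - (PP.card : ℝ) ^ 3 * T / m| ≤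
      Real.sqrt (30720 * (Real.log m) ^ 4 * (X * PP.card) ^ 3 / m) := by
  classical
  have hmr : (0:ℝ) < m := by exact_mod_cast (by omega : 0 < m)
  have hlog : 1 ≤ Real.log m := log_ge_one hm
  have hunit : ∀ p ∈ PP, IsUnit (p : ZMod m) := by
    intro p hp
    obtain ⟨h1, _, h3⟩ := hPP p hp
    exact (ZMod.isUnit_iff_coprime p m).2 (h1.coprime_iff_not_dvd.2 h3)
  set e : ZMod m → ℝ := fun v => gG m PP T v - PP.card * T / m with he
  set f : ZMod m → ℝ := fun u => ∑ x ∈ PP ×ˢ PP, if ((x.1 * x.2 : ℕ) : ZMod m) = u then 1 else 0 with hf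
  have hmain : (∑ p₁ ∈ PP, ∑ p₂ ∈ PP, ∑ p₃ ∈ PP, ∑ t ∈ Finset.Icc 1 T,
      (if (p₁ : ZMod m) * p₂ * p₃ * t = b then (1:ℝ) else 0)) =
      ∑ x ∈ PP ×ˢ PP, gG m PP T (b * ((x.1 * x.2 : ℕ) : ZMod m)⁻¹) := by
    rw [Finset.sum_product]
    apply Finset.sum_congr rfl
    intro p hp
    apply Finset.sum_congr rfl
    intro q hq
    rw [gG]
    apply Finset.sum_congr rfl
    intro r _
    apply Finset.sum_congr rfl
    intro t _
    have hu : IsUnit ((p * q : ℕ) : ZMod m) := by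
      push_cast; exact (hunit p hp).mul (hunit q hq)
    have hinv := ZMod.mul_inv_of_unit _ hu
    have hiff : (p : ZMod m) * q * r * t = b ↔ (r : ZMod m) * t = b * ((p * q : ℕ) : ZMod m)⁻¹ := by
      constructor
      · intro h
        rw [← h]
        push_cast at hinv ⊢
        linear_combination (-(r:ZMod m) * t) * hinv
      · intro h
        push_cast at hinv h
        linear_combination ((p:ZMod m) * q) * h + (b : ZMod m) * hinv
    simp only [hiff]
  have hsplit : ∑ x ∈ PP ×ˢ PP, gG m PP T (b * ((x.1 * x.2 : ℕ) : ZMod m)⁻¹) -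
      (PP.card : ℝ) ^ 3 * T / m = ∑ x ∈ PP ×ˢ PP, e (b * ((x.1 * x.2 : ℕ) : ZMod m)⁻¹) := by
    rw [he, Finset.sum_sub_distrib, Finset.sum_const, Finset.card_product, nsmul_eq_mul]
    push_cast; ring
  have hfe : ∑ x ∈ PP ×ˢ PP, e (b * ((x.1 * x.2 : ℕ) : ZMod m)⁻¹) =
      ∑ u : (ZMod m)ˣ, f u * e (b * (u : ZMod m)⁻¹) := by
    rw [hf]
    simp only [Finset.sum_mul]
    rw [Finset.sum_comm]
    apply Finset.sum_congr rfl
    intro x hx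
    have hx := Finset.mem_product.1 hx
    have hu : IsUnit ((x.1 * x.2 : ℕ) : ZMod m) := by
      push_cast; exact (hunit _ hx.1).mul (hunit _ hx.2)
    obtain ⟨u, hu⟩ := hu
    rw [Finset.sum_eq_single u]
    · rw [← hu]; simp
    · intro v _ hv
      rw [if_neg, zero_mul]
      rw [← hu]
      intro h; exact hv (Units.ext h.symm)
    · simp
  rw [hmain, hsplit, hfe]
  apply Real.abs_le_sqrt
  have hcs := Finset.sum_mul_sq_le_sq_mul_sq Finset.univ (fun u : (ZMod m)ˣ => f u)
    (fun u : (ZMod m)ˣ => e (b * (u : ZMod m)⁻¹))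
  refine hcs.trans ?_
  have h1 : ∑ u : (ZMod m)ˣ, f u ^ 2 ≤ (4 * Real.log m) * ((PP.card * PP.card) * (2 * (X * X / m))) := by
    calc ∑ u : (ZMod m)ˣ, f u ^ 2 = ∑ u ∈ Finset.univ.image (fun u : (ZMod m)ˣ => (u : ZMod m)), f u ^ 2 := by
          rw [Finset.sum_image]
          intro x _ y _ h; exact Units.ext h
      _ ≤ ∑ u : ZMod m, f u ^ 2 :=
          Finset.sum_le_sum_of_subset_of_nonneg (Finset.subset_univ _) (fun _ _ _ => sq_nonneg _)
      _ = ((((PP ×ˢ PP) ×ˢ (PP ×ˢ PP)).filter (fun x : (ℕ × ℕ) × (ℕ × ℕ) =>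
      ((x.1.1 * x.1.2 : ℕ) : ZMod m) = ((x.2.1 * x.2.2 : ℕ) : ZMod m))).card : ℝ) := by
          rw [Finset.card_filter]
          push_cast
          rw [Finset.sum_product (PP ×ˢ PP) (PP ×ˢ PP)]
          simp only [hf, sq, Finset.sum_mul_sum]
          rw [Finset.sum_comm]
          apply Finset.sum_congr rfl
          intro x _
          rw [Finset.sum_comm]
          apply Finset.sum_congr rfl
          intro y _
          simp only [ite_mul, one_mul, zero_mul]
          rw [Finset.sum_ite_eq]
          simp only [Finset.mem_univ, if_true]
          push_cast
          simp only [eq_comm]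
      _ ≤ _ := by
          refine ((Nat.cast_le (α := ℝ)).2 (count_quads hm hX PP hPP)).trans ?_
          push_cast
          have hfl : ((⌊4 * Real.log m⌋₊ : ℕ) : ℝ) ≤ 4 * Real.log m := Nat.floor_le (by linarith)
          have h3 : ((X * X / m : ℕ) : ℝ) ≤ X * X / m := by
            refine Nat.cast_div_le.trans ?_; push_cast; exact le_rfl
          have h4 : (1:ℝ) ≤ X * X / m := by
            rw [le_div_iff₀ hmr, one_mul]; exact_mod_cast hX2
          gcongr
          linarith
  have h2 : ∑ u : (ZMod m)ˣ, e (b * (u : ZMod m)⁻¹) ^ 2 ≤ 3840 * (Real.log m) ^ 3 * (X * PP.card) := by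
    refine le_trans ?_ (energy_e hm hX PP hPP hTX)
    calc ∑ u : (ZMod m)ˣ, e (b * (u : ZMod m)⁻¹) ^ 2 =
        ∑ u ∈ Finset.univ.image (fun u : (ZMod m)ˣ => (b * (u : ZMod m)⁻¹ : ZMod m)), e u ^ 2 := by
          rw [Finset.sum_image]
          intro x _ y _ h
          have h5 := b.isUnit.mul_left_cancel h
          have := congrArg (fun z => (x:ZMod m) * y * z) h5
          have hx := ZMod.mul_inv_of_unit _ x.isUnit
          have hy := ZMod.mul_inv_of_unit _ y.isUnit
          apply Units.ext
          linear_combination (y:ZMod m) * hx - (x:ZMod m) * hy - this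
      _ ≤ ∑ u : ZMod m, e u ^ 2 :=
          Finset.sum_le_sum_of_subset_of_nonneg (Finset.subset_univ _) (fun _ _ _ => sq_nonneg _)
  calc _ ≤ ((4 * Real.log m) * ((PP.card * PP.card) * (2 * (X * X / m)))) *
        (3840 * (Real.log m) ^ 3 * (X * PP.card)) :=
        mul_le_mul h1 h2 (Finset.sum_nonneg fun _ _ => sq_nonneg _) (by positivity)
    _ = _ := by ring


noncomputable def rr (m : ℕ) (PP : Finset ℕ) (b : ZMod m) (n : ℕ) : ℝ :=
  ∑ p₁ ∈ PP, ∑ p₂ ∈ PP, ∑ p₃ ∈ PP, if (p₁ : ZMod m) * p₂ * p₃ * n = b then (1:ℝ) else 0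

lemma rr_nonneg (m : ℕ) (PP : Finset ℕ) (b : ZMod m) (n : ℕ) : 0 ≤ rr m PP b n := by
  unfold rr; positivity

lemma rr_pos_iff {m : ℕ} {PP : Finset ℕ} {b : ZMod m} {n : ℕ} (h : rr m PP b n ≠ 0) :
    ∃ p₁ ∈ PP, ∃ p₂ ∈ PP, ∃ p₃ ∈ PP, (p₁ : ZMod m) * p₂ * p₃ * n = b := by
  by_contra hcon
  push Not at hcon
  apply h
  unfold rr
  refine Finset.sum_eq_zero fun p₁ h₁ => Finset.sum_eq_zero fun p₂ h₂ =>
    Finset.sum_eq_zero fun p₃ h₃ => if_neg (hcon p₁ h₁ p₂ h₂ p₃ h₃)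

noncomputable def ERR (m X N : ℕ) : ℝ :=
  Real.sqrt (30720 * (Real.log m) ^ 4 * ((X:ℝ) * N) ^ 3 / m) + (N:ℝ) ^ 3 / m

lemma sum_multiples (X q : ℕ) (hq : 0 < q) (f : ℕ → ℝ) :
    ∑ n ∈ Finset.Icc 1 X, (if q ∣ n then f n else 0) = ∑ t ∈ Finset.Icc 1 (X / q), f (q * t) := by
  rw [← Finset.sum_filter]
  have : (Finset.Icc 1 X).filter (fun n => q ∣ n) = (Finset.Icc 1 (X / q)).image (fun t => q * t) := by
    ext n
    simp only [Finset.mem_filter, Finset.mem_Icc, Finset.mem_image]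
    constructor
    · rintro ⟨⟨h1, h2⟩, t, rfl⟩
      refine ⟨t, ⟨Nat.pos_of_ne_zero (by rintro rfl; simp at h1), ?_⟩, rfl⟩
      rw [Nat.le_div_iff_mul_le hq]; linarith
    · rintro ⟨t, ⟨h1, h2⟩, rfl⟩
      rw [Nat.le_div_iff_mul_le hq] at h2
      exact ⟨⟨Nat.mul_pos hq h1, by linarith⟩, Dvd.intro t rfl⟩
  rw [this, Finset.sum_image]
  intro a _ b _ h; exact Nat.eq_of_mul_eq_mul_left hq h

lemma Aq_bound {m : ℕ} [NeZero m] (hm : 3 ≤ m) {X : ℕ} (hX : X ≤ m) (hX2 : m ≤ X * X) (PP : Finset ℕ)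
    (hPP : ∀ p ∈ PP, p.Prime ∧ p ≤ X ∧ ¬ p ∣ m) (b : (ZMod m)ˣ) {q : ℕ} (hq : 0 < q)
    (hqm : q.Coprime m) :
    |(∑ n ∈ Finset.Icc 1 X, if q ∣ n then rr m PP b n else 0) - (PP.card : ℝ) ^ 3 * X / m / q| ≤
      ERR m X PP.card := by
  have hmr : (0:ℝ) < m := by exact_mod_cast (by omega : 0 < m)
  have hqr : (0:ℝ) < q := by exact_mod_cast hq
  rw [sum_multiples X q hq]
  set uq : (ZMod m)ˣ := ZMod.unitOfCoprime q hqm with huq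
  have huqv : (uq : ZMod m) = q := ZMod.coe_unitOfCoprime q hqm
  have h1 : ∑ t ∈ Finset.Icc 1 (X / q), rr m PP b (q * t) =
      ∑ p₁ ∈ PP, ∑ p₂ ∈ PP, ∑ p₃ ∈ PP, ∑ t ∈ Finset.Icc 1 (X / q),
      (if (p₁ : ZMod m) * p₂ * p₃ * t = ((b * uq⁻¹ : (ZMod m)ˣ) : ZMod m) then (1:ℝ) else 0) := by
    unfold rr
    rw [Finset.sum_comm]
    refine Finset.sum_congr rfl fun p₁ _ => ?_
    rw [Finset.sum_comm]
    refine Finset.sum_congr rfl fun p₂ _ => ?_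
    rw [Finset.sum_comm]
    refine Finset.sum_congr rfl fun p₃ _ => ?_
    refine Finset.sum_congr rfl fun t _ => ?_
    have hiff : (p₁ : ZMod m) * p₂ * p₃ * ((q * t : ℕ) : ZMod m) = b ↔
        (p₁ : ZMod m) * p₂ * p₃ * t = ((b * uq⁻¹ : (ZMod m)ˣ) : ZMod m) := by
      rw [Units.val_mul, Units.eq_mul_inv_iff_mul_eq, huqv]
      push_cast
      constructor
      · intro h; rw [← h]; ring
      · intro h; rw [← h]; ring
    simp only [hiff]
  rw [h1]
  have h2 := equidist hm hX hX2 PP hPP (T := X / q) (Nat.div_le_self _ _) (b * uq⁻¹)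
  have h3 : |(PP.card : ℝ) ^ 3 * ((X / q : ℕ) : ℝ) / m - (PP.card : ℝ) ^ 3 * X / m / q| ≤
      (PP.card : ℝ) ^ 3 / m := by
    have e : (PP.card : ℝ) ^ 3 * ((X / q : ℕ) : ℝ) / m - (PP.card : ℝ) ^ 3 * X / m / q =
        (PP.card : ℝ) ^ 3 / m * (((X / q : ℕ) : ℝ) - X / q) := by field_simp
    rw [e, abs_mul, abs_of_nonneg (by positivity)]
    have h4 : ((X / q : ℕ) : ℝ) ≤ X / q := Nat.cast_div_le
    have h5 : (X:ℝ) / q < ((X / q : ℕ) : ℝ) + 1 := by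
      rw [div_lt_iff₀ hqr]
      have := Nat.lt_mul_div_succ X hq
      have : (X:ℝ) < q * (((X / q : ℕ) : ℝ) + 1) := by exact_mod_cast this
      linarith
    have h6 : |((X / q : ℕ) : ℝ) - X / q| ≤ 1 := by rw [abs_le]; constructor <;> linarith
    have h7 : 0 ≤ (PP.card : ℝ) ^ 3 / m := by positivity
    nlinarith
  unfold ERR
  exact (abs_sub_le _ _ _).trans (add_le_add h2 h3)

/-- linear sieve functional -/
noncomputable def Lsum (P : ℕ) (w : ℕ → ℝ) (n : ℕ) : ℝ :=
  ∑ d ∈ P.divisors, if d ∣ n then w d else 0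

lemma quad_equidist {m : ℕ} [NeZero m] (hm : 3 ≤ m) {X : ℕ} (hX : X ≤ m) (hX2 : m ≤ X * X) (PP : Finset ℕ)
    (hPP : ∀ p ∈ PP, p.Prime ∧ p ≤ X ∧ ¬ p ∣ m) (b : (ZMod m)ˣ) {q : ℕ} (hq : 0 < q)
    (hqm : q.Coprime m) {P : ℕ} (hP : P.Coprime m) (w : ℕ → ℝ) :
    |(∑ n ∈ Finset.Icc 1 X, if q ∣ n then rr m PP b n * Lsum P w n ^ 2 else 0) -
      (PP.card : ℝ) ^ 3 * X / m * ∑ d₁ ∈ P.divisors, ∑ d₂ ∈ P.divisors,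
        w d₁ * w d₂ / (Nat.lcm q (Nat.lcm d₁ d₂) : ℝ)| ≤
      ERR m X PP.card * (∑ d ∈ P.divisors, |w d|) ^ 2 := by
  have h1 : (∑ n ∈ Finset.Icc 1 X, if q ∣ n then rr m PP b n * Lsum P w n ^ 2 else 0) =
      ∑ d₁ ∈ P.divisors, ∑ d₂ ∈ P.divisors, w d₁ * w d₂ *
        ∑ n ∈ Finset.Icc 1 X, if Nat.lcm q (Nat.lcm d₁ d₂) ∣ n then rr m PP b n else 0 := by
    simp_rw [Finset.mul_sum]
    rw [Finset.sum_congr rfl (fun d _ => Finset.sum_comm), Finset.sum_comm]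
    apply Finset.sum_congr rfl
    intro n _
    unfold Lsum
    rw [sq, Finset.sum_mul_sum]
    split_ifs with h
    · rw [Finset.mul_sum]
      apply Finset.sum_congr rfl
      intro d₁ _
      rw [Finset.mul_sum]
      apply Finset.sum_congr rfl
      intro d₂ _
      by_cases a : d₁ ∣ n <;> by_cases c : d₂ ∣ n <;> simp [Nat.lcm_dvd_iff, a, c, h]
      ring
    · symm
      refine Finset.sum_eq_zero fun d₁ _ => Finset.sum_eq_zero fun d₂ _ => ?_
      rw [if_neg, mul_zero]
      intro h3; exact h ((Nat.dvd_lcm_left _ _).trans h3)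
  rw [h1, Finset.mul_sum, ← Finset.sum_sub_distrib, sq, Finset.sum_mul_sum, Finset.mul_sum]
  refine (Finset.abs_sum_le_sum_abs _ _).trans (Finset.sum_le_sum fun d₁ hd₁ => ?_)
  rw [Finset.mul_sum, ← Finset.sum_sub_distrib, Finset.mul_sum]
  refine (Finset.abs_sum_le_sum_abs _ _).trans (Finset.sum_le_sum fun d₂ hd₂ => ?_)
  have c1 : d₁.Coprime m := hP.coprime_dvd_left (Nat.dvd_of_mem_divisors hd₁)
  have c2 : d₂.Coprime m := hP.coprime_dvd_left (Nat.dvd_of_mem_divisors hd₂)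
  have c3 : (Nat.lcm q (Nat.lcm d₁ d₂)).Coprime m := by
    refine Nat.Coprime.coprime_dvd_left (Nat.lcm_dvd_mul _ _) ?_
    refine Nat.Coprime.mul_left hqm ?_
    exact Nat.Coprime.coprime_dvd_left (Nat.lcm_dvd_mul _ _) (Nat.Coprime.mul_left c1 c2)
  have hpos : 0 < Nat.lcm q (Nat.lcm d₁ d₂) := Nat.lcm_pos hq
    (Nat.lcm_pos (Nat.pos_of_mem_divisors hd₁) (Nat.pos_of_mem_divisors hd₂))
  have hA := Aq_bound hm hX hX2 PP hPP b hpos c3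
  have e : ∀ S : ℝ, w d₁ * w d₂ * S - (PP.card : ℝ) ^ 3 * X / m * (w d₁ * w d₂ / (Nat.lcm q (Nat.lcm d₁ d₂) : ℝ))
      = (w d₁ * w d₂) * (S - (PP.card : ℝ) ^ 3 * X / m / (Nat.lcm q (Nat.lcm d₁ d₂) : ℝ)) := by
    intro S; ring
  rw [e, abs_mul, abs_mul, mul_comm (ERR _ _ _)]
  gcongr

lemma rr_le {m : ℕ} [NeZero m] (hm : 3 ≤ m) {X : ℕ} (hX : X ≤ m) (hX2 : m ≤ X * X) (PP : Finset ℕ)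
    (hPP : ∀ p ∈ PP, p.Prime ∧ p ≤ X ∧ ¬ p ∣ m) (b : (ZMod m)ˣ) (n : ℕ) :
    rr m PP b n ≤ PP.card * (8 * Real.log m * (X * X / m)) := by
  classical
  have hmr : (0:ℝ) < m := by exact_mod_cast (by omega : 0 < m)
  have hmpos : 0 < m := by omega
  have hlog : 1 ≤ Real.log m := log_ge_one hm
  have hunit : ∀ p ∈ PP, IsUnit (p : ZMod m) := by
    intro p hp
    obtain ⟨h1, _, h3⟩ := hPP p hp
    exact (ZMod.isUnit_iff_coprime p m).2 (h1.coprime_iff_not_dvd.2 h3)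
  unfold rr
  rw [← nsmul_eq_mul]
  apply Finset.sum_le_card_nsmul
  intro p₁ hp₁
  by_cases hn : IsUnit (n : ZMod m)
  swap
  · have : ∑ p₂ ∈ PP, ∑ p₃ ∈ PP, (if (p₁ : ZMod m) * p₂ * p₃ * n = b then (1:ℝ) else 0) = 0 := by
      refine Finset.sum_eq_zero fun p₂ h₂ => Finset.sum_eq_zero fun p₃ h₃ => if_neg ?_
      intro h
      have : IsUnit ((p₁ : ZMod m) * p₂ * p₃ * n) := by rw [h]; exact b.isUnit
      exact hn (isUnit_of_mul_isUnit_right this)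
    rw [this]; positivity
  obtain ⟨c, hc⟩ := ((hunit p₁ hp₁).mul hn)
  set g : ℕ := ((b * c⁻¹ : (ZMod m)ˣ) : ZMod m).val with hg
  have hgv : (g : ZMod m) = ((b * c⁻¹ : (ZMod m)ˣ) : ZMod m) := by rw [hg]; simp
  have hgm : g < m := ZMod.val_lt _
  have hval : ∀ p q : ℕ, (p₁ : ZMod m) * p * q * n = b → p * q = m * (p * q / m) + g := by
    intro p q h
    have h1 : ((p * q : ℕ) : ZMod m) = (g : ZMod m) := by
      rw [hgv, Units.val_mul, Units.eq_mul_inv_iff_mul_eq, hc, ← h]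
      push_cast; ring
    rw [ZMod.natCast_eq_natCast_iff', Nat.mod_eq_of_lt hgm] at h1
    conv_lhs => rw [← Nat.div_add_mod (p * q) m, h1]
  have hcard : ((PP ×ˢ PP).filter (fun x : ℕ × ℕ => (p₁ : ZMod m) * x.1 * x.2 * n = b)).card ≤
      ⌊4 * Real.log m⌋₊ * (X * X / m + 1) := by
    have hr : (Finset.range (X * X / m + 1)).card = X * X / m + 1 := Finset.card_range _
    rw [← hr]
    apply Finset.card_le_mul_card_image_of_maps_to (f := fun x : ℕ × ℕ => x.1 * x.2 / m)
    · rintro ⟨p, q⟩ hx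
      simp only [Finset.mem_filter, Finset.mem_product] at hx
      simp only [Finset.mem_range]
      exact Nat.lt_succ_of_le (Nat.div_le_div_right
        (Nat.mul_le_mul (hPP _ hx.1.1).2.1 (hPP _ hx.1.2).2.1))
    · intro k _
      set V := m * k + g with hV
      by_cases hVgood : V ≠ 0 ∧ V ≤ m * m
      · refine le_trans ?_ (omega_le hm hVgood.1 hVgood.2)
        apply Finset.card_le_card_of_injOn (fun x => x.1)
        · intro x hx
          simp only [Finset.coe_filter, Finset.mem_filter, Finset.mem_product,
            Set.mem_ofPred_eq] at hx
          simp only [Finset.mem_coe, Nat.mem_primeFactors]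
          refine ⟨(hPP _ hx.1.1.1).1, ⟨x.2, ?_⟩, hVgood.1⟩
          rw [hval _ _ hx.1.2, hx.2]
        · intro x hx x' hx' h
          simp only [Finset.coe_filter, Finset.mem_filter, Finset.mem_product,
            Set.mem_ofPred_eq] at hx hx' h
          have e1 := hval _ _ hx.1.2
          have e2 := hval _ _ hx'.1.2
          rw [hx.2] at e1
          rw [hx'.2] at e2
          have h0 : 0 < x'.1 := (hPP _ hx'.1.1.1).1.pos
          rw [← e2, h] at e1
          exact Prod.ext h (Nat.eq_of_mul_eq_mul_left h0 e1)
      · rw [Finset.card_eq_zero.2]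
        · exact Nat.zero_le _
        rw [Finset.filter_eq_empty_iff]
        intro x hx hfx
        simp only [Finset.mem_filter, Finset.mem_product] at hx
        have e1 := hval _ _ hx.2
        rw [hfx] at e1
        apply hVgood
        rw [hV, ← e1]
        exact ⟨Nat.mul_ne_zero (hPP _ hx.1.1).1.ne_zero (hPP _ hx.1.2).1.ne_zero,
          Nat.mul_le_mul ((hPP _ hx.1.1).2.1.trans hX) ((hPP _ hx.1.2).2.1.trans hX)⟩
  have e2 : ∑ p₂ ∈ PP, ∑ p₃ ∈ PP, (if (p₁ : ZMod m) * p₂ * p₃ * n = b then (1:ℝ) else 0) =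
      (((PP ×ˢ PP).filter (fun x : ℕ × ℕ => (p₁ : ZMod m) * x.1 * x.2 * n = b)).card : ℝ) := by
    rw [Finset.card_filter]
    push_cast
    rw [Finset.sum_product]
  rw [e2]
  refine ((Nat.cast_le (α := ℝ)).2 hcard).trans ?_
  push_cast
  have hfl : ((⌊4 * Real.log m⌋₊ : ℕ) : ℝ) ≤ 4 * Real.log m := Nat.floor_le (by linarith)
  have h3 : ((X * X / m : ℕ) : ℝ) ≤ X * X / m := by
    refine Nat.cast_div_le.trans ?_; push_cast; exact le_rfl
  have h4 : (1:ℝ) ≤ X * X / m := by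
    rw [le_div_iff₀ hmr, one_mul]; exact_mod_cast hX2
  calc _ ≤ 4 * Real.log m * (X * X / m + X * X / m : ℝ) := by gcongr
    _ = _ := by ring


/-- product of the primes up to `m` not dividing `m` -/
def Pm (m : ℕ) : ℕ := ∏ p ∈ (Finset.range (m + 1)).filter (fun p => p.Prime ∧ ¬ p ∣ m), p

lemma Pm_coprime (m : ℕ) : (Pm m).Coprime m := by
  apply Nat.Coprime.prod_left
  intro p hp
  have h := (Finset.mem_filter.1 hp).2
  exact h.1.coprime_iff_not_dvd.2 h.2

lemma Pm_squarefree (m : ℕ) : Squarefree (Pm m) := by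
  apply Finset.squarefree_prod_of_pairwise_isCoprime
  · intro p hp q hq hpq
    simp only [Function.onFun]
    rw [← Nat.coprime_iff_isRelPrime]
    exact (Nat.coprime_primes (Finset.mem_filter.1 hp).2.1 (Finset.mem_filter.1 hq).2.1).2 hpq
  · intro p hp
    exact (Finset.mem_filter.1 hp).2.1.squarefree

lemma prime_dvd_Pm {m p : ℕ} (hp : p.Prime) (hpm : ¬ p ∣ m) (h : p ≤ m) : p ∣ Pm m :=
  Finset.dvd_prod_of_mem (fun p => p)
    (Finset.mem_filter.2 ⟨Finset.mem_range.2 (Nat.lt_succ_of_le h), hp, hpm⟩)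

lemma dvd_Pm {m k : ℕ} (hk : Squarefree k) (hkm : k.Coprime m) (h : k ≤ m) : k ∣ Pm m := by
  rw [← Nat.prod_primeFactors_of_squarefree hk]
  apply Finset.prod_dvd_prod_of_subset
  intro p hp
  have hpp := Nat.prime_of_mem_primeFactors hp
  have hpk := Nat.dvd_of_mem_primeFactors hp
  refine Finset.mem_filter.2 ⟨Finset.mem_range.2 (Nat.lt_succ_of_le
    ((Nat.le_of_dvd (Nat.pos_of_ne_zero hk.ne_zero) hpk).trans h)), hpp, ?_⟩
  exact hpp.coprime_iff_not_dvd.1 (hkm.coprime_dvd_left hpk)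

lemma mem_div_lt {m : ℕ} {t : ℝ} (ht : t ≤ m) :
    (Pm m).divisors.filter (fun k : ℕ => (k:ℝ) < t) = SF m t := by
  ext k
  simp only [Finset.mem_filter, Nat.mem_divisors, mem_SF]
  constructor
  · rintro ⟨⟨h1, h2⟩, h3⟩
    exact ⟨h3, (Pm_squarefree m).squarefree_of_dvd h1, (Pm_coprime m).coprime_dvd_left h1⟩
  · rintro ⟨h1, h2, h3⟩
    exact ⟨⟨dvd_Pm h2 h3 (by exact_mod_cast (h1.le.trans ht)), (Pm_squarefree m).ne_zero⟩, h1⟩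

noncomputable def RS (m : ℕ) (t₁ t₂ : ℝ) : ℝ :=
  ∑ k ∈ (Pm m).divisors, if t₁ ≤ (k:ℝ) ∧ (k:ℝ) < t₂ then (1:ℝ) / (k.totient : ℝ) else 0

lemma RS_eq {m : ℕ} {t₁ t₂ : ℝ} (h12 : t₁ ≤ t₂) (h2 : t₂ ≤ m) :
    RS m t₁ t₂ = GG m t₂ - GG m t₁ := by
  rw [RS, GG, GG, ← mem_div_lt h2, ← mem_div_lt (h12.trans h2), Finset.sum_filter, Finset.sum_filter,
    ← Finset.sum_sub_distrib]
  apply Finset.sum_congr rfl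
  intro k _
  by_cases a : (k:ℝ) < t₁
  · have : (k:ℝ) < t₂ := a.trans_le h12
    simp [a, this]
  · have a' : t₁ ≤ (k:ℝ) := not_lt.1 a
    by_cases b : (k:ℝ) < t₂ <;> simp [a, a', b]

lemma RS_upper {m : ℕ} (hm : 3 ≤ m) {t₁ t₂ : ℝ} (h1 : 1 ≤ t₁) (h12 : t₁ ≤ t₂) (h2 : t₂ ≤ m) :
    (m:ℝ) / m.totient * RS m t₁ t₂ ≤ Real.log t₂ - Real.log t₁ + EE m := by
  rw [RS_eq h12 h2, mul_sub]
  have := GG_lower m (by omega) t₁ h1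
  have := GG_upper m hm t₂ (h1.trans h12) h2
  linarith

lemma RS_lower {m : ℕ} (hm : 3 ≤ m) {t₁ t₂ : ℝ} (h1 : 1 ≤ t₁) (h12 : t₁ ≤ t₂) (h2 : t₂ ≤ m) :
    Real.log t₂ - Real.log t₁ - EE m ≤ (m:ℝ) / m.totient * RS m t₁ t₂ := by
  rw [RS_eq h12 h2, mul_sub]
  have := GG_lower m (by omega) t₂ (h1.trans h12)
  have := GG_upper m hm t₁ h1 (h12.trans h2)
  linarith

/-- logarithmic cell of an integer -/
noncomputable def cl (u : ℝ) (k : ℕ) : ℕ := ⌊Real.log k / u⌋₊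

lemma cl_eq_iff {u : ℝ} (hu : 0 < u) {k : ℕ} (hk : 0 < k) (i : ℕ) :
    cl u k = i ↔ Real.exp (i * u) ≤ k ∧ (k:ℝ) < Real.exp ((i + 1) * u) := by
  have hkr : (0:ℝ) < k := by exact_mod_cast hk
  have h1 : 0 ≤ Real.log k / u := div_nonneg (Real.log_natCast_nonneg k) hu.le
  rw [cl, Nat.floor_eq_iff h1, le_div_iff₀ hu, div_lt_iff₀ hu, Real.le_log_iff_exp_le hkr,
    Real.log_lt_iff_lt_exp hkr]

lemma le_cl {u : ℝ} (hu : 0 < u) {k : ℕ} (hk : 0 < k) {i : ℕ} (h : Real.exp (i * u) ≤ k) : i ≤ cl u k := by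
  have hkr : (0:ℝ) < k := by exact_mod_cast hk
  rw [cl]
  apply Nat.le_floor
  rw [le_div_iff₀ hu, Real.le_log_iff_exp_le hkr]; exact h

lemma cl_lt {u : ℝ} (hu : 0 < u) {k : ℕ} (hk : 0 < k) {i : ℕ} (h : (k:ℝ) < Real.exp (i * u)) : cl u k < i := by
  have hkr : (0:ℝ) < k := by exact_mod_cast hk
  have h1 : 0 ≤ Real.log k / u := div_nonneg (Real.log_natCast_nonneg k) hu.le
  rw [cl, Nat.floor_lt h1, div_lt_iff₀ hu, Real.log_lt_iff_lt_exp hkr]; exact h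

/-- cell sum -/
noncomputable def CS (m : ℕ) (u : ℝ) (i : ℕ) : ℝ := RS m (Real.exp (i * u)) (Real.exp ((i + 1) * u))

lemma CS_nonneg (m : ℕ) (u : ℝ) (i : ℕ) : 0 ≤ CS m u i := by
  unfold CS RS; positivity

lemma CS_bounds {m : ℕ} (hm : 3 ≤ m) {u : ℝ} (hu : 0 < u) {i n : ℕ} (hi : i < n)
    (hn : Real.exp (n * u) ≤ m) :
    u - EE m ≤ (m:ℝ) / m.totient * CS m u i ∧ (m:ℝ) / m.totient * CS m u i ≤ u + EE m := by
  have h1 : 1 ≤ Real.exp (i * u) := Real.one_le_exp (by positivity)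
  have h12 : Real.exp (i * u) ≤ Real.exp ((i + 1) * u) := by
    apply Real.exp_le_exp.2; nlinarith
  have h2 : Real.exp ((i + 1) * u) ≤ m := by
    refine le_trans (Real.exp_le_exp.2 ?_) hn
    have : ((i + 1 : ℕ) : ℝ) ≤ n := by exact_mod_cast hi
    push_cast at this
    nlinarith
  have a := RS_lower hm h1 h12 h2
  have b := RS_upper hm h1 h12 h2
  rw [Real.log_exp, Real.log_exp] at a b
  unfold CS
  constructor <;> linarith

lemma cell_sum {m : ℕ} {u : ℝ} (hu : 0 < u) (n : ℕ) (F : ℕ → ℝ) (hF : ∀ i, n ≤ i → F i = 0) :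
    ∑ k ∈ (Pm m).divisors, F (cl u k) / (k.totient : ℝ) = ∑ i ∈ Finset.range n, F i * CS m u i := by
  unfold CS RS
  simp_rw [Finset.mul_sum]
  rw [Finset.sum_comm]
  apply Finset.sum_congr rfl
  intro k hk
  have hk0 := Nat.pos_of_mem_divisors hk
  have : ∀ i ∈ Finset.range n, F i * (if Real.exp (i * u) ≤ (k:ℝ) ∧ (k:ℝ) < Real.exp ((i + 1) * u) then
      (1:ℝ) / (k.totient : ℝ) else 0) = if i = cl u k then F (cl u k) / (k.totient : ℝ) else 0 := by
    intro i _
    by_cases h : i = cl u k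
    · rw [if_pos h, if_pos ((cl_eq_iff hu hk0 i).1 h.symm), ← h]; ring
    · rw [if_neg h, if_neg, mul_zero]
      intro h2; exact h ((cl_eq_iff hu hk0 i).2 h2).symm
  rw [Finset.sum_congr rfl this, Finset.sum_ite_eq']
  split_ifs with h
  · rfl
  · rw [hF _ (by simpa using h), zero_div]

/-- sieve coefficients on cells -/
def ccn (i : ℕ) : ℕ := if i < 144 then 169 - i else 0

noncomputable def cc (i : ℕ) : ℝ := (ccn i : ℝ)

lemma cc_nonneg (i : ℕ) : 0 ≤ cc i := Nat.cast_nonneg _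

lemma cc_anti {i j : ℕ} (h : i ≤ j) : cc j ≤ cc i := by
  unfold cc ccn
  norm_cast
  split_ifs <;> omega

lemma cc_zero {i : ℕ} (h : 144 ≤ i) : cc i = 0 := by
  unfold cc ccn; rw [if_neg (by omega)]; simp

lemma cc_le (i : ℕ) : cc i ≤ 169 := by
  unfold cc ccn
  norm_cast
  split_ifs <;> omega

noncomputable def HH (m : ℕ) (u : ℝ) : ℝ := ∑ k ∈ (Pm m).divisors, cc (cl u k) / (k.totient : ℝ)

noncomputable def yy (m : ℕ) (u : ℝ) (k : ℕ) : ℝ := cc (cl u k) / HH m u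

lemma HH_ge (m : ℕ) (u : ℝ) : 169 ≤ HH m u := by
  have h1 : 1 ∈ (Pm m).divisors := by simp [(Pm_squarefree m).ne_zero]
  refine le_trans ?_ (Finset.single_le_sum (f := fun k => cc (cl u k) / (k.totient : ℝ))
    (fun k _ => div_nonneg (cc_nonneg _) (Nat.cast_nonneg _)) h1)
  simp [cl, cc, ccn]

lemma ratio_pos {m : ℕ} (hm : 3 ≤ m) : 0 < (m:ℝ) / m.totient := by
  have : 0 < m.totient := Nat.totient_pos.2 (by omega)
  have h2 : 0 < m := by omega
  positivity

lemma cs_sum_upper {m : ℕ} (hm : 3 ≤ m) {u : ℝ} (hu : 0 < u) {n : ℕ}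
    (hn : Real.exp (n * u) ≤ m) (F : ℕ → ℝ) (hF : ∀ i, 0 ≤ F i) :
    (m:ℝ) / m.totient * ∑ i ∈ Finset.range n, F i * CS m u i ≤ (u + EE m) * ∑ i ∈ Finset.range n, F i := by
  rw [Finset.mul_sum, Finset.mul_sum]
  apply Finset.sum_le_sum
  intro i hi
  have := (CS_bounds hm hu (Finset.mem_range.1 hi) hn).2
  have := mul_le_mul_of_nonneg_left this (hF i)
  linarith

lemma cs_sum_lower {m : ℕ} (hm : 3 ≤ m) {u : ℝ} (hu : 0 < u) {n : ℕ}
    (hn : Real.exp (n * u) ≤ m) (F : ℕ → ℝ) (hF : ∀ i, 0 ≤ F i) :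
    (u - EE m) * ∑ i ∈ Finset.range n, F i ≤ (m:ℝ) / m.totient * ∑ i ∈ Finset.range n, F i * CS m u i := by
  rw [Finset.mul_sum, Finset.mul_sum]
  apply Finset.sum_le_sum
  intro i hi
  have := (CS_bounds hm hu (Finset.mem_range.1 hi) hn).1
  have := mul_le_mul_of_nonneg_left this (hF i)
  linarith

lemma HH_eq {m : ℕ} {u : ℝ} (hu : 0 < u) : HH m u = ∑ i ∈ Finset.range 144, cc i * CS m u i :=
  cell_sum hu 144 cc (fun _ h => cc_zero h)

lemma kill_j {m : ℕ} (hm : 3 ≤ m) {u : ℝ} (hu : 0 < u) (hn : Real.exp ((144 : ℕ) * u) ≤ m)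
    {Q : ℕ} (hQ : Q ∣ Pm m) {p j : ℕ} (hp : 0 < p) (hpj : cl u p = j) :
    (m:ℝ) / m.totient * ∑ k ∈ Q.divisors, (cc (cl u k) - cc (cl u (p * k))) ^ 2 / (k.totient : ℝ) ≤
      (u + EE m) * ∑ i ∈ Finset.range 144, (cc i - cc (i + j + 1)) ^ 2 := by
  have hP0 := (Pm_squarefree m).ne_zero
  refine le_trans ?_ (cs_sum_upper hm hu hn (fun i => (cc i - cc (i + j + 1)) ^ 2) (fun i => sq_nonneg _))
  refine mul_le_mul_of_nonneg_left ?_ (ratio_pos hm).le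
  rw [← cell_sum hu 144 (fun i => (cc i - cc (i + j + 1)) ^ 2)]
  · refine le_trans (Finset.sum_le_sum ?_) (Finset.sum_le_sum_of_subset_of_nonneg
      (Nat.divisors_subset_of_dvd hP0 hQ) ?_)
    · intro k hk
      have hk0 := Nat.pos_of_mem_divisors hk
      have hkr : (0:ℝ) < k := by exact_mod_cast hk0
      have hpk0 : 0 < p * k := Nat.mul_pos hp hk0
      obtain ⟨_, hk2⟩ := (cl_eq_iff hu hk0 (cl u k)).1 rfl
      obtain ⟨_, hp2⟩ := (cl_eq_iff hu hp j).1 hpj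
      have hpr : (1:ℝ) ≤ p := by exact_mod_cast hp
      have hlow : cl u k ≤ cl u (p * k) := by
        apply le_cl hu hpk0
        obtain ⟨hk1, _⟩ := (cl_eq_iff hu hk0 (cl u k)).1 rfl
        push_cast; nlinarith
      have hup : cl u (p * k) ≤ cl u k + j + 1 := by
        apply Nat.lt_succ_iff.1
        apply cl_lt hu hpk0
        push_cast
        calc (p:ℝ) * k < Real.exp ((j + 1) * u) * Real.exp ((cl u k + 1) * u) := by
              apply mul_lt_mul'' hp2 hk2 <;> positivity
          _ = _ := by rw [← Real.exp_add]; congr 1; ring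
      have a1 := cc_anti hlow
      have a2 := cc_anti hup
      gcongr
    · intro k _ _
      positivity
  · intro i hi
    rw [cc_zero hi, cc_zero (by omega)]; simp

lemma kill_0 {m : ℕ} (hm : 3 ≤ m) {u : ℝ} (hu : 0 < u) (hn : Real.exp ((144 : ℕ) * u) ≤ m)
    {Q : ℕ} (hQ : Q ∣ Pm m) {p : ℕ} (hp : 0 < p) (hpj : cl u p = 0) :
    (m:ℝ) / m.totient * ∑ k ∈ Q.divisors, (cc (cl u k) - cc (cl u (p * k))) ^ 2 / (k.totient : ℝ) ≤
      (Real.log p + EE m) * ∑ i ∈ Finset.range 144, (cc i - cc (i + 1)) ^ 2 := by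
  have hP0 := (Pm_squarefree m).ne_zero
  have hpr : (1:ℝ) ≤ p := by exact_mod_cast hp
  have hpr0 : (0:ℝ) < p := by linarith
  obtain ⟨_, hp2⟩ := (cl_eq_iff hu hp 0).1 hpj
  have hp2' : (p:ℝ) < Real.exp u := by simpa using hp2
  have step : ∑ k ∈ Q.divisors, (cc (cl u k) - cc (cl u (p * k))) ^ 2 / (k.totient : ℝ) ≤
      ∑ i ∈ Finset.range 144, (cc i - cc (i + 1)) ^ 2 *
        RS m (Real.exp ((i + 1) * u) / p) (Real.exp ((i + 1) * u)) := by
    unfold RS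
    simp_rw [Finset.mul_sum]
    rw [Finset.sum_comm]
    refine le_trans (Finset.sum_le_sum ?_) (Finset.sum_le_sum_of_subset_of_nonneg
      (Nat.divisors_subset_of_dvd hP0 hQ) ?_)
    · intro k hk
      have hk0 := Nat.pos_of_mem_divisors hk
      have hkr : (0:ℝ) < k := by exact_mod_cast hk0
      have hpk0 : 0 < p * k := Nat.mul_pos hp hk0
      obtain ⟨hk1, hk2⟩ := (cl_eq_iff hu hk0 (cl u k)).1 rfl
      have hlow : cl u k ≤ cl u (p * k) := by
        apply le_cl hu hpk0
        push_cast; nlinarith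
      have hup : cl u (p * k) ≤ cl u k + 1 := by
        apply Nat.lt_succ_iff.1
        apply cl_lt hu hpk0
        push_cast
        calc (p:ℝ) * k < Real.exp u * Real.exp ((cl u k + 1) * u) := by
              apply mul_lt_mul'' hp2' hk2 <;> positivity
          _ = _ := by rw [← Real.exp_add]; congr 1; ring
      have hnn : ∀ i ∈ Finset.range 144, 0 ≤ (cc i - cc (i + 1)) ^ 2 *
          (if Real.exp ((i + 1) * u) / p ≤ (k:ℝ) ∧ (k:ℝ) < Real.exp ((i + 1) * u) then
            (1:ℝ) / (k.totient : ℝ) else 0) := by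
        intro i _; positivity
      by_cases hc : cl u k < 144 ∧ Real.exp ((cl u k + 1) * u) / p ≤ (k:ℝ)
      · refine le_trans ?_ (Finset.single_le_sum hnn (Finset.mem_range.2 hc.1))
        rw [if_pos ⟨hc.2, hk2⟩, mul_one_div]
        have a1 := cc_anti hlow
        have a2 := cc_anti hup
        gcongr
      · have hz : (cc (cl u k) - cc (cl u (p * k))) ^ 2 / (k.totient : ℝ) = 0 := by
          by_cases h144 : cl u k < 144
          · have h3 : ¬ (Real.exp ((cl u k + 1) * u) / p ≤ (k:ℝ)) := fun h => hc ⟨h144, h⟩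
            rw [not_le, lt_div_iff₀ hpr0] at h3
            have : cl u (p * k) = cl u k := by
              refine le_antisymm ?_ hlow
              apply Nat.lt_succ_iff.1
              apply cl_lt hu hpk0
              push_cast; linarith
            rw [this]; simp
          · rw [cc_zero (by omega), cc_zero (by omega)]; simp
        rw [hz]
        exact Finset.sum_nonneg hnn
    · intro k _ _
      positivity
  calc _ ≤ (m:ℝ) / m.totient * ∑ i ∈ Finset.range 144, (cc i - cc (i + 1)) ^ 2 *
        RS m (Real.exp ((i + 1) * u) / p) (Real.exp ((i + 1) * u)) :=
        mul_le_mul_of_nonneg_left step (ratio_pos hm).le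
    _ ≤ _ := by
      rw [Finset.mul_sum, Finset.mul_sum]
      apply Finset.sum_le_sum
      intro i hi
      have hi' := Finset.mem_range.1 hi
      have h1 : 1 ≤ Real.exp ((i + 1) * u) / p := by
        rw [le_div_iff₀ hpr0, one_mul]
        refine hp2'.le.trans (Real.exp_le_exp.2 ?_)
        have : (0:ℝ) ≤ i := Nat.cast_nonneg i
        nlinarith
      have h12 : Real.exp ((i + 1) * u) / p ≤ Real.exp ((i + 1) * u) :=
        div_le_self (Real.exp_pos _).le hpr
      have h2 : Real.exp ((i + 1) * u) ≤ m := by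
        refine le_trans (Real.exp_le_exp.2 ?_) hn
        have : ((i + 1 : ℕ) : ℝ) ≤ (144:ℕ) := by exact_mod_cast hi'
        push_cast at this ⊢
        nlinarith
      have hb := RS_upper hm h1 h12 h2
      rw [Real.log_div (Real.exp_pos _).ne' hpr0.ne', Real.log_exp] at hb
      have := mul_le_mul_of_nonneg_left hb (sq_nonneg (cc i - cc (i + 1)))
      linarith


lemma sigma_le {k : ℕ} (hk : 0 < k) : ∑ d ∈ k.divisors, (d:ℝ) ≤ k * (1 + Real.log k) := by
  have hkr : (0:ℝ) < k := by exact_mod_cast hk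
  have h1 : ∑ d ∈ k.divisors, (d:ℝ) = ∑ d ∈ k.divisors, ((k / d : ℕ) : ℝ) :=
    (Nat.sum_div_divisors k (fun d => (d:ℝ))).symm
  rw [h1]
  have h2 : ∑ d ∈ k.divisors, ((k / d : ℕ) : ℝ) ≤ ∑ d ∈ Finset.Icc 1 k, (k:ℝ) * (d:ℝ)⁻¹ := by
    refine le_trans (Finset.sum_le_sum (fun d hd => ?_)) (Finset.sum_le_sum_of_subset_of_nonneg
      (s := k.divisors) (fun d hd => ?_) (fun d _ _ => ?_))
    · rw [← div_eq_mul_inv]; exact Nat.cast_div_le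
    · exact Finset.mem_Icc.2 ⟨Nat.pos_of_mem_divisors hd, Nat.divisor_le hd⟩
    · positivity
  refine h2.trans ?_
  rw [← Finset.mul_sum]
  gcongr
  have := harmonic_le_one_add_log k
  rw [harmonic_eq_sum_Icc] at this
  push_cast at this
  exact this

lemma lam_abs_sum {m : ℕ} (hm : 3 ≤ m) {R : ℝ} (hRm : R ≤ m) (hR : 0 ≤ R) (y : ℕ → ℝ)
    (hy : ∀ k, |y k| ≤ 1) (hyR : ∀ k : ℕ, R ≤ k → y k = 0) :
    ∑ d ∈ (Pm m).divisors, |lam (Pm m) y d| ≤ R * Real.exp (2 * EE m / 5) := by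
  have hP0 := (Pm_squarefree m).ne_zero
  have h1 : ∀ d ∈ (Pm m).divisors, |lam (Pm m) y d| ≤
      ∑ k ∈ (Pm m).divisors, if d ∣ k then (d:ℝ) * (|y k| / (k.totient : ℝ)) else 0 := by
    intro d _
    unfold lam
    rw [abs_mul, abs_mul]
    have hmu : |(ArithmeticFunction.moebius d : ℝ)| ≤ 1 := by
      exact_mod_cast ArithmeticFunction.abs_moebius_le_one
    have : |∑ k ∈ (Pm m).divisors, if d ∣ k then y k / (k.totient : ℝ) else 0| ≤
        ∑ k ∈ (Pm m).divisors, if d ∣ k then (|y k| / (k.totient : ℝ)) else 0 := by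
      refine (Finset.abs_sum_le_sum_abs _ _).trans (Finset.sum_le_sum fun k _ => ?_)
      split_ifs
      · rw [abs_div, Nat.abs_cast]
      · simp
    calc _ ≤ 1 * |(d:ℝ)| * ∑ k ∈ (Pm m).divisors, if d ∣ k then (|y k| / (k.totient : ℝ)) else 0 := by
          gcongr
      _ = _ := by
          rw [one_mul, Nat.abs_cast, Finset.mul_sum]
          apply Finset.sum_congr rfl; intro k _; split_ifs <;> simp
  refine (Finset.sum_le_sum h1).trans ?_
  rw [Finset.sum_comm]
  have h2 : ∀ k ∈ (Pm m).divisors, (∑ d ∈ (Pm m).divisors,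
      if d ∣ k then (d:ℝ) * (|y k| / (k.totient : ℝ)) else 0) ≤
      if (k:ℝ) < R then Real.exp (2 * EE m / 5) else 0 := by
    intro k hk
    have hk0 := Nat.pos_of_mem_divisors hk
    have hkr : (0:ℝ) < k := by exact_mod_cast hk0
    split_ifs with hkR
    · rw [← Finset.sum_filter, ← Finset.sum_mul]
      have hsub : (Pm m).divisors.filter (fun d => d ∣ k) = k.divisors := by
        ext d
        simp only [Finset.mem_filter, Nat.mem_divisors]
        constructor
        · rintro ⟨_, h⟩; exact ⟨h, hk0.ne'⟩
        · rintro ⟨h, _⟩; exact ⟨⟨h.trans (Nat.dvd_of_mem_divisors hk), hP0⟩, h⟩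
      rw [hsub]
      have hkm : (k:ℝ) ≤ m := hkR.le.trans hRm
      have htot : (0:ℝ) < k.totient := by exact_mod_cast Nat.totient_pos.2 hk0
      have hlog : Real.log k ≤ Real.log m := Real.log_le_log hkr hkm
      have hlm := log_ge_one hm
      have ha := (div_totient_le_hh k hk0.ne').trans (hh_le m k hm hk0.ne' (by linarith))
      have hb := log_le_exp_EE hm
      calc (∑ d ∈ k.divisors, (d:ℝ)) * (|y k| / k.totient)
          ≤ (k * (1 + Real.log k)) * (1 / k.totient) := by
            gcongr
            · exact sigma_le hk0
            · exact hy k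
        _ = (k / k.totient) * (1 + Real.log k) := by ring
        _ ≤ Real.exp (EE m / 5) * Real.exp (EE m / 5) := by
            gcongr
            linarith
        _ = _ := by rw [← Real.exp_add]; congr 1; ring
    · rw [hyR k (not_lt.1 hkR)]; simp
  refine (Finset.sum_le_sum h2).trans ?_
  rw [← Finset.sum_filter, Finset.sum_const, nsmul_eq_mul]
  gcongr
  have hc : (Finset.filter (fun k : ℕ => (k:ℝ) < R) (Pm m).divisors).card ≤ ⌊R⌋₊ := by
    rw [← Nat.card_Icc 1 ⌊R⌋₊ |>.trans (by omega : ⌊R⌋₊ + 1 - 1 = ⌊R⌋₊)]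
    apply Finset.card_le_card
    intro k hk
    rw [Finset.mem_filter] at hk
    exact Finset.mem_Icc.2 ⟨Nat.pos_of_mem_divisors hk.1, Nat.le_floor hk.2.le⟩
  exact (by exact_mod_cast hc : ((Finset.filter (fun k : ℕ => (k:ℝ) < R) (Pm m).divisors).card : ℝ) ≤ (⌊R⌋₊ : ℝ)).trans
    (Nat.floor_le hR)

lemma lam_zero {P : ℕ} {y : ℕ → ℝ} {d : ℕ} {R : ℝ} (hyR : ∀ k : ℕ, R ≤ k → y k = 0) (hd : R ≤ d) (hP : P ≠ 0) :
    lam P y d = 0 := by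
  unfold lam
  rw [Finset.sum_eq_zero, mul_zero]
  intro k hk
  split_ifs with h
  · have : d ≤ k := Nat.le_of_dvd (Nat.pos_of_mem_divisors hk) h
    rw [hyR k (hd.trans (by exact_mod_cast this)), zero_div]
  · rfl

lemma yy_abs (m : ℕ) (u : ℝ) (k : ℕ) : |yy m u k| ≤ 1 := by
  have := HH_ge m u
  unfold yy
  rw [abs_of_nonneg (div_nonneg (cc_nonneg _) (by linarith)), div_le_one (by linarith)]
  linarith [cc_le (cl u k)]

lemma yy_zero {m : ℕ} {u : ℝ} (hu : 0 < u) (k : ℕ) (hk : Real.exp ((144:ℕ) * u) ≤ k) : yy m u k = 0 := by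
  unfold yy
  have hk0 : 0 < k := by
    have : (0:ℝ) < k := (Real.exp_pos _).trans_le hk
    exact_mod_cast this
  rw [cc_zero (le_cl hu hk0 hk), zero_div]

lemma lam_one_yy (m : ℕ) (u : ℝ) : lam (Pm m) (yy m u) 1 = 1 := by
  unfold lam yy
  have h := HH_ge m u
  have h2 : (∑ k ∈ (Pm m).divisors, if 1 ∣ k then cc (cl u k) / HH m u / (k.totient : ℝ) else 0) =
      (∑ k ∈ (Pm m).divisors, cc (cl u k) / (k.totient : ℝ)) / HH m u := by
    rw [Finset.sum_div]
    apply Finset.sum_congr rfl; intro k _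
    rw [if_pos (one_dvd k)]; ring
  rw [h2]
  change _ * _ * (HH m u / HH m u) = 1
  rw [div_self (by linarith)]; simp

/-- Selberg weights at level `t` -/
noncomputable def gy (m : ℕ) (t : ℝ) (k : ℕ) : ℝ := if (k:ℝ) < t then 1 / GG m t else 0

lemma GG_ge_one {m : ℕ} {t : ℝ} (ht : 1 < t) : 1 ≤ GG m t := by
  have h1 : 1 ∈ SF m t := by rw [mem_SF]; simpa using ht
  refine le_trans ?_ (Finset.single_le_sum (f := fun k => (1:ℝ) / (k.totient : ℝ))
    (fun k _ => by positivity) h1)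
  simp

lemma gy_abs {m : ℕ} {t : ℝ} (ht : 1 < t) (k : ℕ) : |gy m t k| ≤ 1 := by
  have := GG_ge_one (m := m) ht
  unfold gy
  split_ifs
  · rw [abs_of_nonneg (by positivity), div_le_one (by linarith)]; exact this
  · simp

lemma gy_zero {m : ℕ} {t : ℝ} (k : ℕ) (hk : t ≤ k) : gy m t k = 0 := by
  unfold gy; rw [if_neg (not_lt.2 hk)]

lemma lam_one_gy {m : ℕ} {t : ℝ} (ht : 1 < t) (htm : t ≤ m) : lam (Pm m) (gy m t) 1 = 1 := by
  unfold lam gy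
  have h := GG_ge_one (m := m) ht
  have h2 : (∑ k ∈ (Pm m).divisors, if 1 ∣ k then (if (k:ℝ) < t then 1 / GG m t else 0) / (k.totient : ℝ) else 0) =
      (∑ k ∈ SF m t, 1 / (k.totient : ℝ)) / GG m t := by
    rw [Finset.sum_div, ← mem_div_lt htm, Finset.sum_filter]
    apply Finset.sum_congr rfl; intro k _
    rw [if_pos (one_dvd k)]
    split_ifs
    · ring
    · simp
  rw [h2]
  change _ * _ * (GG m t / GG m t) = 1
  rw [div_self (by linarith)]; simp

lemma gy_sq {m : ℕ} {t : ℝ} (ht : 1 < t) (htm : t ≤ m) :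
    ∑ k ∈ (Pm m).divisors, gy m t k ^ 2 / (k.totient : ℝ) = 1 / GG m t := by
  unfold gy
  have h := GG_ge_one (m := m) ht
  have h2 : (∑ k ∈ (Pm m).divisors, (if (k:ℝ) < t then 1 / GG m t else 0) ^ 2 / (k.totient : ℝ)) =
      (∑ k ∈ SF m t, 1 / (k.totient : ℝ)) / GG m t ^ 2 := by
    rw [Finset.sum_div, ← mem_div_lt htm, Finset.sum_filter]
    apply Finset.sum_congr rfl; intro k _
    split_ifs
    · ring
    · simp
  rw [h2]
  change GG m t / GG m t ^ 2 = _
  field_simp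

/-- rough numbers: the small sieve sum is trivial -/
lemma Lsum_rough_one {P n : ℕ} {y : ℕ → ℝ} {R z : ℝ} (hP : P ≠ 0) (hyR : ∀ k : ℕ, R ≤ k → y k = 0)
    (hRz : R ≤ z) (hrough : ∀ p : ℕ, p.Prime → p ∣ n → z ≤ p) :
    Lsum P (lam P y) n = lam P y 1 := by
  unfold Lsum
  rw [Finset.sum_eq_single 1]
  · simp
  · intro d hd hd1
    split_ifs with h
    · obtain ⟨p, hp, hpd⟩ := Nat.exists_prime_and_dvd hd1
      have h1 := hrough p hp (hpd.trans h)
      have h2 : p ≤ d := Nat.le_of_dvd (Nat.pos_of_mem_divisors hd) hpd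
      have h3 : (p:ℝ) ≤ d := by exact_mod_cast h2
      exact lam_zero hyR (by linarith) hP
    · rfl
  · intro h; simp [hP] at h

lemma Lsum_rough_two {P n : ℕ} {y : ℕ → ℝ} {R z : ℝ} (hP : Squarefree P) (hn : n ≠ 0) (hyR : ∀ k : ℕ, R ≤ k → y k = 0)
    (hz : 0 ≤ z) (hRz : R ≤ z * z) (hrough : ∀ p : ℕ, p.Prime → p ∣ n → z ≤ p) :
    Lsum P (lam P y) n = lam P y 1 + ∑ p ∈ n.primeFactors, if p ∣ P then lam P y p else 0 := by
  unfold Lsum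
  have hP0 := hP.ne_zero
  have h1 : 1 ∈ P.divisors := by simp [hP0]
  rw [← Finset.add_sum_erase _ _ h1, if_pos (one_dvd n)]
  congr 1
  rw [← Finset.sum_filter, ← Finset.sum_filter]
  symm
  apply Finset.sum_subset
  · intro p hp
    rw [Finset.mem_filter, Nat.mem_primeFactors] at hp
    rw [Finset.mem_filter, Finset.mem_erase, Nat.mem_divisors]
    exact ⟨⟨hp.1.1.ne_one, hp.2, hP0⟩, hp.1.2.1⟩
  · intro d hd hd2
    rw [Finset.mem_filter, Finset.mem_erase, Nat.mem_divisors] at hd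
    rw [Finset.mem_filter, Nat.mem_primeFactors] at hd2
    obtain ⟨⟨hd1, hdP, _⟩, hdn⟩ := hd
    obtain ⟨p, hp, e, rfl⟩ := Nat.exists_prime_and_dvd hd1
    have he1 : e ≠ 1 := by
      rintro rfl
      rw [mul_one] at *
      exact hd2 ⟨⟨hp, hdn, hn⟩, hdP⟩
    obtain ⟨q, hq, f, rfl⟩ := Nat.exists_prime_and_dvd he1
    have hz1 := hrough p hp ((Dvd.intro _ rfl).trans hdn)
    have hz2 := hrough q hq (Dvd.dvd.trans ⟨p * f, by ring⟩ hdn)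
    have hf : 1 ≤ f := Nat.pos_of_ne_zero (by rintro rfl; simp at hdn; exact hn hdn)
    have hfr : (1:ℝ) ≤ f := by exact_mod_cast hf
    apply lam_zero hyR _ hP0
    push_cast
    calc R ≤ z * z := hRz
      _ ≤ p * (q * 1) := by rw [mul_one]; gcongr
      _ ≤ _ := by gcongr


lemma exists_cofactor {m p : ℕ} (hp : p.Prime) (h : p ∣ Pm m) :
    ∃ Q, Pm m = p * Q ∧ ¬ p ∣ Q ∧ Squarefree Q := by
  obtain ⟨Q, hQ⟩ := h
  have hsq := Pm_squarefree m
  rw [hQ] at hsq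
  refine ⟨Q, hQ, ?_, hsq.squarefree_of_dvd (Dvd.intro_left _ rfl)⟩
  have := Nat.coprime_of_squarefree_mul hsq
  exact hp.coprime_iff_not_dvd.1 this

lemma HH_lower {m : ℕ} (hm : 3 ≤ m) {u : ℝ} (hu : 0 < u) (hn : Real.exp ((144 : ℕ) * u) ≤ m) :
    (u - EE m) * 14040 ≤ (m:ℝ) / m.totient * HH m u := by
  have := cs_sum_lower hm hu hn cc cc_nonneg
  rw [← HH_eq hu] at this
  have h2 : ∑ i ∈ Finset.range 144, cc i = 14040 := by
    unfold cc
    rw [← Nat.cast_sum]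
    have : ∑ i ∈ Finset.range 144, ccn i = 14040 := by decide +kernel
    rw [this]; norm_num
  rwa [h2] at this

lemma HH_upper {m : ℕ} (hm : 3 ≤ m) {u : ℝ} (hu : 0 < u) (hn : Real.exp ((144 : ℕ) * u) ≤ m) :
    (m:ℝ) / m.totient * HH m u ≤ (u + EE m) * 14040 := by
  have := cs_sum_upper hm hu hn cc cc_nonneg
  rw [← HH_eq hu] at this
  have h2 : ∑ i ∈ Finset.range 144, cc i = 14040 := by
    unfold cc
    rw [← Nat.cast_sum]
    have : ∑ i ∈ Finset.range 144, ccn i = 14040 := by decide +kernel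
    rw [this]; norm_num
  rwa [h2] at this

lemma lam_prime_bound {m : ℕ} (hm : 3 ≤ m) {u : ℝ} (hu : 1 ≤ u) (hE : EE m ≤ u / 1000)
    (hn : Real.exp ((144 : ℕ) * u) ≤ m) {p : ℕ} (hp : p.Prime) (hpP : p ∣ Pm m)
    (hpz : Real.exp ((112:ℕ) * u) ≤ p) :
    -(1/7) ≤ lam (Pm m) (yy m u) p ∧ lam (Pm m) (yy m u) p ≤ 0 := by
  have hu0 : 0 < u := by linarith
  obtain ⟨Q, hPQ, hpQ, hQ⟩ := exists_cofactor hp hpP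
  have hp4 : (4:ℝ) ≤ p := by
    have := Real.add_one_le_exp ((112:ℕ) * u)
    push_cast at this hpz
    linarith
  have hH := HH_ge m u
  set S : ℝ := ∑ e ∈ Q.divisors, cc (cl u (p * e)) / (e.totient : ℝ) with hS
  have hS0 : 0 ≤ S := Finset.sum_nonneg fun e _ => div_nonneg (cc_nonneg _) (Nat.cast_nonneg _)
  have hlam : lam (Pm m) (yy m u) p = - (p / (p - 1) * (S / HH m u)) := by
    unfold lam
    rw [ArithmeticFunction.moebius_apply_prime hp]
    have : (∑ k ∈ (Pm m).divisors, if p ∣ k then yy m u k / (k.totient : ℝ) else 0) =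
        1 / (p - 1) * (S / HH m u) := by
      rw [hPQ, sum_div_split hp hpQ hQ.ne_zero, hS, Finset.sum_div, Finset.mul_sum]
      apply Finset.sum_congr rfl
      intro e he
      have hpe : ¬ p ∣ e := fun h => hpQ (h.trans (Nat.dvd_of_mem_divisors he))
      rw [if_neg hpe, if_pos (Dvd.intro _ rfl), Nat.totient_mul (hp.coprime_iff_not_dvd.2 hpe),
        Nat.totient_prime hp, zero_add]
      unfold yy
      push_cast [hp.one_le]
      rw [div_div, div_div, div_mul_div_comm]
      congr 1
      · ring
      · ring
    rw [this]
    push_cast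
    ring
  have hSb : (m:ℝ) / m.totient * S ≤ (u + EE m) * 1328 := by
    have hn32 : Real.exp ((32:ℕ) * u) ≤ m := by
      refine le_trans (Real.exp_le_exp.2 ?_) hn
      push_cast; nlinarith
    have := cs_sum_upper hm hu0 hn32 (fun i => cc (i + 112)) (fun i => cc_nonneg _)
    rw [← cell_sum hu0 32 (fun i => cc (i + 112)) (fun i hi => cc_zero (by omega))] at this
    have h2 : ∑ i ∈ Finset.range 32, cc (i + 112) = 1328 := by
      unfold cc
      rw [← Nat.cast_sum]
      have : ∑ i ∈ Finset.range 32, ccn (i + 112) = 1328 := by decide +kernel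
      rw [this]; norm_num
    rw [h2] at this
    refine le_trans (mul_le_mul_of_nonneg_left ?_ (ratio_pos hm).le) this
    rw [hS]
    refine le_trans (Finset.sum_le_sum ?_) (Finset.sum_le_sum_of_subset_of_nonneg
      (Nat.divisors_subset_of_dvd (Pm_squarefree m).ne_zero (Dvd.intro_left _ hPQ.symm)) ?_)
    · intro e he
      have he0 := Nat.pos_of_mem_divisors he
      have : cl u e + 112 ≤ cl u (p * e) := by
        apply le_cl hu0 (Nat.mul_pos hp.pos he0)
        obtain ⟨h1, _⟩ := (cl_eq_iff hu0 he0 (cl u e)).1 rfl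
        push_cast at hpz ⊢
        rw [add_mul, Real.exp_add, mul_comm]
        gcongr
      have := cc_anti this
      gcongr
    · intro e _ _
      exact div_nonneg (cc_nonneg _) (Nat.cast_nonneg _)
  have hHl := HH_lower hm hu0 hn
  have hE0 := EE_ge hm
  set v := (m:ℝ) / m.totient with hv
  have hv0 : 0 < v := ratio_pos hm
  have hq : S / HH m u ≤ 1/10 := by
    rw [div_le_iff₀ (by linarith)]
    have : v * S ≤ v * (1/10 * HH m u) := by
      linarith
    exact le_of_mul_le_mul_left this hv0
  have hq0 : 0 ≤ S / HH m u := div_nonneg hS0 (by linarith)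
  have hr : (p:ℝ) / (p - 1) ≤ 4/3 := by
    rw [div_le_iff₀ (by linarith)]; linarith
  have hr0 : 0 ≤ (p:ℝ) / (p - 1) := div_nonneg (Nat.cast_nonneg p) (by linarith)
  rw [hlam]
  constructor
  · have : (p:ℝ) / (p - 1) * (S / HH m u) ≤ 4/3 * (1/10) := mul_le_mul hr hq hq0 (by norm_num)
    linarith
  · have := mul_nonneg hr0 hq0
    linarith

/-- on rough numbers the main sieve weight has absolute value at most one -/
lemma Lsum_rough_sq {m : ℕ} (hm : 3 ≤ m) {u : ℝ} (hu : 1 ≤ u) (hE : EE m ≤ u / 1000)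
    (hn : Real.exp ((144 : ℕ) * u) ≤ m) {n : ℕ} (hn0 : n ≠ 0) (hnX : Real.log n ≤ 1600 * u)
    (hrough : ∀ p : ℕ, p.Prime → p ∣ n → Real.exp ((112:ℕ) * u) ≤ p) :
    Lsum (Pm m) (lam (Pm m) (yy m u)) n ^ 2 ≤ 1 := by
  have hu0 : 0 < u := by linarith
  rw [Lsum_rough_two (R := Real.exp ((144:ℕ) * u)) (z := Real.exp ((112:ℕ) * u)) (Pm_squarefree m) hn0
    (fun k hk => yy_zero hu0 k hk) (Real.exp_pos _).le
    (by rw [← Real.exp_add]; apply Real.exp_le_exp.2; push_cast; nlinarith) hrough, lam_one_yy]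
  have hcard : n.primeFactors.card ≤ 14 := by
    by_contra hcon
    push Not at hcon
    have h1 : Real.exp ((112:ℕ) * u) ^ n.primeFactors.card ≤ n := by
      calc Real.exp ((112:ℕ) * u) ^ n.primeFactors.card = ∏ p ∈ n.primeFactors, Real.exp ((112:ℕ) * u) := by
            rw [Finset.prod_const]
        _ ≤ ∏ p ∈ n.primeFactors, (p:ℝ) := by
            apply Finset.prod_le_prod
            · intro p _; exact (Real.exp_pos _).le
            · intro p hp; exact hrough p (Nat.prime_of_mem_primeFactors hp) (Nat.dvd_of_mem_primeFactors hp)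
        _ ≤ n := by
            have := Nat.le_of_dvd (Nat.pos_of_ne_zero hn0) (Nat.prod_primeFactors_dvd n)
            rw [← Nat.cast_prod]
            exact Nat.cast_le.2 this
    have h2 := Real.log_le_log (by positivity) h1
    rw [Real.log_pow, Real.log_exp] at h2
    have h3 : (15:ℝ) ≤ n.primeFactors.card := by exact_mod_cast hcon
    push_cast at h2
    nlinarith
  have hlow : -2 ≤ ∑ p ∈ n.primeFactors, (if p ∣ Pm m then lam (Pm m) (yy m u) p else 0) := by
    have : ∑ p ∈ n.primeFactors, (-(1/7) : ℝ) ≤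
        ∑ p ∈ n.primeFactors, (if p ∣ Pm m then lam (Pm m) (yy m u) p else 0) := by
      apply Finset.sum_le_sum
      intro p hp
      split_ifs with h
      · exact (lam_prime_bound hm hu hE hn (Nat.prime_of_mem_primeFactors hp) h
          (hrough p (Nat.prime_of_mem_primeFactors hp) (Nat.dvd_of_mem_primeFactors hp))).1
      · norm_num
    rw [Finset.sum_const, nsmul_eq_mul] at this
    have h14 : (n.primeFactors.card : ℝ) ≤ 14 := by exact_mod_cast hcard
    linarith
  have hup : ∑ p ∈ n.primeFactors, (if p ∣ Pm m then lam (Pm m) (yy m u) p else 0) ≤ 0 := by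
    apply Finset.sum_nonpos
    intro p hp
    split_ifs with h
    · exact (lam_prime_bound hm hu hE hn (Nat.prime_of_mem_primeFactors hp) h
        (hrough p (Nat.prime_of_mem_primeFactors hp) (Nat.dvd_of_mem_primeFactors hp))).2
    · norm_num
  nlinarith


noncomputable def rho (j : ℕ) : ℝ := min 112 ((399 - (j:ℝ)) / 2)

noncomputable def Rp (u : ℝ) (p : ℕ) : ℝ := Real.exp (rho (cl u p) * u)

noncomputable def UU (m : ℕ) (u : ℝ) (p n : ℕ) : ℝ := Lsum (Pm m) (lam (Pm m) (gy m (Rp u p))) n ^ 2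

noncomputable def LL (m : ℕ) (u : ℝ) (n : ℕ) : ℝ := Lsum (Pm m) (lam (Pm m) (yy m u)) n ^ 2

noncomputable def bb (u : ℝ) (p : ℕ) : ℝ := 1 - Real.log p / (340 * u)

noncomputable def S1 (m : ℕ) (u : ℝ) : Finset ℕ := (pr 1 (Real.exp ((112:ℕ) * u))).filter (fun p => ¬ p ∣ m)

noncomputable def S2 (m : ℕ) (u : ℝ) : Finset ℕ :=
  (pr (Real.exp ((112:ℕ) * u)) (Real.exp ((340:ℕ) * u))).filter (fun p => ¬ p ∣ m)

lemma S2_cl {m : ℕ} {u : ℝ} (hu : 0 < u) {p : ℕ} (hp : p ∈ S2 m u) :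
    112 ≤ cl u p ∧ cl u p < 340 ∧ p.Prime ∧ ¬ p ∣ m := by
  unfold S2 at hp
  rw [Finset.mem_filter, mem_pr] at hp
  obtain ⟨⟨h1, h2, h3⟩, h4⟩ := hp
  exact ⟨le_cl hu h1.pos h2, cl_lt hu h1.pos h3, h1, h4⟩

lemma rho_bounds {j : ℕ} (h : j < 340) : 29 ≤ rho j ∧ rho j ≤ 112 ∧ 2 * rho j + j + 1 ≤ 400 := by
  have : (j:ℝ) ≤ 339 := by exact_mod_cast (by omega : j ≤ 339)
  unfold rho
  refine ⟨le_min (by norm_num) (by linarith), min_le_left _ _, ?_⟩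
  have := min_le_right (112:ℝ) ((399 - (j:ℝ)) / 2)
  linarith

lemma bb_nonneg {m : ℕ} {u : ℝ} (hu : 0 < u) {p : ℕ} (hp : p ∈ S2 m u) : 0 ≤ bb u p := by
  unfold S2 at hp
  rw [Finset.mem_filter, mem_pr] at hp
  obtain ⟨⟨h1, h2, h3⟩, h4⟩ := hp
  have hp0 : (0:ℝ) < p := by exact_mod_cast h1.pos
  rw [← Real.log_lt_iff_lt_exp hp0] at h3
  unfold bb
  rw [sub_nonneg, div_le_one (by positivity)]
  push_cast at h3; linarith

lemma bb_le {m : ℕ} {u : ℝ} (hu : 0 < u) {p : ℕ} (hp : p ∈ S2 m u) : bb u p ≤ 1 - (cl u p : ℝ) / 340 := by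
  have h := S2_cl hu hp
  have hp0 : (0:ℝ) < p := by exact_mod_cast h.2.2.1.pos
  have h1 := ((cl_eq_iff hu h.2.2.1.pos (cl u p)).1 rfl).1
  rw [← Real.le_log_iff_exp_le hp0] at h1
  unfold bb
  have : (cl u p : ℝ) / 340 ≤ Real.log p / (340 * u) := by
    rw [div_le_div_iff₀ (by norm_num) (by positivity)]
    nlinarith
  linarith

open Classical in
noncomputable def badf (u : ℝ) (n : ℕ) : ℝ :=
  if (∃ p : ℕ, p.Prime ∧ Real.exp ((112:ℕ) * u) ≤ p ∧ p * p ∣ n) then 1.2 else 0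

lemma W_le {m : ℕ} (hm : 3 ≤ m) {u : ℝ} (hu : 1 ≤ u) (hE : EE m ≤ u / 1000)
    (hn : Real.exp ((144 : ℕ) * u) ≤ m) {n l : ℕ} (hn0 : n ≠ 0) (hnX : Real.log n ≤ 1600 * u)
    (hnl : Real.log n ≤ (l - 0.2) * (340 * u)) (hnm : n.Coprime m)
    (hl : l + 1 ≤ n.primeFactorsList.length) :
    1.2 * (LL m u n * (1 - ∑ p ∈ S1 m u, if p ∣ n then (1:ℝ) else 0)) -
      (∑ p ∈ S2 m u, if p ∣ n then bb u p * UU m u p n else 0) ≤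
      badf u n := by
  unfold badf
  have hu0 : 0 < u := by linarith
  have hLL : 0 ≤ LL m u n := sq_nonneg _
  have hcost : 0 ≤ ∑ p ∈ S2 m u, if p ∣ n then bb u p * UU m u p n else 0 := by
    apply Finset.sum_nonneg
    intro p hp
    split_ifs
    · exact mul_nonneg (bb_nonneg hu0 hp) (sq_nonneg _)
    · exact le_rfl
  have hR0 : 0 ≤ badf u n := by
    unfold badf
    split_ifs <;> norm_num
  have hndvd : ∀ p : ℕ, p.Prime → p ∣ n → ¬ p ∣ m := by
    intro p hp h1 h2
    exact hp.one_lt.ne' (Nat.eq_one_of_dvd_coprimes hnm h1 h2)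
  have hs1 : 0 ≤ ∑ p ∈ S1 m u, if p ∣ n then (1:ℝ) else 0 :=
    Finset.sum_nonneg fun p _ => by split_ifs <;> norm_num
  by_cases hrough : ∀ p : ℕ, p.Prime → p ∣ n → Real.exp ((112:ℕ) * u) ≤ p
  · have hL1 := Lsum_rough_sq hm hu hE hn hn0 hnX hrough
    change LL m u n ≤ 1 at hL1
    have hA : LL m u n * (1 - ∑ p ∈ S1 m u, if p ∣ n then (1:ℝ) else 0) ≤ 1 := by nlinarith
    by_cases hsq : ∃ p : ℕ, p.Prime ∧ Real.exp ((112:ℕ) * u) ≤ p ∧ p * p ∣ n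
    · rw [if_pos hsq]; linarith
    · rw [if_neg hsq]
      have hsqf : Squarefree n := by
        rw [Nat.squarefree_iff_prime_squarefree]
        intro p hp h
        exact hsq ⟨p, hp, hrough p hp ((Dvd.intro _ rfl).trans h), h⟩
      have hcard : (n.primeFactors.card : ℝ) ≥ l + 1 := by
        have h1 : n.primeFactors.card = n.primeFactorsList.length := by
          rw [Nat.primeFactors, List.toFinset_card_of_nodup]
          exact (Nat.squarefree_iff_nodup_primeFactorsList hn0).1 hsqf
        rw [h1]
        exact_mod_cast hl
      have hlogs : ∑ p ∈ n.primeFactors, Real.log p = Real.log n := by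
        rw [← Real.log_prod]
        · congr 1
          rw [← Nat.cast_prod, Nat.prod_primeFactors_of_squarefree hsqf]
        · intro p hp
          exact_mod_cast (Nat.prime_of_mem_primeFactors hp).ne_zero
      have hbsum : ∑ p ∈ n.primeFactors, bb u p = n.primeFactors.card - Real.log n / (340 * u) := by
        unfold bb
        rw [Finset.sum_sub_distrib, ← Finset.sum_div, hlogs]; simp
      have hle : ∑ p ∈ n.primeFactors, bb u p ≤ ∑ p ∈ S2 m u, if p ∣ n then bb u p * UU m u p n else 0 := by
        have hU : ∀ p ∈ S2 m u, UU m u p n = 1 := by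
          intro p hp
          have hc := S2_cl hu0 hp
          have hr := rho_bounds hc.2.1
          have hRz : Rp u p ≤ Real.exp ((112:ℕ) * u) := by
            apply Real.exp_le_exp.2; push_cast; nlinarith
          have hR1 : 1 < Rp u p := by
            unfold Rp; rw [Real.one_lt_exp_iff]; nlinarith
          have hRm : Rp u p ≤ m := by
            refine hRz.trans (le_trans (Real.exp_le_exp.2 ?_) hn)
            push_cast; nlinarith
          unfold UU
          rw [Lsum_rough_one (Pm_squarefree m).ne_zero (fun k hk => gy_zero k hk) hRz hrough,
            lam_one_gy hR1 hRm]; norm_num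
        rw [← Finset.sum_filter]
        have h2 : ∑ p ∈ (S2 m u).filter (fun p => p ∣ n), bb u p * UU m u p n =
            ∑ p ∈ (S2 m u).filter (fun p => p ∣ n), bb u p := by
          apply Finset.sum_congr rfl
          intro p hp
          rw [hU p (Finset.mem_filter.1 hp).1, mul_one]
        rw [h2]
        rw [← Finset.sum_filter_add_sum_filter_not n.primeFactors (fun p => (p:ℝ) < Real.exp ((340:ℕ) * u))]
        have h3 : ∑ p ∈ n.primeFactors.filter (fun p : ℕ => ¬ (p:ℝ) < Real.exp ((340:ℕ) * u)), bb u p ≤ 0 := by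
          apply Finset.sum_nonpos
          intro p hp
          rw [Finset.mem_filter, not_lt] at hp
          have hp0 : (0:ℝ) < p := by exact_mod_cast (Nat.prime_of_mem_primeFactors hp.1).pos
          have := (Real.le_log_iff_exp_le hp0).2 hp.2
          unfold bb
          rw [sub_nonpos, one_le_div (by positivity)]
          push_cast at this; linarith
        have h4 : n.primeFactors.filter (fun p : ℕ => (p:ℝ) < Real.exp ((340:ℕ) * u)) =
            (S2 m u).filter (fun p => p ∣ n) := by
          ext p
          unfold S2
          rw [Finset.mem_filter, Finset.mem_filter, Finset.mem_filter, mem_pr, Nat.mem_primeFactors]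
          constructor
          · rintro ⟨⟨h1, h2, _⟩, h3⟩
            exact ⟨⟨⟨h1, hrough p h1 h2, h3⟩, hndvd p h1 h2⟩, h2⟩
          · rintro ⟨⟨⟨h1, h2, h3⟩, h4⟩, h5⟩
            exact ⟨⟨h1, h5, hn0⟩, h3⟩
        rw [h4]; linarith
      have h5 : Real.log n / (340 * u) ≤ l - 0.2 := by
        rw [div_le_iff₀ (by positivity)]; exact hnl
      rw [hbsum] at hle
      norm_num at hA h5 ⊢
      linarith
  · push Not at hrough
    obtain ⟨p, hp, hpn, hpz⟩ := hrough
    have hp1 : p ∈ S1 m u := by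
      unfold S1
      rw [Finset.mem_filter, mem_pr]
      exact ⟨⟨hp, by exact_mod_cast hp.one_le, hpz⟩, hndvd p hp hpn⟩
    have h1 : 1 ≤ ∑ p ∈ S1 m u, if p ∣ n then (1:ℝ) else 0 := by
      refine le_trans ?_ (Finset.single_le_sum (f := fun p => if p ∣ n then (1:ℝ) else 0)
        (fun p _ => by split_ifs <;> norm_num) hp1)
      simp [hpn]
    unfold badf at hR0
    have : LL m u n * (1 - ∑ p ∈ S1 m u, if p ∣ n then (1:ℝ) else 0) ≤ 0 :=
      mul_nonpos_of_nonneg_of_nonpos hLL (by linarith)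
    linarith


/-- integer version of the cell sums -/
def Kn (j : ℕ) : ℕ := ∑ i ∈ Finset.range 144, (ccn i - ccn (i + j + 1)) ^ 2

lemma Kn_eq (j : ℕ) : ∑ i ∈ Finset.range 144, (cc i - cc (i + j + 1)) ^ 2 = (Kn j : ℝ) := by
  unfold Kn
  rw [Nat.cast_sum]
  apply Finset.sum_congr rfl
  intro i _
  have h : ccn (i + j + 1) ≤ ccn i := by
    unfold ccn; split_ifs <;> omega
  unfold cc
  push_cast [h]
  rfl

lemma Kn_zero : Kn 0 = 819 := by decide +kernel

lemma div_le_nat (a b s : ℕ) (hb : 0 < b) : (a:ℝ) / b ≤ ((s * a / b + 1 : ℕ) : ℝ) / s ∨ s = 0 := by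
  rcases Nat.eq_zero_or_pos s with h | h
  · exact Or.inr h
  · left
    have hbr : (0:ℝ) < b := by exact_mod_cast hb
    have hsr : (0:ℝ) < s := by exact_mod_cast h
    rw [div_le_div_iff₀ hbr hsr]
    have : s * a < (s * a / b + 1) * b := by
      have := Nat.lt_div_mul_add (a := s * a) hb
      linarith
    have h2 : ((s * a : ℕ) : ℝ) ≤ ((s * a / b + 1) * b : ℕ) := by exact_mod_cast this.le
    rw [Nat.cast_mul, Nat.cast_mul] at h2
    linarith

lemma sum_Kn : ∑ j ∈ Finset.Ico 1 112, (Kn j : ℝ) / j ≤ 847053 := by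
  have h : ∀ j ∈ Finset.Ico 1 112, (Kn j : ℝ) / j ≤ ((1000 * Kn j / j + 1 : ℕ) : ℝ) / (1000:ℕ) := by
    intro j hj
    have := (Finset.mem_Ico.1 hj).1
    exact (div_le_nat (Kn j) j 1000 (by omega)).resolve_right (by norm_num)
  refine (Finset.sum_le_sum h).trans ?_
  rw [← Finset.sum_div, ← Nat.cast_sum, div_le_iff₀ (by norm_num)]
  have : ∑ j ∈ Finset.Ico 1 112, (1000 * Kn j / j + 1) ≤ 847053000 := by decide +kernel
  have h2 : ((∑ j ∈ Finset.Ico 1 112, (1000 * Kn j / j + 1) : ℕ) : ℝ) ≤ (847053000 : ℕ) := by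
    exact_mod_cast this
  refine h2.trans ?_
  norm_num

lemma rho_eq (j : ℕ) (hj : j < 340) : rho j = ((min 224 (399 - j) : ℕ) : ℝ) / 2 := by
  unfold rho
  rw [Nat.cast_min, Nat.cast_sub (by omega), ← min_div_div_right (by norm_num)]
  norm_num

lemma sum_cost : ∑ j ∈ Finset.Ico (112:ℕ) 340, (1 - (j:ℝ) / 340) / (j * rho j) ≤ 0.004526 := by
  have h : ∀ j ∈ Finset.Ico (112:ℕ) 340, (1 - (j:ℝ) / 340) / (j * rho j) ≤
      ((1000000000 * (2 * (340 - j)) / (340 * j * min 224 (399 - j)) + 1 : ℕ) : ℝ) / (1000000000:ℕ) := by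
    intro j hj
    obtain ⟨h1, h2⟩ := Finset.mem_Ico.1 hj
    have h3 : 0 < min 224 (399 - j) := by
      apply lt_min <;> omega
    refine le_trans (le_of_eq ?_) ((div_le_nat (2 * (340 - j)) (340 * j * min 224 (399 - j)) 1000000000
      (by positivity)).resolve_right (by norm_num))
    rw [rho_eq j h2]
    have h4 : (0:ℝ) < ((min 224 (399 - j) : ℕ) : ℝ) := by exact_mod_cast h3
    have h5 : (0:ℝ) < j := by exact_mod_cast (by omega : 0 < j)
    rw [Nat.cast_mul, Nat.cast_mul, Nat.cast_mul, Nat.cast_sub h2.le]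
    generalize ((min 224 (399 - j) : ℕ) : ℝ) = t at *
    push_cast
    field_simp
  refine (Finset.sum_le_sum h).trans ?_
  rw [← Finset.sum_div, ← Nat.cast_sum, div_le_iff₀ (by norm_num)]
  have : ∑ j ∈ Finset.Ico 112 340, (1000000000 * (2 * (340 - j)) / (340 * j * min 224 (399 - j)) + 1) ≤ 4526000 := by
    decide +kernel
  have h2 : ((∑ j ∈ Finset.Ico 112 340, (1000000000 * (2 * (340 - j)) / (340 * j * min 224 (399 - j)) + 1) : ℕ) : ℝ)
      ≤ (4526000 : ℕ) := by
    exact_mod_cast this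
  refine h2.trans ?_
  norm_num

lemma sum_cc_sq : ∑ i ∈ Finset.range 144, cc i ^ 2 = 1617720 := by
  unfold cc
  have : ∑ i ∈ Finset.range 144, ccn i ^ 2 = 1617720 := by decide +kernel
  have h2 : ((∑ i ∈ Finset.range 144, ccn i ^ 2 : ℕ) : ℝ) = (1617720 : ℕ) := by rw [this]
  push_cast at h2
  exact h2

/-- the bilinear form -/
noncomputable def DD (m : ℕ) (y : ℕ → ℝ) (q : ℕ) : ℝ :=
  ∑ d₁ ∈ (Pm m).divisors, ∑ d₂ ∈ (Pm m).divisors,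
    lam (Pm m) y d₁ * lam (Pm m) y d₂ / (Nat.lcm q (Nat.lcm d₁ d₂) : ℝ)

lemma DD_one (m : ℕ) (y : ℕ → ℝ) : DD m y 1 = ∑ k ∈ (Pm m).divisors, y k ^ 2 / (k.totient : ℝ) := by
  rw [← quad_lam (Pm_squarefree m)]
  unfold DD
  simp only [Nat.lcm_one_left] 

lemma DD_yy_eq {m : ℕ} {u : ℝ} {p : ℕ} (hp : p.Prime) (hpP : p ∣ Pm m) :
    ∃ Q, Q ∣ Pm m ∧ DD m (yy m u) p * HH m u ^ 2 =
      (1 / p) * ∑ k ∈ Q.divisors, (cc (cl u k) - cc (cl u (p * k))) ^ 2 / (k.totient : ℝ) := by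
  obtain ⟨Q, hPQ, hpQ, hQ⟩ := exists_cofactor hp hpP
  refine ⟨Q, Dvd.intro_left _ hPQ.symm, ?_⟩
  have hH := HH_ge m u
  have hH0 : HH m u ≠ 0 := by linarith
  unfold DD
  rw [hPQ, quad_lam_prime hp hpQ hQ, mul_assoc, Finset.sum_mul]
  congr 1
  apply Finset.sum_congr rfl
  intro k _
  unfold yy
  rw [← sub_div, div_pow]
  field_simp

lemma DD_gy {m : ℕ} {t : ℝ} (ht : 1 < t) (htm : t ≤ m) {p : ℕ} (hp : p.Prime) (hpP : p ∣ Pm m) (htp : t ≤ p) :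
    DD m (gy m t) p ≤ (1 / p) * (1 / GG m t) := by
  obtain ⟨Q, hPQ, hpQ, hQ⟩ := exists_cofactor hp hpP
  rw [← gy_sq ht htm]
  have : DD m (gy m t) p = (1 / p) * ∑ k ∈ Q.divisors, (gy m t k - gy m t (p * k)) ^ 2 / (k.totient : ℝ) := by
    unfold DD
    rw [hPQ, quad_lam_prime hp hpQ hQ]
  rw [this]
  refine mul_le_mul_of_nonneg_left ?_ (by positivity)
  refine le_trans (le_of_eq (Finset.sum_congr rfl ?_)) (Finset.sum_le_sum_of_subset_of_nonneg
    (Nat.divisors_subset_of_dvd (Pm_squarefree m).ne_zero (Dvd.intro_left _ hPQ.symm)) ?_)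
  · intro k hk
    have hk0 : (1:ℝ) ≤ k := by exact_mod_cast Nat.pos_of_mem_divisors hk
    rw [gy_zero (p * k), sub_zero]
    push_cast
    nlinarith
  · intro k _ _; positivity

lemma cell_split {u : ℝ} (S : Finset ℕ) {a b : ℕ} (hcl : ∀ p ∈ S, a ≤ cl u p ∧ cl u p < b) (f : ℕ → ℝ) :
    ∑ p ∈ S, f p = ∑ j ∈ Finset.Ico a b, ∑ p ∈ S.filter (fun p => cl u p = j), f p := by
  rw [Finset.sum_fiberwise_of_maps_to]
  intro p hp
  exact Finset.mem_Ico.2 (hcl p hp)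

lemma filter_sub {u : ℝ} (hu : 0 < u) (S : Finset ℕ) (hS : ∀ p ∈ S, p.Prime) (j : ℕ) :
    S.filter (fun p => cl u p = j) ⊆ pr (Real.exp (j * u)) (Real.exp ((j + 1) * u)) := by
  intro p hp
  rw [Finset.mem_filter] at hp
  rw [mem_pr]
  exact ⟨hS p hp.1, (cl_eq_iff hu (hS p hp.1).pos j).1 hp.2⟩

lemma S1_cl {m : ℕ} {u : ℝ} (hu : 0 < u) {p : ℕ} (hp : p ∈ S1 m u) :
    cl u p < 112 ∧ p.Prime ∧ ¬ p ∣ m ∧ (p:ℝ) < Real.exp ((112:ℕ) * u) := by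
  unfold S1 at hp
  rw [Finset.mem_filter, mem_pr] at hp
  obtain ⟨⟨h1, h2, h3⟩, h4⟩ := hp
  exact ⟨cl_lt hu h1.pos h3, h1, h4, h3⟩

lemma kill_total {m : ℕ} (hm : 3 ≤ m) {u : ℝ} (hu : 1 ≤ u) (hE : EE m ≤ u / 1000)
    (hn : Real.exp ((144 : ℕ) * u) ≤ m)
    (h0 : ∑ p ∈ pr 1 (Real.exp u), (Real.log p + EE m) / p ≤ u * 1.002)
    (hj : ∀ j : ℕ, 1 ≤ j → ∑ p ∈ pr (Real.exp (j * u)) (Real.exp ((j + 1) * u)), (1:ℝ) / p ≤ 1.001 / j) :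
    (m:ℝ) / m.totient * ∑ p ∈ S1 m u, DD m (yy m u) p * HH m u ^ 2 ≤ u * 849571 := by
  have hu0 : 0 < u := by linarith
  have hv0 := ratio_pos hm
  have hE0 := EE_ge hm
  have hprime : ∀ p ∈ S1 m u, p.Prime := fun p hp => (S1_cl hu0 hp).2.1
  have hdvd : ∀ p ∈ S1 m u, p ∣ Pm m := by
    intro p hp
    obtain ⟨_, h2, h3, h4⟩ := S1_cl hu0 hp
    apply prime_dvd_Pm h2 h3
    have : (p:ℝ) ≤ m := by
      refine h4.le.trans (le_trans (Real.exp_le_exp.2 ?_) hn)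
      push_cast; nlinarith
    exact_mod_cast this
  rw [cell_split (S1 m u) (a := 0) (b := 112) (fun p hp => ⟨Nat.zero_le _, (S1_cl hu0 hp).1⟩),
    Finset.sum_eq_sum_Ico_succ_bot (by norm_num), mul_add]
  have hpart0 : (m:ℝ) / m.totient * ∑ p ∈ (S1 m u).filter (fun p => cl u p = 0), DD m (yy m u) p * HH m u ^ 2 ≤
      u * 1.002 * 819 := by
    have hsub := filter_sub hu0 (S1 m u) hprime 0
    have hsub' : (S1 m u).filter (fun p => cl u p = 0) ⊆ pr 1 (Real.exp u) := by
      refine hsub.trans ?_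
      simp
    calc (m:ℝ) / m.totient * ∑ p ∈ (S1 m u).filter (fun p => cl u p = 0), DD m (yy m u) p * HH m u ^ 2
        ≤ ∑ p ∈ (S1 m u).filter (fun p => cl u p = 0), (Real.log p + EE m) / p * 819 := by
          rw [Finset.mul_sum]
          apply Finset.sum_le_sum
          intro p hp
          rw [Finset.mem_filter] at hp
          obtain ⟨Q, hQ, hQe⟩ := DD_yy_eq (u := u) (hprime p hp.1) (hdvd p hp.1)
          have hk := kill_0 hm hu0 hn hQ (hprime p hp.1).pos hp.2
          have hK := Kn_eq 0
          rw [Kn_zero] at hK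
          norm_num at hK
          rw [hK] at hk
          rw [hQe, mul_left_comm]
          have hpinv : (0:ℝ) ≤ 1 / (p:ℝ) := by positivity
          have := mul_le_mul_of_nonneg_left hk hpinv
          refine this.trans (le_of_eq ?_)
          ring
      _ ≤ ∑ p ∈ pr 1 (Real.exp u), (Real.log p + EE m) / p * 819 := by
          apply Finset.sum_le_sum_of_subset_of_nonneg hsub'
          intro p _ _
          have := Real.log_natCast_nonneg p
          have : 0 ≤ Real.log p + EE m := by linarith
          positivity
      _ ≤ _ := by rw [← Finset.sum_mul]; gcongr
  have hpart : (m:ℝ) / m.totient * ∑ j ∈ Finset.Ico (0 + 1) 112, ∑ p ∈ (S1 m u).filter (fun p => cl u p = j),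
      DD m (yy m u) p * HH m u ^ 2 ≤ u * 1.001 * 1.001 * 847053 := by
    calc _ ≤ ∑ j ∈ Finset.Ico 1 112, u * 1.001 * 1.001 * ((Kn j : ℝ) / j) := by
          rw [Finset.mul_sum]
          apply Finset.sum_le_sum
          intro j hjm
          have hj1 := (Finset.mem_Ico.1 hjm).1
          calc _ ≤ ∑ p ∈ (S1 m u).filter (fun p => cl u p = j), (1:ℝ) / p * ((u + EE m) * Kn j) := by
                rw [Finset.mul_sum]
                apply Finset.sum_le_sum
                intro p hp
                rw [Finset.mem_filter] at hp
                obtain ⟨Q, hQ, hQe⟩ := DD_yy_eq (u := u) (hprime p hp.1) (hdvd p hp.1)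
                have hk := kill_j hm hu0 hn hQ (hprime p hp.1).pos hp.2
                rw [Kn_eq] at hk
                rw [hQe, mul_left_comm]
                have hpinv : (0:ℝ) ≤ 1 / (p:ℝ) := by positivity
                exact mul_le_mul_of_nonneg_left hk hpinv
            _ ≤ ∑ p ∈ pr (Real.exp (j * u)) (Real.exp ((j + 1) * u)), (1:ℝ) / p * ((u + EE m) * Kn j) := by
                apply Finset.sum_le_sum_of_subset_of_nonneg (filter_sub hu0 _ hprime j)
                intro p _ _
                have : 0 ≤ u + EE m := by linarith
                exact mul_nonneg (by positivity) (mul_nonneg this (Nat.cast_nonneg _))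
            _ ≤ 1.001 / j * ((u * 1.001) * Kn j) := by
                rw [← Finset.sum_mul]
                have h1 := hj j hj1
                have h2 : u + EE m ≤ u * 1.001 := by linarith
                have h3 : 0 ≤ u + EE m := by linarith
                have h4 : (0:ℝ) ≤ Kn j := Nat.cast_nonneg _
                exact mul_le_mul h1 (mul_le_mul_of_nonneg_right h2 h4) (mul_nonneg h3 h4) (by positivity)
            _ = _ := by ring
      _ ≤ _ := by
          rw [← Finset.mul_sum]
          exact mul_le_mul_of_nonneg_left sum_Kn (by positivity)
  have : (m:ℝ) / m.totient * ∑ p ∈ (S1 m u).filter (fun p => cl u p = 0), DD m (yy m u) p * HH m u ^ 2 +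
    (m:ℝ) / m.totient * ∑ j ∈ Finset.Ico (0 + 1) 112, ∑ p ∈ (S1 m u).filter (fun p => cl u p = j),
      DD m (yy m u) p * HH m u ^ 2 ≤ u * 1.002 * 819 + u * 1.001 * 1.001 * 847053 := add_le_add hpart0 hpart
  refine this.trans ?_
  nlinarith


lemma Rp_facts {m : ℕ} {u : ℝ} (hu : 1 ≤ u) (hn : Real.exp ((144 : ℕ) * u) ≤ m) {p : ℕ} (hp : p ∈ S2 m u) :
    1 < Rp u p ∧ Rp u p ≤ m ∧ Rp u p ≤ p := by
  have hu0 : 0 < u := by linarith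
  have hc := S2_cl hu0 hp
  have hr := rho_bounds hc.2.1
  have hRz : Rp u p ≤ Real.exp ((112:ℕ) * u) := by
    apply Real.exp_le_exp.2; push_cast; nlinarith
  refine ⟨?_, ?_, ?_⟩
  · unfold Rp; rw [Real.one_lt_exp_iff]; nlinarith
  · refine hRz.trans (le_trans (Real.exp_le_exp.2 ?_) hn)
    push_cast; nlinarith
  · unfold S2 at hp
    rw [Finset.mem_filter, mem_pr] at hp
    exact hRz.trans hp.1.2.1

lemma S2_dvd {m : ℕ} {u : ℝ} (hu : 1 ≤ u) (hY : Real.exp ((340 : ℕ) * u) ≤ m) {p : ℕ} (hp : p ∈ S2 m u) :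
    p ∣ Pm m := by
  unfold S2 at hp
  rw [Finset.mem_filter, mem_pr] at hp
  apply prime_dvd_Pm hp.1.1 hp.2
  have : (p:ℝ) ≤ m := hp.1.2.2.le.trans hY
  exact_mod_cast this

lemma cost_total {m : ℕ} (hm : 3 ≤ m) {u : ℝ} (hu : 1 ≤ u)
    (hn : Real.exp ((144 : ℕ) * u) ≤ m) (hY : Real.exp ((340 : ℕ) * u) ≤ m)
    (hj : ∀ j : ℕ, 1 ≤ j → ∑ p ∈ pr (Real.exp (j * u)) (Real.exp ((j + 1) * u)), (1:ℝ) / p ≤ 1.001 / j) :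
    ∑ p ∈ S2 m u, bb u p * DD m (gy m (Rp u p)) p ≤ (m:ℝ) / m.totient / u * (1.001 * 0.004526) := by
  have hu0 : 0 < u := by linarith
  have hv0 := ratio_pos hm
  set v := (m:ℝ) / m.totient with hv
  have hprime : ∀ p ∈ S2 m u, p.Prime := fun p hp => (S2_cl hu0 hp).2.2.1
  rw [cell_split (S2 m u) (a := 112) (b := 340) (fun p hp => ⟨(S2_cl hu0 hp).1, (S2_cl hu0 hp).2.1⟩)]
  calc _ ≤ ∑ j ∈ Finset.Ico (112:ℕ) 340, v / u * 1.001 * ((1 - (j:ℝ) / 340) / (j * rho j)) := by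
        apply Finset.sum_le_sum
        intro j hjm
        obtain ⟨hj1, hj2⟩ := Finset.mem_Ico.1 hjm
        have hr := rho_bounds hj2
        have hjr : (0:ℝ) < j := by exact_mod_cast (by omega : 0 < j)
        have hj340 : (j:ℝ) ≤ 340 := by exact_mod_cast hj2.le
        have hb0 : 0 ≤ 1 - (j:ℝ) / 340 := by
          rw [sub_nonneg, div_le_one (by norm_num)]; exact hj340
        have hrpos : 0 < rho j := by linarith
        have hc0 : 0 ≤ (1 - (j:ℝ) / 340) * (v / (rho j * u)) :=
          mul_nonneg hb0 (div_nonneg hv0.le (mul_pos hrpos hu0).le)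
        calc _ ≤ ∑ p ∈ (S2 m u).filter (fun p => cl u p = j), (1:ℝ) / p * ((1 - (j:ℝ) / 340) * (v / (rho j * u))) := by
              apply Finset.sum_le_sum
              intro p hp
              rw [Finset.mem_filter] at hp
              obtain ⟨hp, hpj⟩ := hp
              obtain ⟨f1, f2, f3⟩ := Rp_facts hu hn hp
              have h1 := DD_gy f1 f2 (hprime p hp) (S2_dvd hu hY hp) f3
              have h2 := bb_le hu0 hp
              have h3 := bb_nonneg hu0 hp
              rw [hpj] at h2
              have h4 := GG_lower m (by omega) (Rp u p) f1.le
              have h5 : Real.log (Rp u p) = rho j * u := by unfold Rp; rw [Real.log_exp, hpj]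
              rw [h5] at h4
              have hG := GG_ge_one (m := m) f1
              have h6 : 1 / GG m (Rp u p) ≤ v / (rho j * u) := by
                rw [div_le_div_iff₀ (by linarith) (by positivity), one_mul]; exact h4
              have hpp : (0:ℝ) ≤ 1 / (p:ℝ) := by positivity
              calc _ ≤ bb u p * ((1 / p) * (1 / GG m (Rp u p))) := mul_le_mul_of_nonneg_left h1 h3
                _ ≤ (1 - (j:ℝ) / 340) * ((1 / p) * (v / (rho j * u))) := by
                    apply mul_le_mul h2 (mul_le_mul_of_nonneg_left h6 hpp) _ hb0
                    positivity
                _ = _ := by ring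
          _ ≤ ∑ p ∈ pr (Real.exp (j * u)) (Real.exp ((j + 1) * u)), (1:ℝ) / p * ((1 - (j:ℝ) / 340) * (v / (rho j * u))) := by
              apply Finset.sum_le_sum_of_subset_of_nonneg (filter_sub hu0 _ hprime j)
              intro p _ _
              exact mul_nonneg (by positivity) hc0
          _ ≤ 1.001 / j * ((1 - (j:ℝ) / 340) * (v / (rho j * u))) := by
              rw [← Finset.sum_mul]
              exact mul_le_mul_of_nonneg_right (hj j (by omega)) hc0
          _ = _ := by field_simp
    _ ≤ _ := by
        rw [← Finset.mul_sum, mul_assoc]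
        refine mul_le_mul_of_nonneg_left ?_ (by positivity)
        exact mul_le_mul_of_nonneg_left sum_cost (by norm_num)

lemma main_lower {m : ℕ} (hm : 3 ≤ m) {u : ℝ} (hu : 1 ≤ u) (hE : EE m ≤ u / 1000)
    (hn : Real.exp ((144 : ℕ) * u) ≤ m) (hY : Real.exp ((340 : ℕ) * u) ≤ m)
    (h0 : ∑ p ∈ pr 1 (Real.exp u), (Real.log p + EE m) / p ≤ u * 1.002)
    (hj : ∀ j : ℕ, 1 ≤ j → ∑ p ∈ pr (Real.exp (j * u)) (Real.exp ((j + 1) * u)), (1:ℝ) / p ≤ 1.001 / j) :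
    (1:ℝ) / 10000 / u ≤
    1.2 * (DD m (yy m u) 1 - ∑ p ∈ S1 m u, DD m (yy m u) p) - ∑ p ∈ S2 m u, bb u p * DD m (gy m (Rp u p)) p := by
  have hu0 : 0 < u := by linarith
  have hv0 := ratio_pos hm
  have hcost := cost_total hm hu hn hY hj
  have hkill := kill_total hm hu hE hn h0 hj
  have hHu := HH_upper hm hu0 hn
  have hv1 : 1 ≤ (m:ℝ) / m.totient := by
    rw [one_le_div (by exact_mod_cast Nat.totient_pos.2 (by omega))]
    exact_mod_cast Nat.totient_le m
  set v := (m:ℝ) / m.totient with hv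
  have hH := HH_ge m u
  have hH0 : HH m u ≠ 0 := by linarith
  have h1 : (u - EE m) * 1617720 ≤ v * (DD m (yy m u) 1 * HH m u ^ 2) := by
    have := cs_sum_lower hm hu0 hn (fun i => cc i ^ 2) (fun i => sq_nonneg _)
    rw [sum_cc_sq, ← cell_sum hu0 144 (fun i => cc i ^ 2) (fun i hi => by rw [cc_zero hi]; norm_num)] at this
    refine this.trans (le_of_eq ?_)
    rw [DD_one, Finset.sum_mul]
    congr 1
    apply Finset.sum_congr rfl
    intro k _
    unfold yy
    rw [div_pow]
    field_simp
  rw [← Finset.sum_mul] at hkill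
  set A := DD m (yy m u) 1 - ∑ p ∈ S1 m u, DD m (yy m u) p with hA
  have h2 : u * 766531 ≤ v * (A * HH m u ^ 2) := by
    rw [hA, sub_mul, mul_sub]
    linarith
  have h3 : v * HH m u ≤ u * 14055 := by
    refine hHu.trans ?_
    linarith
  have h4 : (v * HH m u) ^ 2 ≤ (u * 14055) ^ 2 := by
    apply pow_le_pow_left₀ (by positivity) h3
  have hA0 : 0 ≤ A := by
    by_contra hneg
    push Not at hneg
    have : v * (A * HH m u ^ 2) ≤ 0 := by
      apply mul_nonpos_of_nonneg_of_nonpos hv0.le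
      exact mul_nonpos_of_nonpos_of_nonneg hneg.le (sq_nonneg _)
    linarith
  have h5 : v / u * (766531 / 14055 ^ 2) ≤ A := by
    have a1 : v * (u * 766531) ≤ A * (u * 14055) ^ 2 := by
      calc v * (u * 766531) ≤ v * (v * (A * HH m u ^ 2)) := mul_le_mul_of_nonneg_left h2 hv0.le
        _ = A * (v * HH m u) ^ 2 := by ring
        _ ≤ _ := mul_le_mul_of_nonneg_left h4 hA0
    rw [div_mul_div_comm, div_le_iff₀ (by positivity)]
    have a2 : u * (v * 766531) ≤ u * (A * (u * 14055 ^ 2)) := by nlinarith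
    exact le_of_mul_le_mul_left a2 hu0
  have h6 : 1 / u ≤ v / u := by gcongr
  have h7 : 0 ≤ 1 / u := by positivity
  have h8 : (1:ℝ) / 10000 / u = 1 / u * (1/10000) := by ring
  rw [h8]
  generalize (1:ℝ) / u = w at *
  norm_num at h5 hcost ⊢
  linarith


noncomputable def WW (m : ℕ) (u : ℝ) (n : ℕ) : ℝ :=
  1.2 * (LL m u n * (1 - ∑ p ∈ S1 m u, if p ∣ n then (1:ℝ) else 0)) -
      (∑ p ∈ S2 m u, if p ∣ n then bb u p * UU m u p n else 0)

lemma sum_WW {m : ℕ} (u : ℝ) (X : ℕ) (r : ℕ → ℝ) :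
    ∑ n ∈ Finset.Icc 1 X, r n * WW m u n =
      1.2 * ((∑ n ∈ Finset.Icc 1 X, if 1 ∣ n then r n * LL m u n else 0) -
        ∑ p ∈ S1 m u, ∑ n ∈ Finset.Icc 1 X, if p ∣ n then r n * LL m u n else 0) -
      ∑ p ∈ S2 m u, bb u p * ∑ n ∈ Finset.Icc 1 X, if p ∣ n then r n * UU m u p n else 0 := by
  simp only [one_dvd, if_true]
  rw [Finset.sum_comm (s := S1 m u)]
  simp_rw [Finset.mul_sum (s := Finset.Icc 1 X)]
  rw [Finset.sum_comm (s := S2 m u), ← Finset.sum_sub_distrib, Finset.mul_sum, ← Finset.sum_sub_distrib]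
  apply Finset.sum_congr rfl
  intro n _
  unfold WW
  rw [mul_sub, Finset.mul_sum (s := S2 m u)]
  congr 1
  · have : ∑ p ∈ S1 m u, (if p ∣ n then r n * LL m u n else 0) =
        (r n * LL m u n) * ∑ p ∈ S1 m u, (if p ∣ n then (1:ℝ) else 0) := by
      rw [Finset.mul_sum]; apply Finset.sum_congr rfl; intro p _; split_ifs <;> simp
    rw [this]; ring
  · apply Finset.sum_congr rfl
    intro p _
    split_ifs
    · ring
    · simp

lemma card_S1 (m : ℕ) (u : ℝ) : ((S1 m u).card : ℝ) ≤ Real.exp ((112:ℕ) * u) := by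
  have hc : (S1 m u).card ≤ ⌊Real.exp ((112:ℕ) * u)⌋₊ := by
    have e : (Finset.Icc 1 ⌊Real.exp ((112:ℕ) * u)⌋₊).card = ⌊Real.exp ((112:ℕ) * u)⌋₊ := by simp
    rw [← e]
    apply Finset.card_le_card
    intro k hk
    unfold S1 at hk
    rw [Finset.mem_filter, mem_pr] at hk
    exact Finset.mem_Icc.2 ⟨hk.1.1.one_le, Nat.le_floor hk.1.2.2.le⟩
  exact (Nat.cast_le.2 hc).trans (Nat.floor_le (Real.exp_pos _).le)

lemma sum_Rp {m : ℕ} (hm : 3 ≤ m) {u : ℝ} (hu : 1 ≤ u) (hY : Real.exp ((340 : ℕ) * u) ≤ m) :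
    ∑ p ∈ S2 m u, Rp u p ^ 2 ≤ Real.exp (400 * u) * Real.exp (EE m / 5) := by
  have hu0 : 0 < u := by linarith
  calc ∑ p ∈ S2 m u, Rp u p ^ 2 ≤ ∑ p ∈ S2 m u, Real.exp (400 * u) * (p:ℝ)⁻¹ := by
        apply Finset.sum_le_sum
        intro p hp
        obtain ⟨h1, h2, h3, _⟩ := S2_cl hu0 hp
        have hr := (rho_bounds h2).2.2
        have hc := ((cl_eq_iff hu0 h3.pos (cl u p)).1 rfl).2
        have hp0 : (0:ℝ) < p := by exact_mod_cast h3.pos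
        rw [← div_eq_mul_inv, le_div_iff₀ hp0]
        calc Rp u p ^ 2 * p ≤ Rp u p ^ 2 * Real.exp ((cl u p + 1) * u) := by gcongr
          _ = Real.exp ((2 * rho (cl u p) + cl u p + 1) * u) := by
              unfold Rp
              rw [← Real.exp_nat_mul, ← Real.exp_add]; congr 1; push_cast; ring
          _ ≤ _ := by
              apply Real.exp_le_exp.2
              nlinarith
    _ = Real.exp (400 * u) * ∑ p ∈ S2 m u, (p:ℝ)⁻¹ := by rw [Finset.mul_sum]
    _ ≤ _ := by
        gcongr
        calc ∑ p ∈ S2 m u, (p:ℝ)⁻¹ ≤ ∑ p ∈ Finset.Icc 1 m, (p:ℝ)⁻¹ := by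
              apply Finset.sum_le_sum_of_subset_of_nonneg
              · intro p hp
                unfold S2 at hp
                rw [Finset.mem_filter, mem_pr] at hp
                have : (p:ℝ) ≤ m := hp.1.2.2.le.trans hY
                exact Finset.mem_Icc.2 ⟨hp.1.1.one_le, by exact_mod_cast this⟩
              · intro p _ _; positivity
          _ ≤ 1 + Real.log m := by
              have := harmonic_le_one_add_log m
              rw [harmonic_eq_sum_Icc] at this
              push_cast at this
              exact this
          _ ≤ _ := log_le_exp_EE hm

lemma sum_lower {m : ℕ} [NeZero m] (hm : 3 ≤ m) {u : ℝ} (hu : 1 ≤ u) (hE : EE m ≤ u / 1000)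
    (hY : Real.exp ((340 : ℕ) * u) ≤ m)
    (h0 : ∑ p ∈ pr 1 (Real.exp u), (Real.log p + EE m) / p ≤ u * 1.002)
    (hj : ∀ j : ℕ, 1 ≤ j → ∑ p ∈ pr (Real.exp (j * u)) (Real.exp ((j + 1) * u)), (1:ℝ) / p ≤ 1.001 / j)
    {X : ℕ} (hX : X ≤ m) (hX2 : m ≤ X * X) (PP : Finset ℕ)
    (hPP : ∀ p ∈ PP, p.Prime ∧ p ≤ X ∧ ¬ p ∣ m) (b : (ZMod m)ˣ) :
    (PP.card : ℝ) ^ 3 * X / m * ((1:ℝ) / 10000 / u) - 4 * ERR m X PP.card * Real.exp (EE m) * Real.exp (400 * u) ≤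
      ∑ n ∈ Finset.Icc 1 X, rr m PP b n * WW m u n := by
  have hu0 : 0 < u := by linarith
  have hn : Real.exp ((144 : ℕ) * u) ≤ m := by
    refine le_trans (Real.exp_le_exp.2 ?_) hY
    push_cast; nlinarith
  have hmain := main_lower hm hu hE hn hY h0 hj
  set Mn := (PP.card : ℝ) ^ 3 * X / m with hMn
  have hMn0 : 0 ≤ Mn := by positivity
  have hER0 : 0 ≤ ERR m X PP.card := by unfold ERR; positivity
  have hPc := Pm_coprime m
  rw [sum_WW]
  set T : ℕ → ℝ := fun q => ∑ n ∈ Finset.Icc 1 X, if q ∣ n then rr m PP b n * LL m u n else 0 with hT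
  set V : ℕ → ℝ := fun p => ∑ n ∈ Finset.Icc 1 X, if p ∣ n then rr m PP b n * UU m u p n else 0 with hV
  set e1 := ERR m X PP.card * (Real.exp ((144:ℕ) * u) * Real.exp (2 * EE m / 5)) ^ 2 with he1
  have hTq : ∀ q : ℕ, 0 < q → q.Coprime m → |T q - Mn * DD m (yy m u) q| ≤ e1 := by
    intro q hq hqm
    have := quad_equidist hm hX hX2 PP hPP b hq hqm hPc (lam (Pm m) (yy m u))
    refine this.trans ?_
    rw [he1]
    refine mul_le_mul_of_nonneg_left ?_ hER0
    refine pow_le_pow_left₀ (Finset.sum_nonneg fun _ _ => abs_nonneg _) ?_ 2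
    exact lam_abs_sum hm hn (Real.exp_pos _).le _ (yy_abs m u) (fun k hk => yy_zero hu0 k hk)
  have hVp : ∀ p ∈ S2 m u, V p ≤ Mn * DD m (gy m (Rp u p)) p +
      ERR m X PP.card * (Rp u p * Real.exp (2 * EE m / 5)) ^ 2 := by
    intro p hp
    obtain ⟨_, _, h3, h4⟩ := S2_cl hu0 hp
    obtain ⟨f1, f2, f3⟩ := Rp_facts hu hn hp
    have := quad_equidist hm hX hX2 PP hPP b h3.pos (h3.coprime_iff_not_dvd.2 h4) hPc (lam (Pm m) (gy m (Rp u p)))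
    have h5 := (abs_le.1 this).2
    have h6 : ERR m X PP.card * (∑ d ∈ (Pm m).divisors, |lam (Pm m) (gy m (Rp u p)) d|) ^ 2 ≤
        ERR m X PP.card * (Rp u p * Real.exp (2 * EE m / 5)) ^ 2 := by
      refine mul_le_mul_of_nonneg_left ?_ hER0
      refine pow_le_pow_left₀ (Finset.sum_nonneg fun _ _ => abs_nonneg _) ?_ 2
      exact lam_abs_sum hm f2 (by linarith) _ (gy_abs f1) (fun k hk => gy_zero k hk)
    change V p - Mn * DD m (gy m (Rp u p)) p ≤ _ at h5
    linarith
  have a1 : Mn * DD m (yy m u) 1 - e1 ≤ T 1 := by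
    have := (abs_le.1 (hTq 1 one_pos (Nat.coprime_one_left m))).1
    linarith
  have a2 : ∑ p ∈ S1 m u, T p ≤ Mn * ∑ p ∈ S1 m u, DD m (yy m u) p + (S1 m u).card * e1 := by
    rw [Finset.mul_sum, ← nsmul_eq_mul, ← Finset.sum_const, ← Finset.sum_add_distrib]
    apply Finset.sum_le_sum
    intro p hp
    obtain ⟨_, h2, h3, _⟩ := S1_cl hu0 hp
    have := (abs_le.1 (hTq p h2.pos (h2.coprime_iff_not_dvd.2 h3))).2
    linarith
  have a3 : ∑ p ∈ S2 m u, bb u p * V p ≤ Mn * (∑ p ∈ S2 m u, bb u p * DD m (gy m (Rp u p)) p) +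
      ERR m X PP.card * Real.exp (4 * EE m / 5) * ∑ p ∈ S2 m u, Rp u p ^ 2 := by
    rw [Finset.mul_sum, Finset.mul_sum, ← Finset.sum_add_distrib]
    apply Finset.sum_le_sum
    intro p hp
    have b0 := bb_nonneg hu0 hp
    have b1 : bb u p ≤ 1 := by
      unfold bb
      have : 0 ≤ Real.log p / (340 * u) := div_nonneg (Real.log_natCast_nonneg p) (by positivity)
      linarith
    have c1 := mul_le_mul_of_nonneg_left (hVp p hp) b0
    have c2 : (Rp u p * Real.exp (2 * EE m / 5)) ^ 2 = Real.exp (4 * EE m / 5) * Rp u p ^ 2 := by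
      rw [mul_pow, ← Real.exp_nat_mul, mul_comm]; congr 2; push_cast; ring
    rw [c2] at c1
    have c3 : 0 ≤ ERR m X PP.card * (Real.exp (4 * EE m / 5) * Rp u p ^ 2) := by positivity
    nlinarith
  have hEE := EE_ge hm
  have he1' : e1 = ERR m X PP.card * Real.exp (4 * EE m / 5) * Real.exp (288 * u) := by
    rw [he1, mul_pow, ← Real.exp_nat_mul, ← Real.exp_nat_mul, mul_assoc]
    congr 1
    rw [mul_comm]
    congr 1 <;> congr 1 <;> push_cast <;> ring
  have a4 : (1 + (S1 m u).card) * e1 ≤ 2 * (ERR m X PP.card * Real.exp (EE m) * Real.exp (400 * u)) := by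
    have hc := card_S1 m u
    have h1 : (1:ℝ) ≤ Real.exp ((112:ℕ) * u) := Real.one_le_exp (by positivity)
    rw [he1']
    calc (1 + ((S1 m u).card : ℝ)) * (ERR m X PP.card * Real.exp (4 * EE m / 5) * Real.exp (288 * u))
        ≤ (2 * Real.exp ((112:ℕ) * u)) * (ERR m X PP.card * Real.exp (EE m) * Real.exp (288 * u)) := by
          gcongr
          · linarith
          · linarith
      _ = 2 * (ERR m X PP.card * Real.exp (EE m) * (Real.exp ((112:ℕ) * u) * Real.exp (288 * u))) := by ring
      _ = _ := by rw [← Real.exp_add]; congr 4; push_cast; ring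
  have a5 : ERR m X PP.card * Real.exp (4 * EE m / 5) * ∑ p ∈ S2 m u, Rp u p ^ 2 ≤
      ERR m X PP.card * Real.exp (EE m) * Real.exp (400 * u) := by
    calc _ ≤ ERR m X PP.card * Real.exp (4 * EE m / 5) * (Real.exp (400 * u) * Real.exp (EE m / 5)) := by
          have := sum_Rp hm hu hY
          gcongr
      _ = ERR m X PP.card * (Real.exp (4 * EE m / 5) * Real.exp (EE m / 5)) * Real.exp (400 * u) := by ring
      _ = _ := by rw [← Real.exp_add]; congr 3; ring
  have a6 := mul_le_mul_of_nonneg_left hmain hMn0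
  have a7 : 0 ≤ ERR m X PP.card * Real.exp (EE m) * Real.exp (400 * u) := by positivity
  change _ ≤ 1.2 * (T 1 - ∑ p ∈ S1 m u, T p) - ∑ p ∈ S2 m u, bb u p * V p
  norm_num at a6 ⊢
  nlinarith

lemma sum_badf (u : ℝ) (hu : 0 < u) (X : ℕ) :
    ∑ n ∈ Finset.Icc 1 X, badf u n ≤ 3 * X / Real.exp ((112:ℕ) * u) := by
  classical
  set z := Real.exp ((112:ℕ) * u) with hz
  have hz0 : 0 < z := Real.exp_pos _
  have hz1 : 1 ≤ z := Real.one_le_exp (by positivity)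
  set k := ⌈z⌉₊ - 1 with hk
  have hck : 1 ≤ ⌈z⌉₊ := Nat.one_le_ceil_iff.2 hz0
  have h1 : ∀ n ∈ Finset.Icc 1 X, badf u n ≤ 1.2 * ∑ d ∈ Finset.Ioo k (X + 1), if d * d ∣ n then (1:ℝ) else 0 := by
    intro n hn
    obtain ⟨hn1, hn2⟩ := Finset.mem_Icc.1 hn
    unfold badf
    have hnn : ∀ d ∈ Finset.Ioo k (X + 1), (0:ℝ) ≤ if d * d ∣ n then (1:ℝ) else 0 := by
      intro d _; split_ifs <;> norm_num
    split_ifs with h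
    · obtain ⟨p, hp, hpz, hpn⟩ := h
      have hple : p ≤ X := by
        have := Nat.le_of_dvd hn1 hpn
        nlinarith [hp.one_le]
      have hpc : ⌈z⌉₊ ≤ p := Nat.ceil_le.2 hpz
      have hpm : p ∈ Finset.Ioo k (X + 1) := Finset.mem_Ioo.2 ⟨by omega, by omega⟩
      have := Finset.single_le_sum hnn hpm
      rw [if_pos hpn] at this
      linarith
    · exact mul_nonneg (by norm_num) (Finset.sum_nonneg hnn)
  refine (Finset.sum_le_sum h1).trans ?_
  rw [← Finset.mul_sum, Finset.sum_comm]
  have h2 : ∀ d ∈ Finset.Ioo k (X + 1), (∑ n ∈ Finset.Icc 1 X, if d * d ∣ n then (1:ℝ) else 0) ≤ X * ((d:ℝ) ^ 2)⁻¹ := by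
    intro d hd
    have hd0 : 0 < d := by have := (Finset.mem_Ioo.1 hd).1; omega
    rw [sum_multiples X (d * d) (by positivity)]
    simp only [Finset.sum_const, Nat.card_Icc, nsmul_eq_mul, mul_one, Nat.add_sub_cancel]
    rw [← div_eq_mul_inv]
    refine Nat.cast_div_le.trans (le_of_eq ?_)
    push_cast; ring
  have h3 := Finset.sum_le_sum h2
  rw [← Finset.mul_sum] at h3
  have h4 := sum_Ioo_inv_sq_le (α := ℝ) k (X + 1)
  have h5 : z ≤ (k:ℝ) + 1 := by
    have : (⌈z⌉₊ : ℝ) = (k:ℝ) + 1 := by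
      rw [hk]; push_cast [hck]; ring
    rw [← this]; exact Nat.le_ceil z
  have h6 : (2:ℝ) / (k + 1) ≤ 2 / z := by gcongr
  have h7 : (X:ℝ) * ∑ d ∈ Finset.Ioo k (X + 1), ((d:ℝ) ^ 2)⁻¹ ≤ X * (2 / z) :=
    mul_le_mul_of_nonneg_left (h4.trans h6) (Nat.cast_nonneg X)
  have h8 : 0 ≤ (X:ℝ) / z := by positivity
  calc _ ≤ 1.2 * ((X:ℝ) * (2 / z)) := by gcongr; exact h3.trans h7
    _ = 2.4 * (X / z) := by ring
    _ ≤ 3 * (X / z) := by nlinarith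
    _ = _ := by ring

/-- the core existence statement -/
lemma core {m : ℕ} [NeZero m] (hm : 3 ≤ m) {u : ℝ} (hu : 1 ≤ u) (hE : EE m ≤ u / 1000)
    (hY : Real.exp ((340 : ℕ) * u) ≤ m)
    (h0 : ∑ p ∈ pr 1 (Real.exp u), (Real.log p + EE m) / p ≤ u * 1.002)
    (hj : ∀ j : ℕ, 1 ≤ j → ∑ p ∈ pr (Real.exp (j * u)) (Real.exp ((j + 1) * u)), (1:ℝ) / p ≤ 1.001 / j)
    {X : ℕ} (hX : X ≤ m) (hX2 : m ≤ X * X) (PP : Finset ℕ)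
    (hPP : ∀ p ∈ PP, p.Prime ∧ p ≤ X ∧ ¬ p ∣ m) (b : (ZMod m)ˣ) (l : ℕ)
    (hX3 : Real.log X ≤ 1600 * u) (hX4 : Real.log X ≤ (l - 0.2) * (340 * u))
    (herr : 4 * ERR m X PP.card * Real.exp (EE m) * Real.exp (400 * u) +
      PP.card * (8 * Real.log m * (X * X / m)) * (3 * X / Real.exp ((112:ℕ) * u)) <
      (PP.card : ℝ) ^ 3 * X / m * ((1:ℝ) / 10000 / u)) :
    ∃ n : ℕ, 0 < n ∧ n ≤ X ∧ n.primeFactorsList.length ≤ l ∧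
      ∃ p₁ ∈ PP, ∃ p₂ ∈ PP, ∃ p₃ ∈ PP, (p₁ : ZMod m) * p₂ * p₃ * n = b := by
  by_contra hcon
  push Not at hcon
  have hu0 : 0 < u := by linarith
  have hn : Real.exp ((144 : ℕ) * u) ≤ m := by
    refine le_trans (Real.exp_le_exp.2 ?_) hY
    push_cast; nlinarith
  have hlow := sum_lower hm hu hE hY h0 hj hX hX2 PP hPP b
  have hup : ∑ n ∈ Finset.Icc 1 X, rr m PP b n * WW m u n ≤
      PP.card * (8 * Real.log m * (X * X / m)) * (3 * X / Real.exp ((112:ℕ) * u)) := by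
    have hbad0 : ∀ n, 0 ≤ badf u n := by
      intro n; unfold badf; split_ifs <;> norm_num
    have hlog0 : 0 ≤ Real.log m := Real.log_natCast_nonneg m
    calc _ ≤ ∑ n ∈ Finset.Icc 1 X, PP.card * (8 * Real.log m * (X * X / m)) * badf u n := by
          apply Finset.sum_le_sum
          intro n hnm
          obtain ⟨hn1, hn2⟩ := Finset.mem_Icc.1 hnm
          have hr0 := rr_nonneg m PP b n
          refine le_trans ?_ (mul_le_mul_of_nonneg_right (rr_le hm hX hX2 PP hPP b n) (hbad0 n))
          by_cases hr : rr m PP b n = 0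
          · rw [hr]; simp
          · refine mul_le_mul_of_nonneg_left ?_ hr0
            obtain ⟨p₁, h₁, p₂, h₂, p₃, h₃, he⟩ := rr_pos_iff hr
            have hlen : l + 1 ≤ n.primeFactorsList.length := by
              by_contra h
              exact hcon n hn1 hn2 (by omega) p₁ h₁ p₂ h₂ p₃ h₃ he
            have hcop : n.Coprime m := by
              rw [← ZMod.isUnit_iff_coprime]
              have : IsUnit ((p₁ : ZMod m) * p₂ * p₃ * n) := by rw [he]; exact b.isUnit
              exact isUnit_of_mul_isUnit_right this
            have hlogn : Real.log n ≤ Real.log X := by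
              apply Real.log_le_log
              · exact_mod_cast hn1
              · exact_mod_cast hn2
            exact W_le hm hu hE hn (by omega) (hlogn.trans hX3) (hlogn.trans hX4) hcop hlen
      _ = PP.card * (8 * Real.log m * (X * X / m)) * ∑ n ∈ Finset.Icc 1 X, badf u n := by rw [Finset.mul_sum]
      _ ≤ _ := mul_le_mul_of_nonneg_left (sum_badf u hu0 X) (by positivity)
  linarith


lemma herr_real {N X m L e G Z u : ℝ} (hN : 0 < N) (hX : 0 < X) (hm : 0 < m) (hL : 1 ≤ L) (hLe : L ≤ e)
    (he : 4 * 10 ^ 8 ≤ e) (hG : 0 < G) (hZ : 0 < Z) (hu : 0 < u) (huL : u ≤ L)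
    (hNX : X ≤ N * e ^ 2) (h1 : e ^ 24 * (m * G ^ 2) ≤ 4 * X ^ 2) (h2 : e ^ 7 * G ≤ 2 * X) (h3 : e ^ 7 ≤ Z) :
    4 * (Real.sqrt (30720 * L ^ 4 * (X * N) ^ 3 / m) + N ^ 3 / m) * e ^ 5 * G +
      N * (8 * L * (X * X / m)) * (3 * X / Z) < N ^ 3 * X / m * (1 / 10000 / u) := by
  have hL0 : 0 < L := by linarith
  have he0 : 0 < e := by linarith
  set A := N ^ 3 * X / m with hA
  have hA0 : 0 < A := by positivity
  set δ := 1 / (40000 * L) with hδ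
  have hδ0 : 0 < δ := by positivity
  -- first term
  have t1 : 4 * Real.sqrt (30720 * L ^ 4 * (X * N) ^ 3 / m) * e ^ 5 * G ≤ A * δ := by
    set B := δ / (4 * e ^ 5 * G) with hB
    have hB0 : 0 < B := by positivity
    have hs : Real.sqrt (30720 * L ^ 4 * (X * N) ^ 3 / m) ≤ A * B := by
      rw [Real.sqrt_le_iff]
      refine ⟨by positivity, ?_⟩
      have hN3 : X ^ 3 ≤ N ^ 3 * e ^ 6 := by
        calc X ^ 3 ≤ (N * e ^ 2) ^ 3 := by gcongr
          _ = _ := by ring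
      have key : 30720 * L ^ 4 * X * m * (160000 * L * e ^ 5 * G) ^ 2 ≤ N ^ 3 := by
        have c1 : 30720 * 4 * 160000 ^ 2 * (L ^ 6 * e ^ 16 * (m * G ^ 2)) ≤ 4 * X ^ 2 := by
          have : L ^ 6 ≤ e ^ 6 := by gcongr
          have hee : (30720 * 4 * 160000 ^ 2 : ℝ) ≤ e ^ 2 := by nlinarith
          calc 30720 * 4 * 160000 ^ 2 * (L ^ 6 * e ^ 16 * (m * G ^ 2))
              ≤ e ^ 2 * (e ^ 6 * e ^ 16 * (m * G ^ 2)) := by gcongr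
            _ = e ^ 24 * (m * G ^ 2) := by ring
            _ ≤ _ := h1
        have c2 : (30720 * L ^ 4 * X * m * (160000 * L * e ^ 5 * G) ^ 2) * e ^ 6 ≤ N ^ 3 * e ^ 6 := by
          refine le_trans ?_ hN3
          calc (30720 * L ^ 4 * X * m * (160000 * L * e ^ 5 * G) ^ 2) * e ^ 6
              = X * (30720 * 4 * 160000 ^ 2 * (L ^ 6 * e ^ 16 * (m * G ^ 2))) / 4 := by ring
            _ ≤ X * (4 * X ^ 2) / 4 := by gcongr
            _ = X ^ 3 := by ring
        exact le_of_mul_le_mul_right c2 (by positivity)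
      have hBe : B = 1 / (160000 * L * e ^ 5 * G) := by
        rw [hB, hδ]; field_simp; norm_num
      have : (A * B) ^ 2 = N ^ 3 * (N ^ 3 * X ^ 2 / m ^ 2 / (160000 * L * e ^ 5 * G) ^ 2) := by
        rw [hBe, hA]; field_simp
      rw [this]
      calc 30720 * L ^ 4 * (X * N) ^ 3 / m =
          (30720 * L ^ 4 * X * m * (160000 * L * e ^ 5 * G) ^ 2) *
            (N ^ 3 * X ^ 2 / m ^ 2 / (160000 * L * e ^ 5 * G) ^ 2) := by field_simp
        _ ≤ _ := by gcongr
    calc 4 * Real.sqrt (30720 * L ^ 4 * (X * N) ^ 3 / m) * e ^ 5 * G ≤ 4 * (A * B) * e ^ 5 * G := by gcongr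
      _ = A * δ := by rw [hB]; field_simp
  have t2 : 4 * (N ^ 3 / m) * e ^ 5 * G ≤ A * δ := by
    have c1 : 160000 * L * e ^ 5 * G ≤ X := by
      have : 160000 * 2 * (L * e ^ 5 * G) ≤ e * (e * e ^ 5 * G) := by
        gcongr
        linarith
      nlinarith
    have : A * δ = (N ^ 3 / m / (40000 * L)) * X := by rw [hA, hδ]; field_simp
    rw [this]
    calc 4 * (N ^ 3 / m) * e ^ 5 * G = (N ^ 3 / m / (40000 * L)) * (160000 * L * e ^ 5 * G) := by
          field_simp; norm_num
      _ ≤ _ := by gcongr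
  have t3 : N * (8 * L * (X * X / m)) * (3 * X / Z) ≤ A * δ := by
    have hN2 : X ^ 2 ≤ N ^ 2 * e ^ 4 := by
      calc X ^ 2 ≤ (N * e ^ 2) ^ 2 := by gcongr
        _ = _ := by ring
    have c1 : 960000 * L ^ 2 * X ^ 2 ≤ N ^ 2 * Z := by
      calc 960000 * L ^ 2 * X ^ 2 ≤ e * e ^ 2 * (N ^ 2 * e ^ 4) := by
            gcongr
            linarith
        _ = N ^ 2 * e ^ 7 := by ring
        _ ≤ _ := by gcongr
    have e1 : N * (8 * L * (X * X / m)) * (3 * X / Z) = (960000 * L ^ 2 * X ^ 2) * (N * X / m / Z / (40000 * L)) := by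
      field_simp; norm_num
    have e2 : A * δ = (N ^ 2 * Z) * (N * X / m / Z / (40000 * L)) := by
      rw [hA, hδ]; field_simp
    rw [e1, e2]
    gcongr
  have t4 : 3 * (A * δ) < A * (1 / 10000 / u) := by
    have : 3 * δ < 1 / 10000 / u := by
      rw [hδ, div_div, mul_one_div, div_lt_div_iff₀ (by positivity) (by positivity)]
      nlinarith
    nlinarith
  nlinarith


lemma tendsto_logN : Filter.Tendsto (fun m : ℕ => Real.log m) Filter.atTop Filter.atTop :=
  Real.tendsto_log_atTop.comp tendsto_natCast_atTop_atTop

lemma ev_rpow {r : ℝ} (hr : r < 1) {η : ℝ} (hη : 0 < η) :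
    ∀ᶠ L : ℝ in Filter.atTop, L ^ r ≤ η * L := by
  have h := (tendsto_rpow_neg_atTop (y := 1 - r) (by linarith)).eventually_le_const hη
  filter_upwards [h, Filter.eventually_ge_atTop 1] with L h1 h2
  have h0 : 0 < L := by linarith
  calc L ^ r = L ^ (-(1 - r)) * L ^ (1:ℝ) := by rw [← Real.rpow_add h0]; congr 1; ring
    _ ≤ η * L := by rw [Real.rpow_one]; exact mul_le_mul_of_nonneg_right h1 h0.le

lemma ev_EE {η : ℝ} (hη : 0 < η) : ∀ᶠ m : ℕ in Filter.atTop, EE m ≤ η * Real.log m := by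
  have h := tendsto_logN.eventually (ev_rpow (r := 3/4) (by norm_num) (η := η / 100) (by positivity))
  filter_upwards [h] with m hm
  unfold EE
  linarith

lemma ev_EElog {η : ℝ} (hη : 0 < η) :
    ∀ᶠ m : ℕ in Filter.atTop, EE m * (2 + 2 * Real.log (Real.log m)) ≤ η * Real.log m := by
  have h := tendsto_logN.eventually (ev_rpow (r := 7/8) (by norm_num) (η := η / 400) (by positivity))
  have h2 := tendsto_logN.eventually
    ((isLittleO_log_rpow_atTop (r := 1/8) (by norm_num)).def (c := 1) one_pos)
  filter_upwards [h, h2, tendsto_logN.eventually_ge_atTop 1] with m hm h2 h3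
  have h0 : 0 < Real.log m := by linarith
  have h4 : Real.log (Real.log m) ≤ Real.log m ^ (1/8 : ℝ) := by
    rw [one_mul, Real.norm_of_nonneg (Real.rpow_nonneg h0.le _)] at h2
    exact (le_abs_self _).trans h2
  have h5 : 1 ≤ Real.log m ^ (1/8 : ℝ) := Real.one_le_rpow h3 (by norm_num)
  have h6 : Real.log m ^ (7/8:ℝ) = Real.log m ^ (3/4:ℝ) * Real.log m ^ (1/8:ℝ) := by
    rw [← Real.rpow_add h0]; norm_num
  unfold EE
  have h7 : 0 ≤ Real.log m ^ (3/4:ℝ) := Real.rpow_nonneg h0.le _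
  calc 100 * Real.log m ^ (3/4:ℝ) * (2 + 2 * Real.log (Real.log m))
      ≤ 100 * Real.log m ^ (3/4:ℝ) * (4 * Real.log m ^ (1/8:ℝ)) := by
        apply mul_le_mul_of_nonneg_left _ (by positivity); linarith
    _ = 400 * Real.log m ^ (7/8:ℝ) := by rw [h6]; ring
    _ ≤ η * Real.log m := by linarith

lemma ev_h0 {c : ℝ} (hc : 0 < c) (hc1 : c ≤ 1) : ∀ᶠ m : ℕ in Filter.atTop,
    ∑ p ∈ pr 1 (Real.exp (c * Real.log m)), (Real.log p + EE m) / p ≤ c * Real.log m * 1.002 := by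
  obtain ⟨C1, hC1, M1⟩ := mertens_interval
  obtain ⟨C3, hC3, M3⟩ := mertens_loglog
  filter_upwards [ev_EElog (η := 0.001 * c / C3) (by positivity),
    tendsto_logN.eventually_ge_atTop 1, tendsto_logN.eventually_ge_atTop (1000 * C1 / c),
    tendsto_logN.eventually_ge_atTop (1 / c), Filter.eventually_ge_atTop 3] with m h1 h2 h3 h4 hm
  set L := Real.log m
  have hu1 : 1 ≤ c * L := by rw [div_le_iff₀ hc] at h4; linarith
  have hC : C1 ≤ 0.001 * (c * L) := by rw [div_le_iff₀ hc] at h3; linarith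
  have hE : 0 ≤ EE m := by linarith [EE_ge hm]
  obtain ⟨s, hs1, hs2⟩ : ∃ s : ℕ, c * L ≤ 2 ^ s ∧ (s : ℝ) + 1 ≤ 2 + 2 * Real.log L := by
    refine ⟨⌈Real.logb 2 (c * L)⌉₊, ?_, ?_⟩
    · have := Nat.le_ceil (Real.logb 2 (c * L))
      rw [← Real.rpow_natCast]
      calc c * L = 2 ^ (Real.logb 2 (c * L)) := by
            rw [Real.rpow_logb (by norm_num) (by norm_num) (by linarith)]
        _ ≤ _ := Real.rpow_le_rpow_of_exponent_le (by norm_num) this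
    · have h5 : 0 ≤ Real.logb 2 (c * L) := Real.logb_nonneg (by norm_num) hu1
      have := Nat.ceil_lt_add_one h5
      have h6 : Real.logb 2 (c * L) ≤ 2 * Real.log L := by
        unfold Real.logb
        rw [div_le_iff₀ (Real.log_pos (by norm_num))]
        have h7 : Real.log (c * L) ≤ Real.log L := Real.log_le_log (by linarith) (by nlinarith)
        have h8 := Real.log_two_gt_d9
        have h9 : 0 ≤ Real.log L := Real.log_nonneg h2
        nlinarith
      linarith
  have hsplit : ∑ p ∈ pr 1 (Real.exp (c * L)), (Real.log p + EE m) / p =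
      ∑ p ∈ pr 1 (Real.exp (c * L)), Real.log p / p + EE m * ∑ p ∈ pr 1 (Real.exp (c * L)), (1:ℝ) / p := by
    rw [Finset.mul_sum, ← Finset.sum_add_distrib]
    apply Finset.sum_congr rfl; intros; ring
  have hA := M1 1 (Real.exp (c * L)) le_rfl (Real.one_le_exp (by linarith))
  rw [Real.log_exp, Real.log_one] at hA
  have hB : ∑ p ∈ pr 1 (Real.exp (c * L)), (1:ℝ) / p ≤ C3 * (s + 1) := by
    refine le_trans (Finset.sum_le_sum_of_subset_of_nonneg ?_ ?_) (M3 s)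
    · intro p hp
      rw [mem_pr] at hp ⊢
      exact ⟨hp.1, hp.2.1, hp.2.2.trans_le (Real.exp_le_exp.mpr hs1)⟩
    · intros; positivity
  have hD : EE m * ∑ p ∈ pr 1 (Real.exp (c * L)), (1:ℝ) / p ≤ 0.001 * c * L := by
    calc _ ≤ EE m * (C3 * (2 + 2 * Real.log L)) := by
          apply mul_le_mul_of_nonneg_left _ hE
          exact hB.trans (mul_le_mul_of_nonneg_left hs2 hC3.le)
      _ = C3 * (EE m * (2 + 2 * Real.log L)) := by ring
      _ ≤ C3 * (0.001 * c / C3 * L) := mul_le_mul_of_nonneg_left h1 hC3.le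
      _ = _ := by field_simp
  rw [hsplit]
  linarith

lemma ev_hj {c : ℝ} (hc : 0 < c) : ∀ᶠ m : ℕ in Filter.atTop, ∀ j : ℕ, 1 ≤ j →
    ∑ p ∈ pr (Real.exp (j * (c * Real.log m))) (Real.exp ((j + 1) * (c * Real.log m))), (1:ℝ) / p
      ≤ 1.001 / j := by
  obtain ⟨C2, hC2, M2⟩ := mertens_recip
  filter_upwards [tendsto_logN.eventually_ge_atTop 1,
    tendsto_logN.eventually_ge_atTop (1000 * C2 / c)] with m h2 h3 j hj
  set L := Real.log m
  have hu : 0 < c * L := by positivity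
  have hC : C2 ≤ 0.001 * (c * L) := by rw [div_le_iff₀ hc] at h3; linarith
  have hj' : (1:ℝ) ≤ j := by exact_mod_cast hj
  refine (M2 (j * (c * L)) ((j + 1) * (c * L)) (by positivity) (by linarith)).trans ?_
  rw [div_le_div_iff₀ (by positivity) (by positivity)]
  nlinarith

lemma PP_card (m X : ℕ) (hm : m ≠ 0) :
    (Nat.primeCounting X : ℝ) ≤
      (((Finset.range (X+1)).filter Nat.Prime) \ m.primeFactors).card + 2 * Real.log m := by
  have h1 := card_primeFactors_le m hm
  have h2 : Nat.primeCounting X = ((Finset.range (X+1)).filter Nat.Prime).card := by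
    rw [Nat.primeCounting, Nat.primeCounting', Nat.count_eq_card_filter_range]
  have h3 := Finset.le_card_sdiff m.primeFactors ((Finset.range (X+1)).filter Nat.Prime)
  rw [← h2] at h3
  have h4 : (Nat.primeCounting X : ℝ) ≤
    (((Finset.range (X+1)).filter Nat.Prime) \ m.primeFactors).card + m.primeFactors.card := by
    exact_mod_cast (by omega)
  linarith

set_option maxHeartbeats 1000000 in
lemma asymp (l : ℕ) {σ g ε : ℝ} (hε : 0 < ε) (hg : g = σ - 1/2 - ε/2) (hσ : σ ≤ 1) (hg0 : 0 < g)
    (hs4 : σ ≤ 4 * g) (hsl : σ ≤ 0.85 * (l - 0.2) * g) :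
    ∀ᶠ m : ℕ in Filter.atTop, ∀ [NeZero m], ∀ b : (ZMod m)ˣ,
      ∃ n X : ℕ, (X : ℝ) ≤ (m:ℝ) ^ σ ∧ 0 < n ∧ n ≤ X ∧ n.primeFactorsList.length ≤ l ∧
      ∃ p₁ p₂ p₃ : ℕ, p₁.Prime ∧ p₂.Prime ∧ p₃.Prime ∧ p₁ ≤ X ∧ p₂ ≤ X ∧ p₃ ≤ X ∧
        (p₁ : ZMod m) * p₂ * p₃ * n = b := by
  have hc : 0 < g / 400 := by positivity
  have hg1 : g ≤ 1/2 := by linarith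
  have hσ0 : 0 < σ := by linarith
  filter_upwards [ev_h0 hc (by linarith), ev_hj hc, ev_EE (η := g / 400 / 1000) (by positivity),
    ev_EE (η := ε / 10) (by positivity), ev_EE (η := 1 / 10) (by positivity),
    ev_EE (η := g / 10) (by positivity),
    tendsto_logN.eventually_ge_atTop (400 / g), Filter.eventually_ge_atTop 3]
    with m h0 hj hE hE1 hE2 hE3 hL hm _ b
  set L := Real.log m with hLdef
  have hL1 : 1 ≤ L := log_ge_one hm
  have hEg : 100 ≤ EE m := EE_ge hm
  set u := g / 400 * L with hu
  have hu1 : 1 ≤ u := by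
    rw [div_le_iff₀ hg0] at hL; rw [hu]; linarith
  have hm0 : (0:ℝ) < m := by positivity
  have hmexp : (m:ℝ) = Real.exp L := (Real.exp_log hm0).symm
  have hpow : (m:ℝ) ^ σ = Real.exp (σ * L) := by
    rw [Real.rpow_def_of_pos hm0, mul_comm]
  set X := ⌊(m:ℝ) ^ σ⌋₊ with hX
  have hXle : (X:ℝ) ≤ (m:ℝ) ^ σ := Nat.floor_le (by positivity)
  have hX1 : (1:ℝ) ≤ (m:ℝ) ^ σ := by rw [hpow]; exact Real.one_le_exp (by positivity)
  have hX1' : 1 ≤ X := (Nat.one_le_floor_iff _).mpr hX1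
  have hXR : (1:ℝ) ≤ X := by exact_mod_cast hX1'
  have hXge : (m:ℝ) ^ σ ≤ 2 * X := by
    have := Nat.lt_floor_add_one ((m:ℝ) ^ σ)
    linarith
  have hXm : X ≤ m := by
    have : (X:ℝ) ≤ m := by
      refine hXle.trans ?_
      rw [hpow]; rw [hmexp]; exact Real.exp_le_exp.mpr (by nlinarith)
    exact_mod_cast this
  have hlogX : Real.log X ≤ σ * L := by
    rw [← Real.log_exp (σ * L), ← hpow]
    exact Real.log_le_log (by linarith) hXle
  set e := Real.exp (EE m / 5) with he
  have hek : ∀ k : ℕ, e ^ k = Real.exp (k * (EE m / 5)) := fun k => (Real.exp_nat_mul _ _).symm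
  have heL : 1 + L ≤ e := log_le_exp_EE hm
  have he8 : 4 * 10 ^ 8 ≤ e := by
    have h1 : Real.exp 20 ≤ e := Real.exp_le_exp.mpr (by linarith)
    have h2 : Real.exp 20 = Real.exp 1 ^ 20 := by rw [← Real.exp_nat_mul]; norm_num
    have h3 : (2.718:ℝ) ^ 20 ≤ Real.exp 1 ^ 20 :=
      pow_le_pow_left₀ (by norm_num) (by linarith [Real.exp_one_gt_d9]) _
    have h4 : (4 * 10 ^ 8 : ℝ) ≤ 2.718 ^ 20 := by norm_num
    linarith
  have h1 : e ^ 24 * (m * Real.exp (400 * u) ^ 2) ≤ 4 * (X:ℝ) ^ 2 := by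
    have : e ^ 24 * (m * Real.exp (400 * u) ^ 2) ≤ ((m:ℝ) ^ σ) ^ 2 := by
      rw [hpow, hek]; rw [hmexp]
      rw [← Real.exp_nat_mul, ← Real.exp_nat_mul, ← Real.exp_add, ← Real.exp_add]
      apply Real.exp_le_exp.mpr
      push_cast
      rw [hu, hg]
      linarith
    have h' : ((m:ℝ) ^ σ) ^ 2 ≤ (2 * X) ^ 2 := pow_le_pow_left₀ (by positivity) hXge 2
    linarith
  have h2 : e ^ 7 * Real.exp (400 * u) ≤ 2 * (X:ℝ) := by
    refine le_trans ?_ hXge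
    rw [hpow, hek, ← Real.exp_add]
    apply Real.exp_le_exp.mpr
    push_cast
    rw [hu, hg]
    have : 0 < ε * L := by positivity
    linarith
  have h3 : e ^ 7 ≤ Real.exp (112 * u) := by
    rw [hek]
    apply Real.exp_le_exp.mpr
    push_cast
    rw [hu]
    have : 0 < g * L := by positivity
    linarith
  have hG1 : 1 ≤ Real.exp (400 * u) := Real.one_le_exp (by linarith)
  have hX2 : m ≤ X * X := by
    have a1 : (4:ℝ) ≤ e ^ 24 := by
      have : e ^ 1 ≤ e ^ 24 := pow_le_pow_right₀ (by linarith) (by norm_num)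
      linarith
    have a2 : (m:ℝ) ≤ m * Real.exp (400 * u) ^ 2 :=
      le_mul_of_one_le_right hm0.le (one_le_pow₀ hG1)
    have a3 : 4 * (m:ℝ) ≤ e ^ 24 * (m * Real.exp (400 * u) ^ 2) :=
      mul_le_mul a1 a2 hm0.le (by positivity)
    have : (m:ℝ) ≤ X * X := by
      rw [← pow_two]; linarith
    exact_mod_cast this
  set PP := ((Finset.range (X+1)).filter Nat.Prime) \ m.primeFactors with hPPd
  have hPP : ∀ p ∈ PP, p.Prime ∧ p ≤ X ∧ ¬ p ∣ m := by
    intro p hp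
    rw [hPPd, Finset.mem_sdiff, Finset.mem_filter, Finset.mem_range] at hp
    refine ⟨hp.1.2, by omega, fun hd => hp.2 ?_⟩
    exact Nat.mem_primeFactors.mpr ⟨hp.1.2, hd, by omega⟩
  have hXbig : 200 * L ^ 2 ≤ (X:ℝ) := by
    have a1 : e ^ 7 ≤ 2 * (X:ℝ) := le_trans (le_mul_of_one_le_right (by positivity) hG1) h2
    have a2 : e ^ 3 ≤ e ^ 7 := pow_le_pow_right₀ (by linarith) (by norm_num)
    have a3 : L ^ 2 ≤ e ^ 2 := pow_le_pow_left₀ (by linarith) (by linarith) 2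
    have a4 : 400 * L ^ 2 ≤ e * e ^ 2 := mul_le_mul (by linarith) a3 (by positivity) (by linarith)
    have a5 : e ^ 3 = e * e ^ 2 := by ring
    linarith
  have hN4 : (X:ℝ) ≤ 8 * PP.card * L := by
    have a1 := PP_card m X (by omega)
    rw [← hPPd] at a1
    have a2 := Chebyshev.pi_ge X
    have a3 : 1 < (X:ℝ) := by
      have := one_le_pow₀ hL1 (n := 2)
      linarith
    rw [div_le_iff₀ (Real.log_pos a3)] at a2
    have a4 : Real.log X ≤ L := Real.log_le_log (by linarith) (by exact_mod_cast hXm)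
    have a5 : Real.log ((X:ℝ) + 1) ≤ 2 * L := by
      have : (2:ℝ) * L = Real.log ((m:ℝ) ^ 2) := by rw [Real.log_pow]; simp [hLdef]
      rw [this]
      apply Real.log_le_log (by linarith)
      have : (X:ℝ) ≤ m := by exact_mod_cast hXm
      have : (3:ℝ) ≤ m := by exact_mod_cast hm
      nlinarith
    have a6 := Real.log_two_gt_d9
    have a7 : (Nat.primeCounting X : ℝ) * Real.log X ≤ (PP.card + 2 * L) * L :=
      mul_le_mul a1 a4 (Real.log_pos a3).le
        (add_nonneg (Nat.cast_nonneg _) (by linarith))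
    have a8 : (X:ℝ) * 0.69 ≤ X * Real.log 2 := mul_le_mul_of_nonneg_left (by linarith) (by linarith)
    have a9 : L ≤ L ^ 2 := by
      have := mul_le_mul_of_nonneg_right hL1 (by linarith : 0 ≤ L)
      rw [pow_two]; linarith
    linarith
  have hN0 : (0:ℝ) < PP.card := by
    by_contra hcon
    have : (0:ℝ) ≤ PP.card := Nat.cast_nonneg _
    have : (PP.card : ℝ) = 0 := by linarith
    rw [this] at hN4
    linarith
  have hNX : (X:ℝ) ≤ PP.card * e ^ 2 := by
    have b1 : 8 * L ≤ e * e := mul_le_mul (by linarith) (by linarith) (by linarith) (by linarith)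
    have b2 : PP.card * (8 * L) ≤ PP.card * (e * e) := mul_le_mul_of_nonneg_left b1 hN0.le
    have b3 : e ^ 2 = e * e := by ring
    rw [b3]
    linarith
  have herr := herr_real (N := PP.card) (X := X) (m := m) (L := L) (e := e)
    (G := Real.exp (400 * u)) (Z := Real.exp (112 * u)) (u := u) hN0 (by linarith) hm0 hL1
    (by linarith) he8 (Real.exp_pos _) (Real.exp_pos _) (by linarith) (by
      have := mul_le_mul_of_nonneg_right (by linarith : g / 400 ≤ 1) (by linarith : 0 ≤ L)
      rw [hu]; linarith) hNX h1 h2 h3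
  have he5 : e ^ 5 = Real.exp (EE m) := by rw [hek]; congr 1; push_cast; ring
  obtain ⟨n, hn0, hnX, hnl, p₁, hp₁, p₂, hp₂, p₃, hp₃, heq⟩ :=
    core hm hu1 (by rw [hu]; linarith) (by
      rw [hmexp]
      apply Real.exp_le_exp.mpr
      push_cast
      have := mul_le_mul_of_nonneg_right (by linarith : g ≤ 1) (by linarith : 0 ≤ L)
      rw [hu]; linarith) h0 hj hXm hX2 PP hPP b l
      (hlogX.trans (by
        have := mul_le_mul_of_nonneg_right hs4 (by linarith : 0 ≤ L)
        rw [hu]; linarith)) (hlogX.trans (by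
        have := mul_le_mul_of_nonneg_right hsl (by linarith : 0 ≤ L)
        rw [hu]; linarith)) (by
        rw [he5] at herr
        unfold ERR
        push_cast
        exact herr)
  exact ⟨n, X, hXle, hn0, hnX, hnl, p₁, p₂, p₃, (hPP _ hp₁).1, (hPP _ hp₂).1, (hPP _ hp₃).1,
    (hPP _ hp₁).2.1, (hPP _ hp₂).2.1, (hPP _ hp₃).2.1, heq⟩

lemma params (l : ℕ) (hl : 3 ≤ l) : 2 < greavesTheta l ∧
    4 * greavesTheta l ≤ 0.85 * (l - 0.2) * (greavesTheta l + 2) := by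
  unfold greavesTheta greavesDelta
  rcases (show l = 3 ∨ l = 4 ∨ 5 ≤ l by omega) with rfl | rfl | h
  · norm_num
  · norm_num
  · rw [if_neg (by omega), if_neg (by omega), if_neg (by omega)]
    have : (5:ℝ) ≤ l := by exact_mod_cast h
    constructor
    · linarith
    · nlinarith

theorem stmt_6 (l : ℕ) (hl : 3 ≤ l) (α : ℝ)
    (hα : α = 2 * greavesTheta l / (3 * greavesTheta l - 2)) :
    ∀ ε : ℝ, 0 < ε → ∃ M : ℕ, ∀ m : ℕ, M ≤ m → ∀ a : ℤ, Int.gcd a m = 1 →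
      ∃ p₁ p₂ p₃ s : ℕ, p₁.Prime ∧ p₂.Prime ∧ p₃.Prime ∧
        (p₁ : ℝ) ≤ (m : ℝ) ^ (α + ε) ∧ (p₂ : ℝ) ≤ (m : ℝ) ^ (α + ε) ∧
        (p₃ : ℝ) ≤ (m : ℝ) ^ (α + ε) ∧
        0 < s ∧ (s : ℝ) ≤ (m : ℝ) ^ (α + ε) ∧ s.primeFactorsList.length ≤ l ∧
        ((p₁ * p₂ * p₃ * s : ℕ) : ℤ) ≡ a [ZMOD (m : ℤ)] := by
  intro ε hε
  obtain ⟨hθ, hp⟩ := params l hl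
  set θ := greavesTheta l
  have hd : 0 < 3 * θ - 2 := by linarith
  have hα' : α * (3 * θ - 2) = 2 * θ := by rw [hα]; exact div_mul_cancel₀ _ hd.ne'
  have hα1 : α < 1 := by rw [hα, div_lt_one hd]; linarith
  have hα2 : 2/3 < α := by rw [hα, lt_div_iff₀ hd]; linarith
  have hl' : (3:ℝ) ≤ l := by exact_mod_cast hl
  have hα3 : α ≤ 0.85 * (l - 0.2) * (α - 1/2) := by
    have e1 : α - 1/2 = (θ + 2) / (2 * (3 * θ - 2)) := by
      rw [eq_div_iff (by positivity)]
      linarith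
    rw [e1, hα, ← mul_div_assoc, div_le_div_iff₀ hd (by positivity)]
    nlinarith
  set ε' := min ε (1 - α) with hε'
  have h1 : 0 < ε' := lt_min hε (by linarith)
  have h2 : ε' ≤ ε := min_le_left _ _
  have h3 : ε' ≤ 1 - α := min_le_right _ _
  have h := asymp l (σ := α + ε') (g := α - 1/2 + ε'/2) h1 (by ring) (by linarith) (by linarith)
    (by linarith) (by nlinarith)
  obtain ⟨M, hM⟩ := Filter.eventually_atTop.mp h
  refine ⟨max M 1, fun m hm a ha => ?_⟩
  have hm1 : 1 ≤ m := (le_max_right _ _).trans hm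
  have : NeZero m := ⟨by omega⟩
  have hu : IsUnit (a : ZMod m) := by
    rw [ZMod.coe_int_isUnit_iff_isCoprime, Int.isCoprime_iff_gcd_eq_one, Int.gcd_comm]
    exact ha
  obtain ⟨b, hb⟩ := hu
  obtain ⟨n, X, hX, hn0, hnX, hnl, p₁, p₂, p₃, q1, q2, q3, r1, r2, r3, heq⟩ :=
    hM m ((le_max_left _ _).trans hm) b
  have key : ∀ k : ℕ, k ≤ X → (k:ℝ) ≤ (m:ℝ) ^ (α + ε) := by
    intro k hk
    have a1 : (k:ℝ) ≤ X := by exact_mod_cast hk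
    refine a1.trans (hX.trans ?_)
    exact Real.rpow_le_rpow_of_exponent_le (by exact_mod_cast hm1) (by linarith)
  refine ⟨p₁, p₂, p₃, n, q1, q2, q3, key _ r1, key _ r2, key _ r3, hn0, key _ hnX, hnl, ?_⟩
  rw [← ZMod.intCast_eq_intCast_iff]
  push_cast
  rw [heq, hb]
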